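/- arXiv:1504.06143 — 2 statements merged into one kernel-verified Lean document; each statement's English description precedes it below -/
import Mathlib

section
/- Reverse hypercontractivity for the boolean cube (Borell): Let f : {0,1}^n → ℝ be non-negative and fix real numbers p, q with −∞ < q ≤ p ≤ 1, p ≠ 0, q ≠ 0 (if p < 0, assume f is strictly positive). Then for all γ with 0 ≤ γ ≤ √((1−p)/(1−q)), one has ‖T_γ(f)‖_q ≥ ‖f‖_p. -/
open Matrix
open scoped ComplexOrder

noncomputable section

/-- Apply a real function to a Hermitian matrix via the functional calculus
(junk value `0` on non-Hermitian matrices). -/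
def hermFC {ι : Type*} [Fintype ι] [DecidableEq ι] (φ : ℝ → ℝ)
    (f : Matrix ι ι ℂ) : Matrix ι ι ℂ :=
  if hf : f.IsHermitian then
    (hf.eigenvectorUnitary : Matrix ι ι ℂ) *
      Matrix.diagonal (fun i => (φ (hf.eigenvalues i) : ℂ)) *
      (star hf.eigenvectorUnitary : Matrix ι ι ℂ)
  else 0

/-- Real matrix powers of a Hermitian matrix, via the functional calculus on eigenvalues. -/
def mpow {ι : Type*} [Fintype ι] [DecidableEq ι] (f : Matrix ι ι ℂ) (a : ℝ) :
    Matrix ι ι ℂ :=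
  hermFC (fun x => x ^ a) f

/-- The normalized trace `τ(f) = Tr f / d` (real part). -/
def ntrace {ι : Type*} [Fintype ι] [DecidableEq ι] (f : Matrix ι ι ℂ) : ℝ :=
  (f.trace).re / (Fintype.card ι)

/-- Normalized Schatten p-'norm': `‖f‖_p = ((1/d) Tr |f|^p)^(1/p)` with `|f| = √(f† f)`. -/
def snorm {ι : Type*} [Fintype ι] [DecidableEq ι] (p : ℝ) (f : Matrix ι ι ℂ) : ℝ :=
  (ntrace (mpow (fᴴ * f) (p / 2))) ^ (1 / p)

/-- The entropy `Ent(f) = τ(f ln f) − τ(f) ln τ(f)`. -/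
def mEnt {ι : Type*} [Fintype ι] [DecidableEq ι] (f : Matrix ι ι ℂ) : ℝ :=
  ntrace (hermFC (fun x => x * Real.log x) f) - ntrace f * Real.log (ntrace f)

/-- The Dirichlet form `E_L(f,g) = τ(f L(g))`. -/
def dirichlet {ι : Type*} [Fintype ι] [DecidableEq ι]
    (L : Matrix ι ι ℂ → Matrix ι ι ℂ) (f g : Matrix ι ι ℂ) : ℝ :=
  ntrace (f * L g)

/-- Complete positivity: every matrix extension `id_m ⊗ T` maps PSD matrices to PSD matrices. -/
def IsCompletelyPositive {ι : Type*} [Fintype ι] [DecidableEq ι]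
    (T : Matrix ι ι ℂ → Matrix ι ι ℂ) : Prop :=
  ∀ (m : ℕ) (M : Matrix (Fin m × ι) (Fin m × ι) ℂ), M.PosSemidef →
    (Matrix.of fun p q : Fin m × ι =>
      T (Matrix.of fun i j : ι => M (p.1, i) (q.1, j)) p.2 q.2).PosSemidef

/-- A quantum channel: a linear, completely positive, trace-preserving map. -/
def IsQChannel {ι : Type*} [Fintype ι] [DecidableEq ι]
    (T : Matrix ι ι ℂ → Matrix ι ι ℂ) : Prop :=
  IsLinearMap ℂ T ∧ IsCompletelyPositive T ∧ ∀ f, (T f).trace = f.trace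

/-- Reversibility (detailed balance w.r.t. the trace): `τ(f T(g)) = τ(T(f) g)`. -/
def IsReversible {ι : Type*} [Fintype ι] [DecidableEq ι]
    (T : Matrix ι ι ℂ → Matrix ι ι ℂ) : Prop :=
  ∀ f g : Matrix ι ι ℂ, (f * T g).trace = (T f * g).trace

/-- Primitivity: iterates of `T` converge on every density matrix to a fixed
full-rank state independent of the input. -/
def IsPrimitive {ι : Type*} [Fintype ι] [DecidableEq ι]
    (T : Matrix ι ι ℂ → Matrix ι ι ℂ) : Prop :=
  ∃ σ : Matrix ι ι ℂ, σ.PosDef ∧ σ.trace = 1 ∧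
    ∀ ρ : Matrix ι ι ℂ, ρ.PosSemidef → ρ.trace = 1 →
      Filter.Tendsto (fun k => T^[k] ρ) Filter.atTop (nhds σ)

/-- The depolarizing channel with parameter `γ` applied to the `k`-th qubit of `n` qubits:
`D_γ(f) = γ f + (1−γ) (tr_k f) ⊗_k (I/2)`. -/
def depolAt {n : ℕ} (γ : ℝ) (k : Fin n)
    (f : Matrix (Fin n → Fin 2) (Fin n → Fin 2) ℂ) :
    Matrix (Fin n → Fin 2) (Fin n → Fin 2) ℂ :=
  Matrix.of fun x y =>
    (γ : ℂ) * f x y +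
      ((1 - γ : ℝ) : ℂ) *
        (if x k = y k then
          (1 / 2) * ∑ b : Fin 2, f (Function.update x k b) (Function.update y k b)
        else 0)

/-- The tensor power `D_γ^{⊗n}` of the qubit depolarizing channel, acting on `n` qubits. -/
def depolChannel {n : ℕ} (γ : ℝ)
    (f : Matrix (Fin n → Fin 2) (Fin n → Fin 2) ℂ) :
    Matrix (Fin n → Fin 2) (Fin n → Fin 2) ℂ :=
  (List.finRange n).foldl (fun g k => depolAt γ k g) f

/-- The semigroup element `e^{−tL}` applied to `f`, defined by its power series. -/
def opExp {ι : Type*} [Fintype ι] [DecidableEq ι]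
    (L : Matrix ι ι ℂ → Matrix ι ι ℂ) (t : ℝ) (f : Matrix ι ι ℂ) : Matrix ι ι ℂ :=
  ∑' k : ℕ, (((-t) ^ k / (Nat.factorial k) : ℝ) : ℂ) • L^[k] f

/-- The classical noise operator `T_γ` on functions on the boolean cube:
each bit is flipped independently with probability `(1−γ)/2`. -/
def noiseOp {n : ℕ} (γ : ℝ) (f : (Fin n → Fin 2) → ℝ) : (Fin n → Fin 2) → ℝ :=
  fun x => ∑ y : Fin n → Fin 2,
    (∏ i : Fin n, if y i = x i then (1 + γ) / 2 else (1 - γ) / 2) * f y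

/-- The normalized `ℓ_p` 'norm' `‖f‖_p = (2^{-n} Σ_x |f(x)|^p)^{1/p}` on the boolean cube. -/
def lpnorm {n : ℕ} (p : ℝ) (f : (Fin n → Fin 2) → ℝ) : ℝ :=
  ((∑ x : Fin n → Fin 2, |f x| ^ p) / 2 ^ n) ^ (1 / p)

end

/-- The two-point logarithmic Sobolev inequality on the ordered half. -/
theorem two_point_entropy_le_of_le {u v : ℝ} (hv : 0 < v) (huv : v ≤ u) :
    (u ^ 2 * Real.log (u ^ 2) + v ^ 2 * Real.log (v ^ 2)) / 2
      - (u ^ 2 + v ^ 2) / 2 * Real.log ((u ^ 2 + v ^ 2) / 2) ≤ (u - v) ^ 2 / 2 := by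
  set ψ : ℝ → ℝ := fun t => (t ^ 2 * Real.log (t ^ 2) + v ^ 2 * Real.log (v ^ 2)) / 2
      - (t ^ 2 + v ^ 2) / 2 * Real.log ((t ^ 2 + v ^ 2) / 2) - (t - v) ^ 2 / 2 with hψ
  have hder : ∀ t, v ≤ t → HasDerivAt ψ
      (t * (Real.log (t ^ 2) - Real.log ((t ^ 2 + v ^ 2) / 2)) - (t - v)) t := by
    intro t ht
    have ht0 : 0 < t := hv.trans_le ht
    have h1 : HasDerivAt (fun t : ℝ => t ^ 2) (2 * t) t := by simpa using hasDerivAt_pow 2 t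
    have h2 := h1.log (by positivity)
    have h3 : HasDerivAt (fun t : ℝ => (t ^ 2 + v ^ 2) / 2) t t := by
      refine ((h1.add_const (v ^ 2)).div_const 2).congr_deriv ?_
      ring
    have h4 := h3.log (by positivity)
    have h5 : HasDerivAt (fun t : ℝ => (t - v) ^ 2 / 2) (t - v) t := by
      refine ((((hasDerivAt_id t).sub_const v).pow 2).div_const 2).congr_deriv ?_
      simp
    refine (((((h1.mul h2).add_const (v ^ 2 * Real.log (v ^ 2))).div_const 2).sub
      (h3.mul h4)).sub h5).congr_deriv ?_
    field_simp
    ring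
  have hanti : AntitoneOn ψ (Set.Ici v) := by
    refine antitoneOn_of_hasDerivWithinAt_nonpos (convex_Ici v)
      (fun t ht => (hder t ht).continuousAt.continuousWithinAt)
      (fun t ht => (hder t (interior_subset ht)).hasDerivWithinAt) ?_
    intro t ht
    have ht : v ≤ t := interior_subset ht
    have ht0 : 0 < t := hv.trans_le ht
    set s := Real.sqrt ((t ^ 2 + v ^ 2) / 2) with hs
    have hs0 : 0 < s := Real.sqrt_pos.2 (by positivity)
    have hss : s ^ 2 = (t ^ 2 + v ^ 2) / 2 := Real.sq_sqrt (by positivity)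
    have hst : s ≤ t := by
      apply Real.sqrt_le_iff.2 ⟨ht0.le, by nlinarith⟩
    have hvs : (t + v) / 2 ≤ s := by
      apply Real.le_sqrt_of_sq_le
      nlinarith [sq_nonneg (t - v)]
    have hw : 0 ≤ Real.log (t / s) := Real.log_nonneg (by rwa [le_div_iff₀ hs0, one_mul])
    have hlog := Real.self_le_sinh_iff.2 hw
    rw [Real.sinh_eq, Real.exp_neg, Real.exp_log (by positivity),
      Real.log_div ht0.ne' hs0.ne'] at hlog
    rw [← hss, Real.log_pow, Real.log_pow]
    have h1 : t * (t / s - (t / s)⁻¹) ≤ t - v := by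
      have : t * (t / s - (t / s)⁻¹) = (t - v) * ((t + v) / 2) / s := by
        field_simp
        linarith
      rw [this, div_le_iff₀ hs0]
      exact mul_le_mul_of_nonneg_left hvs (by linarith)
    push_cast
    nlinarith [mul_le_mul_of_nonneg_left hlog ht0.le]
  have h := hanti (Set.mem_Ici.2 le_rfl) huv huv
  have h0 : ψ v = 0 := by
    have : (v ^ 2 + v ^ 2) / 2 = v ^ 2 := by ring
    simp only [hψ, this]
    ring
  rw [h0] at h
  simp only [hψ] at h
  linarith

/-- The two-point logarithmic Sobolev inequality. -/
theorem two_point_entropy_le {u v : ℝ} (hu : 0 < u) (hv : 0 < v) :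
    (u ^ 2 * Real.log (u ^ 2) + v ^ 2 * Real.log (v ^ 2)) / 2
      - (u ^ 2 + v ^ 2) / 2 * Real.log ((u ^ 2 + v ^ 2) / 2) ≤ (u - v) ^ 2 / 2 := by
  rcases le_total v u with h | h
  · exact two_point_entropy_le_of_le hv h
  · have := two_point_entropy_le_of_le hu h
    rw [add_comm (v ^ 2), add_comm (v ^ 2 * _), ← neg_sub u v, neg_sq] at this
    exact this

/-- The two-point Stroock–Varopoulos inequality for exponents below one. -/
theorem stroock_varopoulos_of_lt_one {a b q : ℝ} (hb : 0 < b) (hab : b ≤ a) (hq1 : q < 1)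
    (hq0 : q ≠ 0) :
    (a ^ (q / 2) - b ^ (q / 2)) ^ 2
      ≤ q ^ 2 / (4 * (1 - q)) * ((a - b) * (b ^ (q - 1) - a ^ (q - 1))) := by
  have hq : 0 < 1 - q := by linarith
  have hquad : ∀ l : ℝ, 0 ≤ (b ^ (q - 1) - a ^ (q - 1)) / (1 - q) * (l * l)
      + (-(4 / q) * (a ^ (q / 2) - b ^ (q / 2))) * l + (a - b) := by
    intro l
    have hder : ∀ t, b ≤ t → HasDerivAt
        (fun t : ℝ => -(l ^ 2 / (1 - q)) * t ^ (q - 1) - l * (4 / q) * t ^ (q / 2) + t)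
        ((l * t ^ (q / 2 - 1) - 1) ^ 2) t := by
      intro t ht
      have ht0 : 0 < t := hb.trans_le ht
      refine ((((Real.hasDerivAt_rpow_const (p := q - 1) (Or.inl ht0.ne')).const_mul
        (-(l ^ 2 / (1 - q)))).sub ((Real.hasDerivAt_rpow_const (p := q / 2)
        (Or.inl ht0.ne')).const_mul (l * (4 / q)))).add (hasDerivAt_id t)).congr_deriv ?_
      have : t ^ (q - 1 - 1) = (t ^ (q / 2 - 1)) ^ 2 := by
        rw [← Real.rpow_natCast, ← Real.rpow_mul ht0.le]
        congr 1
        push_cast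
        ring
      rw [this]
      field_simp
      ring
    have hmono := monotoneOn_of_hasDerivWithinAt_nonneg (convex_Ici b)
      (fun t ht => (hder t ht).continuousAt.continuousWithinAt)
      (fun t ht => (hder t (interior_subset ht)).hasDerivWithinAt)
      (fun t _ => sq_nonneg _) (Set.mem_Ici.2 le_rfl) hab hab
    simp only at hmono
    have e : (b ^ (q - 1) - a ^ (q - 1)) / (1 - q) * (l * l)
      + (-(4 / q) * (a ^ (q / 2) - b ^ (q / 2))) * l + (a - b)
      = (-(l ^ 2 / (1 - q)) * a ^ (q - 1) - l * (4 / q) * a ^ (q / 2) + a)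
        - (-(l ^ 2 / (1 - q)) * b ^ (q - 1) - l * (4 / q) * b ^ (q / 2) + b) := by ring
    rw [e]
    linarith
  have h := discrim_le_zero hquad
  rw [discrim] at h
  have hq2 : 0 < q ^ 2 := by positivity
  have e : (-(4 / q) * (a ^ (q / 2) - b ^ (q / 2))) ^ 2
      - 4 * ((b ^ (q - 1) - a ^ (q - 1)) / (1 - q)) * (a - b)
      = 16 / q ^ 2 * ((a ^ (q / 2) - b ^ (q / 2)) ^ 2
      - q ^ 2 / (4 * (1 - q)) * ((a - b) * (b ^ (q - 1) - a ^ (q - 1)))) := by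
    field_simp
    ring
  rw [e] at h
  have := nonpos_of_mul_nonpos_right h (by positivity)
  linarith

/-- The logarithm of the `q`-th power mean of `1 ± c / √(1 - q)`. -/
noncomputable def logPowMean (c q : ℝ) : ℝ :=
  q⁻¹ * Real.log (((1 + c / √(1 - q)) ^ q + (1 - c / √(1 - q)) ^ q) / 2)

theorem exists_hasDerivAt_logPowMean_nonpos {c q : ℝ} (hc : 0 ≤ c) (hq1 : q < 1) (hq0 : q ≠ 0)
    (hcq : c < √(1 - q)) : ∃ d ≤ 0, HasDerivAt (logPowMean c) d q := by
  have hq : 0 < 1 - q := by linarith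
  have hs : 0 < √(1 - q) := Real.sqrt_pos.2 hq
  have hss : √(1 - q) ^ 2 = 1 - q := Real.sq_sqrt hq.le
  set y := c / √(1 - q) with hy
  have hy0 : 0 ≤ y := by positivity
  have hy1 : y < 1 := by rwa [hy, div_lt_one hs]
  have hA : 0 < 1 + y := by linarith
  have hB : 0 < 1 - y := by linarith
  have hdy : HasDerivAt (fun t : ℝ => c / √(1 - t)) (y / (2 * (1 - q))) q := by
    have h1 : HasDerivAt (fun t : ℝ => 1 - t) (-1) q := by
      simpa using (hasDerivAt_id q).const_sub 1
    refine ((hasDerivAt_const q c).div (h1.sqrt hq.ne') hs.ne').congr_deriv ?_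
    rw [hss, hy]
    field_simp
    rw [hss]
    ring
  have hAq := (hdy.const_add 1).rpow (hasDerivAt_id q) hA
  have hBq := (hdy.const_sub 1).rpow (hasDerivAt_id q) hB
  have hE : 0 < ((1 + y) ^ q + (1 - y) ^ q) / 2 := by positivity
  have hlog := ((hAq.add hBq).div_const 2).log hE.ne'
  have hF := (hasDerivAt_inv hq0).mul hlog
  refine ⟨_, ?_, hF⟩
  have hpow : ∀ x : ℝ, 0 < x → (x ^ (q / 2)) ^ 2 = x ^ q := by
    intro x hx
    rw [← Real.rpow_natCast, ← Real.rpow_mul hx.le]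
    congr 1
    push_cast
    ring
  have hent := two_point_entropy_le (Real.rpow_pos_of_pos hA (q / 2))
    (Real.rpow_pos_of_pos hB (q / 2))
  rw [hpow _ hA, hpow _ hB, Real.log_rpow hA, Real.log_rpow hB] at hent
  have hsv := stroock_varopoulos_of_lt_one (a := 1 + y) (b := 1 - y) hB (by linarith) hq1 hq0
  simp only [id, Pi.add_apply, ← hy]
  set E := ((1 + y) ^ q + (1 - y) ^ q) / 2 with hE_def
  set a := (1 + y) ^ (q - 1)
  set b := (1 - y) ^ (q - 1)
  have hkey : q * (y / (2 * (1 - q)) * q * (a - b)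
      + (1 + y) ^ q * Real.log (1 + y) + (1 - y) ^ q * Real.log (1 - y)) / 2
      - E * Real.log E ≤ 0 := by
    have e : q ^ 2 / (4 * (1 - q)) * ((1 + y - (1 - y)) * (b - a))
        = 2 * (q * (y / (2 * (1 - q)) * q * (b - a)) / 2) := by
      field_simp
      ring
    rw [e] at hsv
    linarith
  have e : ∀ L : ℝ, -(q ^ 2)⁻¹ * L + q⁻¹ * ((y / (2 * (1 - q)) * q * a
      + 1 * (1 + y) ^ q * Real.log (1 + y) + (-(y / (2 * (1 - q))) * q * b
      + 1 * (1 - y) ^ q * Real.log (1 - y))) / 2 / E)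
      = (q ^ 2 * E)⁻¹ * (q * (y / (2 * (1 - q)) * q * (a - b)
      + (1 + y) ^ q * Real.log (1 + y) + (1 - y) ^ q * Real.log (1 - y)) / 2 - E * L) := by
    intro L
    field_simp
    ring
  rw [e]
  exact mul_nonpos_of_nonneg_of_nonpos (by positivity) hkey

theorem rpow_one_div_le_rpow_one_div {q x y : ℝ} (hq : q ≠ 0) (hx : 0 < x) (hy : 0 < y)
    (hpos : 0 < q → x ≤ y) (hneg : q < 0 → y ≤ x) : x ^ (1 / q) ≤ y ^ (1 / q) := by
  rcases hq.lt_or_gt with h | h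
  · exact Real.rpow_le_rpow_of_nonpos hy (hneg h) (one_div_neg.2 h).le
  · exact Real.rpow_le_rpow hx.le (hpos h) (one_div_pos.2 h).le

theorem le_rpow_one_div {q w x : ℝ} (hq : q ≠ 0) (hw : 0 < w) (hx : 0 < x)
    (hpos : 0 < q → w ^ q ≤ x) (hneg : q < 0 → x ≤ w ^ q) : w ≤ x ^ (1 / q) := by
  have h := rpow_one_div_le_rpow_one_div hq (Real.rpow_pos_of_pos hw q) hx hpos hneg
  rwa [one_div, Real.rpow_rpow_inv hw.le hq, ← one_div] at h

theorem add_rpow_le_rpow_add_of_mem_unit {a b s t r : ℝ} (ha : 0 ≤ a) (hb : 0 ≤ b)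
    (hab : a + b = 1) (hs : 0 < s) (ht : 0 < t) (hr0 : 0 ≤ r) (hr1 : r ≤ 1) :
    a * s ^ r + b * t ^ r ≤ (a * s + b * t) ^ r :=
  (Real.concaveOn_rpow hr0 hr1).2 (Set.mem_Ici.2 hs.le) (Set.mem_Ici.2 ht.le) ha hb hab

theorem rpow_add_le_add_rpow_of_nonpos_or_one_le {a b s t r : ℝ} (ha : 0 ≤ a) (hb : 0 ≤ b)
    (hab : a + b = 1) (hs : 0 < s) (ht : 0 < t) (hr : r ≤ 0 ∨ 1 ≤ r) :
    (a * s + b * t) ^ r ≤ a * s ^ r + b * t ^ r := by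
  rcases hr with hr | hr
  · have hst : 0 < s ^ a * t ^ b := by positivity
    calc (a * s + b * t) ^ r ≤ (s ^ a * t ^ b) ^ r :=
          Real.rpow_le_rpow_of_nonpos hst
            (Real.geom_mean_le_arith_mean2_weighted ha hb hs.le ht.le hab) hr
      _ = (s ^ r) ^ a * (t ^ r) ^ b := by
          rw [Real.mul_rpow (by positivity) (by positivity), ← Real.rpow_mul hs.le,
            ← Real.rpow_mul ht.le, ← Real.rpow_mul hs.le, ← Real.rpow_mul ht.le,
            mul_comm a, mul_comm b]
      _ ≤ a * s ^ r + b * t ^ r :=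
          Real.geom_mean_le_arith_mean2_weighted ha hb (by positivity) (by positivity) hab
  · exact (convexOn_rpow hr).2 (Set.mem_Ici.2 hs.le) (Set.mem_Ici.2 ht.le) ha hb hab

/-- The power mean of two numbers with exponent `p`. -/
noncomputable def powMean (p a b : ℝ) : ℝ := ((a ^ p + b ^ p) / 2) ^ (1 / p)

theorem powMean_pos {p a b : ℝ} (ha : 0 < a) (hb : 0 < b) : 0 < powMean p a b := by
  unfold powMean
  positivity

theorem powMean_comm (p a b : ℝ) : powMean p a b = powMean p b a := by
  rw [powMean, powMean, add_comm]

theorem powMean_rpow {p a b : ℝ} (hp : p ≠ 0) (ha : 0 < a) (hb : 0 < b) :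
    powMean p a b ^ p = (a ^ p + b ^ p) / 2 := by
  rw [powMean, one_div, Real.rpow_inv_rpow (by positivity) hp]

theorem powMean_mul {p l a b : ℝ} (hp : p ≠ 0) (hl : 0 < l) (ha : 0 < a) (hb : 0 < b) :
    powMean p (l * a) (l * b) = l * powMean p a b := by
  rw [powMean, powMean, Real.mul_rpow hl.le ha.le, Real.mul_rpow hl.le hb.le, ← mul_add,
    mul_div_assoc, Real.mul_rpow (by positivity) (by positivity), one_div,
    Real.rpow_rpow_inv hl.le hp]

theorem powMean_le_powMean {p a b a' b' : ℝ} (hp : p ≠ 0) (ha : 0 < a) (hb : 0 < b)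
    (haa : a ≤ a') (hbb : b ≤ b') : powMean p a b ≤ powMean p a' b' := by
  have ha' := ha.trans_le haa
  have hb' := hb.trans_le hbb
  refine rpow_one_div_le_rpow_one_div hp (by positivity) (by positivity) (fun h => ?_)
    (fun h => ?_)
  · have := Real.rpow_le_rpow ha.le haa h.le
    have := Real.rpow_le_rpow hb.le hbb h.le
    linarith
  · have := Real.rpow_le_rpow_of_nonpos ha haa h.le
    have := Real.rpow_le_rpow_of_nonpos hb hbb h.le
    linarith

theorem powMean_spread_antitone {q x y : ℝ} (hq0 : q ≠ 0) (hq1 : q ≤ 1) (hx : 0 ≤ x)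
    (hxy : x ≤ y) (hy : y < 1) :
    powMean q (1 + y) (1 - y) ≤ powMean q (1 + x) (1 - x) := by
  rcases (hx.trans hxy).eq_or_lt with rfl | hy0
  · rw [le_antisymm hxy hx]
  have hA : 0 < 1 + y := by linarith
  have hB : 0 < 1 - y := by linarith
  have hA' : 0 < 1 + x := by linarith
  have hB' : 0 < 1 - x := by linarith
  set t := x / y with ht
  have hty : t * y = x := div_mul_cancel₀ x hy0.ne'
  have ht1 : t ≤ 1 := (div_le_one hy0).2 hxy
  have ht0 : 0 ≤ t := by positivity
  have e1 : 1 + x = (1 + t) / 2 * (1 + y) + (1 - t) / 2 * (1 - y) := by rw [← hty]; ring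
  have e2 : 1 - x = (1 - t) / 2 * (1 + y) + (1 + t) / 2 * (1 - y) := by rw [← hty]; ring
  have h1 : 0 ≤ (1 + t) / 2 := by linarith
  have h2 : 0 ≤ (1 - t) / 2 := by linarith
  refine rpow_one_div_le_rpow_one_div hq0 (by positivity) (by positivity) (fun h => ?_)
    (fun h => ?_)
  · have i1 := add_rpow_le_rpow_add_of_mem_unit h1 h2 (by ring) hA hB h.le hq1
    have i2 := add_rpow_le_rpow_add_of_mem_unit h2 h1 (by ring) hA hB h.le hq1
    rw [e1, e2]
    linarith
  · have i1 := rpow_add_le_add_rpow_of_nonpos_or_one_le h1 h2 (by ring) hA hB (Or.inl h.le)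
    have i2 := rpow_add_le_add_rpow_of_nonpos_or_one_le h2 h1 (by ring) hA hB (Or.inl h.le)
    rw [e1, e2]
    linarith

theorem logPowMean_antitoneOn {c : ℝ} (hc : 0 ≤ c) {D : Set ℝ} (hD : Convex ℝ D)
    (h : ∀ t ∈ D, t < 1 ∧ t ≠ 0 ∧ c < √(1 - t)) : AntitoneOn (logPowMean c) D := by
  have key := fun t ht =>
    exists_hasDerivAt_logPowMean_nonpos hc (h t ht).1 (h t ht).2.1 (h t ht).2.2
  refine antitoneOn_of_deriv_nonpos hD ?_ ?_ ?_
  · intro t ht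
    obtain ⟨d, -, hd⟩ := key t ht
    exact hd.continuousAt.continuousWithinAt
  · intro t ht
    obtain ⟨d, -, hd⟩ := key t (interior_subset ht)
    exact hd.differentiableAt.differentiableWithinAt
  · intro t ht
    obtain ⟨d, hd0, hd⟩ := key t (interior_subset ht)
    rwa [hd.deriv]

/-- The first-order bound on the logarithmic power mean near exponent zero. -/
noncomputable def logPowMeanBound (c q : ℝ) : ℝ :=
  ((1 + c / √(1 - q)) ^ q * Real.log (1 + c / √(1 - q))
    + (1 - c / √(1 - q)) ^ q * Real.log (1 - c / √(1 - q))) / 2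

theorem continuousAt_logPowMeanBound {c : ℝ} (hc : 0 ≤ c) (hc1 : c < 1) :
    ContinuousAt (logPowMeanBound c) 0 := by
  have hy : ContinuousAt (fun q : ℝ => c / √(1 - q)) 0 := by
    refine ContinuousAt.div (by fun_prop) (by fun_prop) (by simp)
  have hA : ContinuousAt (fun q : ℝ => 1 + c / √(1 - q)) 0 := by fun_prop
  have hB : ContinuousAt (fun q : ℝ => 1 - c / √(1 - q)) 0 := by fun_prop
  have hA0 : (1 + c / √(1 - 0) : ℝ) ≠ 0 := by simp; linarith
  have hB0 : (1 - c / √(1 - 0) : ℝ) ≠ 0 := by simp; linarith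
  exact (((hA.rpow continuousAt_id (Or.inl hA0)).mul (hA.log hA0)).add
    ((hB.rpow continuousAt_id (Or.inl hB0)).mul (hB.log hB0))).div_const 2

theorem log_mean_rpow_le {c q : ℝ} (hc : 0 ≤ c) (hq1 : q < 1) (hcq : c < √(1 - q)) :
    Real.log (((1 + c / √(1 - q)) ^ q + (1 - c / √(1 - q)) ^ q) / 2)
      ≤ q * logPowMeanBound c q := by
  have hs : 0 < √(1 - q) := Real.sqrt_pos.2 (by linarith)
  unfold logPowMeanBound
  set y := c / √(1 - q) with hy
  have hy0 : 0 ≤ y := by positivity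
  have hy1 : y < 1 := by rwa [hy, div_lt_one hs]
  have hA : 0 < 1 + y := by linarith
  have hB : 0 < 1 - y := by linarith
  have key : ∀ x : ℝ, 0 < x → x ^ q - 1 ≤ q * (x ^ q * Real.log x) := by
    intro x hx
    have hxq := Real.rpow_pos_of_pos hx q
    have h := Real.one_sub_inv_le_log_of_pos hxq
    rw [Real.log_rpow hx] at h
    have := mul_le_mul_of_nonneg_left h hxq.le
    rw [mul_sub, mul_inv_cancel₀ hxq.ne'] at this
    linarith
  have h := Real.log_le_sub_one_of_pos (x := ((1 + y) ^ q + (1 - y) ^ q) / 2) (by positivity)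
  linarith [key _ hA, key _ hB]

theorem logPowMean_le_logPowMean {c p q : ℝ} (hc : 0 ≤ c) (hqp : q ≤ p) (hp1 : p < 1)
    (hp0 : p ≠ 0) (hq0 : q ≠ 0) (hcp : c < √(1 - p)) : logPowMean c p ≤ logPowMean c q := by
  have hct : ∀ t ≤ p, c < √(1 - t) := fun t ht =>
    hcp.trans_le (Real.sqrt_le_sqrt (by linarith))
  rcases hp0.lt_or_gt with hp | hp
  · refine logPowMean_antitoneOn hc (convex_Icc q p) (fun t ht => ?_) (Set.left_mem_Icc.2 hqp)
      (Set.right_mem_Icc.2 hqp) hqp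
    exact ⟨by linarith [ht.2], by linarith [ht.2], hct t ht.2⟩
  rcases hq0.lt_or_gt with hq | hq
  · have hc1 : c < 1 := by simpa using hct 0 hp.le
    have hcont := continuousAt_logPowMeanBound hc hc1
    have h1 : logPowMean c p ≤ logPowMeanBound c 0 := by
      refine ge_of_tendsto (hcont.tendsto.mono_left nhdsWithin_le_nhds)
        (?_ : ∀ᶠ t in nhdsWithin 0 (Set.Ioi 0), logPowMean c p ≤ logPowMeanBound c t)
      filter_upwards [Ioc_mem_nhdsGT hp] with t ht
      have h := logPowMean_antitoneOn hc (convex_Ioc 0 p)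
        (fun s hs => ⟨by linarith [hs.2], hs.1.ne', hct s hs.2⟩) ht (Set.right_mem_Ioc.2 hp) ht.2
      refine h.trans ?_
      have := log_mean_rpow_le hc (ht.2.trans_lt hp1) (hct t ht.2)
      rw [logPowMean, inv_mul_le_iff₀ ht.1]
      exact this
    have h2 : logPowMeanBound c 0 ≤ logPowMean c q := by
      refine le_of_tendsto (hcont.tendsto.mono_left nhdsWithin_le_nhds)
        (?_ : ∀ᶠ t in nhdsWithin 0 (Set.Iio 0), logPowMeanBound c t ≤ logPowMean c q)
      filter_upwards [Ico_mem_nhdsLT hq] with t ht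
      have h := logPowMean_antitoneOn hc (convex_Ico q 0)
        (fun s hs => ⟨by linarith [hs.2], hs.2.ne, hct s (hs.2.le.trans hp.le)⟩)
        (Set.left_mem_Ico.2 hq) ht ht.1
      refine le_trans ?_ h
      have := log_mean_rpow_le hc (ht.2.trans zero_lt_one) (hct t (ht.2.le.trans hp.le))
      have := mul_le_mul_of_nonpos_left this (inv_lt_zero.2 ht.2).le
      rwa [inv_mul_cancel_left₀ ht.2.ne] at this
    exact h1.trans h2
  · refine logPowMean_antitoneOn hc (convex_Icc q p) (fun t ht => ?_) (Set.left_mem_Icc.2 hqp)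
      (Set.right_mem_Icc.2 hqp) hqp
    exact ⟨by linarith [ht.2], by linarith [ht.1], hct t ht.2⟩

theorem powMean_eq_exp_logPowMean {c q : ℝ} (hc : 0 ≤ c) (hcq : c < √(1 - q)) :
    powMean q (1 + c / √(1 - q)) (1 - c / √(1 - q)) = Real.exp (logPowMean c q) := by
  have hs : 0 < √(1 - q) := hc.trans_lt hcq
  have hy1 : c / √(1 - q) < 1 := by rwa [div_lt_one hs]
  have hy0 : 0 ≤ c / √(1 - q) := by positivity
  have hB : 0 < 1 - c / √(1 - q) := by linarith
  rw [powMean, logPowMean, Real.rpow_def_of_pos (by positivity), one_div, mul_comm]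

theorem powMean_one_add_one_sub_le {p q a γ : ℝ} (hqp : q ≤ p) (hp1 : p ≤ 1) (hp0 : p ≠ 0)
    (hq0 : q ≠ 0) (ha0 : 0 ≤ a) (ha1 : a < 1) (hγ0 : 0 ≤ γ)
    (hγ1 : γ ≤ √((1 - p) / (1 - q))) :
    powMean p (1 + a) (1 - a) ≤ powMean q (1 + γ * a) (1 - γ * a) := by
  rcases hp1.eq_or_lt with rfl | hp1
  · have : γ = 0 := le_antisymm (by simpa using hγ1) hγ0
    subst this
    simp [powMean]
  have hp : 0 < 1 - p := by linarith
  have hq : 0 < 1 - q := by linarith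
  have hsp := Real.sqrt_pos.2 hp
  have hsq := Real.sqrt_pos.2 hq
  set c := a * √(1 - p) with hc_def
  have hc : 0 ≤ c := by positivity
  have hcp : c < √(1 - p) := by rw [hc_def]; nlinarith
  have hcq : c < √(1 - q) := hcp.trans_le (Real.sqrt_le_sqrt (by linarith))
  have h := Real.exp_le_exp.2 (logPowMean_le_logPowMean hc hqp hp1 hp0 hq0 hcp)
  rw [← powMean_eq_exp_logPowMean hc hcp, ← powMean_eq_exp_logPowMean hc hcq,
    show c / √(1 - p) = a from mul_div_cancel_right₀ a hsp.ne'] at h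
  refine h.trans (powMean_spread_antitone hq0 (by linarith) (by positivity) ?_
    ((div_lt_one hsq).2 hcq))
  rw [Real.sqrt_div hp.le] at hγ1
  calc γ * a ≤ √(1 - p) / √(1 - q) * a := mul_le_mul_of_nonneg_right hγ1 ha0
    _ = c / √(1 - q) := by rw [hc_def]; ring

theorem sqrt_ratio_le_one {p q : ℝ} (hqp : q ≤ p) (hp1 : p ≤ 1) :
    √((1 - p) / (1 - q)) ≤ 1 :=
  Real.sqrt_le_one.2 (div_le_one_of_le₀ (by linarith) (by linarith))

/-- Reverse hypercontractivity for the noise operator on one bit. -/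
theorem powMean_le_powMean_noise {p q a b γ : ℝ} (hqp : q ≤ p) (hp1 : p ≤ 1) (hp0 : p ≠ 0)
    (hq0 : q ≠ 0) (ha : 0 < a) (hb : 0 < b) (hγ0 : 0 ≤ γ)
    (hγ1 : γ ≤ √((1 - p) / (1 - q))) :
    powMean p a b
      ≤ powMean q ((1 + γ) / 2 * a + (1 - γ) / 2 * b) ((1 - γ) / 2 * a + (1 + γ) / 2 * b) := by
  wlog hba : b ≤ a generalizing a b
  · have h := this hb ha (le_of_not_ge hba)
    rw [powMean_comm, powMean_comm q]
    convert h using 2 <;> ring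
  have hγ : γ ≤ 1 := hγ1.trans (sqrt_ratio_le_one hqp hp1)
  set l := (a + b) / 2 with hl_def
  have hl : 0 < l := by positivity
  set d := (a - b) / 2 / l with hd_def
  have hd0 : 0 ≤ d := div_nonneg (by linarith) hl.le
  have hd1 : d < 1 := by rw [hd_def, div_lt_one hl]; linarith
  have hdl : l * d = (a - b) / 2 := mul_div_cancel₀ _ hl.ne'
  have hγd : γ * d < 1 := by nlinarith
  have hγd0 : 0 ≤ γ * d := by positivity
  have e1 : a = l * (1 + d) := by rw [mul_add, hdl]; ring
  have e2 : b = l * (1 - d) := by rw [mul_sub, hdl]; ring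
  have e3 : (1 + γ) / 2 * a + (1 - γ) / 2 * b = l * (1 + γ * d) := by
    linear_combination (-γ) * hdl
  have e4 : (1 - γ) / 2 * a + (1 + γ) / 2 * b = l * (1 - γ * d) := by
    linear_combination γ * hdl
  rw [e3, e4, powMean_mul hq0 hl (by linarith) (by linarith)]
  have e5 : powMean p a b = l * powMean p (1 + d) (1 - d) := by
    rw [← powMean_mul hp0 hl (by linarith) (by linarith), ← e1, ← e2]
  rw [e5]
  exact mul_le_mul_of_nonneg_left
    (powMean_one_add_one_sub_le hqp hp1 hp0 hq0 hd0 hd1 hγ0 hγ1) hl.le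

theorem lpnorm_of_pos {n : ℕ} (p : ℝ) {f : (Fin n → Fin 2) → ℝ} (hf : ∀ x, 0 < f x) :
    lpnorm p f = ((∑ x, f x ^ p) / 2 ^ n) ^ (1 / p) := by
  simp only [lpnorm, abs_of_pos (hf _)]

theorem sum_rpow_div_pos {n : ℕ} (p : ℝ) {f : (Fin n → Fin 2) → ℝ} (hf : ∀ x, 0 < f x) :
    0 < (∑ x, f x ^ p) / 2 ^ n :=
  div_pos (Finset.sum_pos (fun x _ => Real.rpow_pos_of_pos (hf x) p) Finset.univ_nonempty)
    (by positivity)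

theorem lpnorm_pos {n : ℕ} (p : ℝ) {f : (Fin n → Fin 2) → ℝ} (hf : ∀ x, 0 < f x) :
    0 < lpnorm p f := by
  rw [lpnorm_of_pos p hf]
  exact Real.rpow_pos_of_pos (sum_rpow_div_pos p hf) _

theorem lpnorm_rpow {n : ℕ} {p : ℝ} (hp : p ≠ 0) {f : (Fin n → Fin 2) → ℝ}
    (hf : ∀ x, 0 < f x) : lpnorm p f ^ p = (∑ x, f x ^ p) / 2 ^ n := by
  rw [lpnorm_of_pos p hf, one_div, Real.rpow_inv_rpow (sum_rpow_div_pos p hf).le hp]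

theorem lpnorm_le_lpnorm {n : ℕ} {p : ℝ} (hp : p ≠ 0) {f g : (Fin n → Fin 2) → ℝ}
    (hf : ∀ x, 0 < f x) (hfg : ∀ x, f x ≤ g x) : lpnorm p f ≤ lpnorm p g := by
  have hg : ∀ x, 0 < g x := fun x => (hf x).trans_le (hfg x)
  rw [lpnorm_of_pos p hf, lpnorm_of_pos p hg]
  refine rpow_one_div_le_rpow_one_div hp (sum_rpow_div_pos p hf) (sum_rpow_div_pos p hg)
    (fun h => ?_) (fun h => ?_)
  · gcongr with x
    · exact (hf x).le
    · exact hfg x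
  · refine div_le_div_of_nonneg_right (Finset.sum_le_sum fun x _ => ?_) (by positivity)
    exact Real.rpow_le_rpow_of_nonpos (hf x) (hfg x) h.le

theorem sum_cube_succ {M : Type*} [AddCommMonoid M] {n : ℕ} (F : (Fin (n + 1) → Fin 2) → M) :
    ∑ x, F x = ∑ y : Fin n → Fin 2, F (Fin.cons 0 y) + ∑ y : Fin n → Fin 2, F (Fin.cons 1 y) := by
  rw [← (Fin.consEquiv fun _ : Fin (n + 1) => Fin 2).sum_comp, Fintype.sum_prod_type,
    Fin.sum_univ_two]
  rfl

theorem lpnorm_succ {n : ℕ} {p : ℝ} (hp : p ≠ 0) {f : (Fin (n + 1) → Fin 2) → ℝ}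
    (hf : ∀ x, 0 < f x) :
    lpnorm p f
      = powMean p (lpnorm p fun y => f (Fin.cons 0 y)) (lpnorm p fun y => f (Fin.cons 1 y)) := by
  rw [lpnorm_of_pos p hf, powMean, lpnorm_rpow hp fun y => hf _, lpnorm_rpow hp fun y => hf _,
    sum_cube_succ]
  congr 1
  rw [pow_succ]
  ring

theorem lpnorm_powMean {n : ℕ} {p : ℝ} (hp : p ≠ 0) {g h : (Fin n → Fin 2) → ℝ}
    (hg : ∀ x, 0 < g x) (hh : ∀ x, 0 < h x) :
    lpnorm p (fun y => powMean p (g y) (h y)) = powMean p (lpnorm p g) (lpnorm p h) := by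
  rw [lpnorm_of_pos p fun y => powMean_pos (hg y) (hh y)]
  conv_rhs => rw [powMean, lpnorm_rpow hp hg, lpnorm_rpow hp hh]
  simp_rw [powMean_rpow hp (hg _) (hh _)]
  rw [← Finset.sum_div, Finset.sum_add_distrib]
  congr 1
  ring

/-- The reverse Minkowski inequality for mixed power means. -/
theorem powMean_lpnorm_le {n : ℕ} {p q : ℝ} (hqp : q ≤ p) (hp : p ≠ 0) (hq : q ≠ 0)
    {g h : (Fin n → Fin 2) → ℝ} (hg : ∀ x, 0 < g x) (hh : ∀ x, 0 < h x) :
    powMean p (lpnorm q g) (lpnorm q h) ≤ lpnorm q (fun y => powMean p (g y) (h y)) := by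
  have hA := lpnorm_pos q hg
  have hB := lpnorm_pos q hh
  have hAq := lpnorm_rpow hq hg
  have hBq := lpnorm_rpow hq hh
  set A := lpnorm q g
  set B := lpnorm q h
  have hW := powMean_pos (p := p) hA hB
  have hWp := powMean_rpow hp hA hB
  set W := powMean p A B
  have hWp0 : 0 < W ^ p := by positivity
  set a := A ^ p / (2 * W ^ p) with ha_def
  set b := B ^ p / (2 * W ^ p) with hb_def
  have ha : 0 ≤ a := by positivity
  have hb : 0 ≤ b := by positivity
  have hab : a + b = 1 := by
    rw [ha_def, hb_def, ← add_div, div_eq_one_iff_eq (by positivity)]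
    linarith
  have hpow : ∀ y, powMean p (g y) (h y) ^ q
      = W ^ q * (a * (g y / A) ^ p + b * (h y / B) ^ p) ^ (q / p) := by
    intro y
    have hgy := hg y
    have hhy := hh y
    have e : a * (g y / A) ^ p + b * (h y / B) ^ p = (g y ^ p + h y ^ p) / 2 / W ^ p := by
      rw [Real.div_rpow hgy.le hA.le, Real.div_rpow hhy.le hB.le, ha_def, hb_def]
      field_simp
    rw [e, ← powMean_rpow hp hgy hhy, ← Real.div_rpow (powMean_pos hgy hhy).le hW.le,
      ← Real.rpow_mul (div_pos (powMean_pos hgy hhy) hW).le, mul_div_cancel₀ _ hp,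
      Real.div_rpow (powMean_pos hgy hhy).le hW.le, mul_div_cancel₀ _ (by positivity)]
  have hsplit : ∀ x : ℝ, 0 < x → (x ^ p) ^ (q / p) = x ^ q := by
    intro x hx
    rw [← Real.rpow_mul hx.le, mul_div_cancel₀ _ hp]
  have hmean : (∑ y, W ^ q * (a * (g y / A) ^ q + b * (h y / B) ^ q)) / 2 ^ n = W ^ q := by
    simp_rw [Real.div_rpow (hg _).le hA.le, Real.div_rpow (hh _).le hB.le]
    rw [← Finset.mul_sum, Finset.sum_add_distrib, ← Finset.mul_sum, ← Finset.mul_sum,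
      ← Finset.sum_div, ← Finset.sum_div, mul_div_assoc, add_div]
    have e1 : a * ((∑ y, g y ^ q) / A ^ q) / 2 ^ n = a := by
      rw [mul_div_assoc, div_right_comm, ← hAq, div_self (by positivity), mul_one]
    have e2 : b * ((∑ y, h y ^ q) / B ^ q) / 2 ^ n = b := by
      rw [mul_div_assoc, div_right_comm, ← hBq, div_self (by positivity), mul_one]
    rw [e1, e2, hab, mul_one]
  have hpos : ∀ y, 0 < powMean p (g y) (h y) := fun y => powMean_pos (hg y) (hh y)
  rw [lpnorm_of_pos q hpos]
  refine le_rpow_one_div hq hW (sum_rpow_div_pos q hpos) (fun hq' => ?_) (fun hq' => ?_)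
  · have hp' : 0 < p := hq'.trans_le hqp
    rw [← hmean]
    gcongr with y
    have hgy := hg y
    have hhy := hh y
    rw [hpow]
    gcongr
    rw [← hsplit (g y / A) (by positivity), ← hsplit (h y / B) (by positivity)]
    exact add_rpow_le_rpow_add_of_mem_unit ha hb hab (by positivity) (by positivity)
      (by positivity) ((div_le_one hp').2 hqp)
  · rw [← hmean]
    gcongr with y
    have hgy := hg y
    have hhy := hh y
    rw [hpow]
    gcongr
    rw [← hsplit (g y / A) (by positivity), ← hsplit (h y / B) (by positivity)]
    refine rpow_add_le_add_rpow_of_nonpos_or_one_le ha hb hab (by positivity) (by positivity) ?_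
    rcases hp.lt_or_gt with hp' | hp'
    · exact Or.inr ((one_le_div_of_neg hp').2 hqp)
    · exact Or.inl (div_nonpos_of_nonpos_of_nonneg hq'.le hp'.le)

theorem noiseOp_cons_zero {n : ℕ} (γ : ℝ) (f : (Fin (n + 1) → Fin 2) → ℝ) (y : Fin n → Fin 2) :
    noiseOp γ f (Fin.cons 0 y) = (1 + γ) / 2 * noiseOp γ (fun z => f (Fin.cons 0 z)) y
      + (1 - γ) / 2 * noiseOp γ (fun z => f (Fin.cons 1 z)) y := by
  simp [noiseOp, sum_cube_succ, Fin.prod_univ_succ, Finset.mul_sum, mul_assoc]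

theorem noiseOp_cons_one {n : ℕ} (γ : ℝ) (f : (Fin (n + 1) → Fin 2) → ℝ) (y : Fin n → Fin 2) :
    noiseOp γ f (Fin.cons 1 y) = (1 - γ) / 2 * noiseOp γ (fun z => f (Fin.cons 0 z)) y
      + (1 + γ) / 2 * noiseOp γ (fun z => f (Fin.cons 1 z)) y := by
  simp [noiseOp, sum_cube_succ, Fin.prod_univ_succ, Finset.mul_sum, mul_assoc]

theorem noiseOp_pos_of_pos {n : ℕ} {γ : ℝ} (hγ0 : 0 ≤ γ) (hγ1 : γ ≤ 1)
    {f : (Fin n → Fin 2) → ℝ} (hf : ∀ x, 0 < f x) (x : Fin n → Fin 2) : 0 < noiseOp γ f x := by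
  have hw : ∀ y : Fin n → Fin 2,
      0 ≤ (∏ i : Fin n, if y i = x i then (1 + γ) / 2 else (1 - γ) / 2) * f y := fun y =>
    mul_nonneg (Finset.prod_nonneg fun i _ => by split_ifs <;> linarith) (hf y).le
  refine Finset.sum_pos' (fun y _ => hw y) ⟨x, Finset.mem_univ x, mul_pos ?_ (hf x)⟩
  exact Finset.prod_pos fun i _ => by rw [if_pos rfl]; linarith

/-- Reverse hypercontractivity for strictly positive functions. -/
theorem lpnorm_le_lpnorm_noiseOp_of_pos {p q γ : ℝ} (hqp : q ≤ p) (hp1 : p ≤ 1) (hp0 : p ≠ 0)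
    (hq0 : q ≠ 0) (hγ0 : 0 ≤ γ) (hγ1 : γ ≤ √((1 - p) / (1 - q))) {n : ℕ}
    {f : (Fin n → Fin 2) → ℝ} (hf : ∀ x, 0 < f x) :
    lpnorm p f ≤ lpnorm q (noiseOp γ f) := by
  have hγ : γ ≤ 1 := hγ1.trans (sqrt_ratio_le_one hqp hp1)
  induction n with
  | zero =>
    simp [lpnorm, noiseOp, Real.rpow_rpow_inv (abs_nonneg _) hp0,
      Real.rpow_rpow_inv (abs_nonneg _) hq0]
  | succ n ih =>
    have hf0 : ∀ y : Fin n → Fin 2, 0 < f (Fin.cons 0 y) := fun y => hf _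
    have hf1 : ∀ y : Fin n → Fin 2, 0 < f (Fin.cons 1 y) := fun y => hf _
    have hg0 := noiseOp_pos_of_pos hγ0 hγ hf0
    have hg1 := noiseOp_pos_of_pos hγ0 hγ hf1
    have hTf := noiseOp_pos_of_pos hγ0 hγ hf
    rw [lpnorm_succ hp0 hf]
    calc powMean p (lpnorm p fun y => f (Fin.cons 0 y)) (lpnorm p fun y => f (Fin.cons 1 y))
        ≤ powMean p (lpnorm q (noiseOp γ fun y => f (Fin.cons 0 y)))
            (lpnorm q (noiseOp γ fun y => f (Fin.cons 1 y))) :=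
          powMean_le_powMean hp0 (lpnorm_pos p hf0) (lpnorm_pos p hf1) (ih hf0) (ih hf1)
      _ ≤ lpnorm q (fun y => powMean p (noiseOp γ (fun y => f (Fin.cons 0 y)) y)
            (noiseOp γ (fun y => f (Fin.cons 1 y)) y)) :=
          powMean_lpnorm_le hqp hp0 hq0 hg0 hg1
      _ ≤ lpnorm q (fun y => powMean q (noiseOp γ f (Fin.cons 0 y))
            (noiseOp γ f (Fin.cons 1 y))) := by
          refine lpnorm_le_lpnorm hq0 (fun y => powMean_pos (hg0 y) (hg1 y)) fun y => ?_
          rw [noiseOp_cons_zero, noiseOp_cons_one]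
          exact powMean_le_powMean_noise hqp hp1 hp0 hq0 (hg0 y) (hg1 y) hγ0 hγ1
      _ = lpnorm q (noiseOp γ f) := by
          rw [lpnorm_powMean hq0 (fun y => hTf _) (fun y => hTf _), lpnorm_succ hq0 hTf]

theorem noiseOp_pos_of_ne_zero {n : ℕ} {γ : ℝ} (hγ0 : 0 ≤ γ) (hγ1 : γ < 1)
    {f : (Fin n → Fin 2) → ℝ} (hf : ∀ x, 0 ≤ f x) (hf0 : f ≠ 0) (x : Fin n → Fin 2) :
    0 < noiseOp γ f x := by
  have hw : ∀ y : Fin n → Fin 2,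
      0 < ∏ i : Fin n, if y i = x i then (1 + γ) / 2 else (1 - γ) / 2 := fun y =>
    Finset.prod_pos fun i _ => by split_ifs <;> linarith
  obtain ⟨y, hy⟩ := Function.ne_iff.1 hf0
  exact Finset.sum_pos' (fun y _ => mul_nonneg (hw y).le (hf y))
    ⟨y, Finset.mem_univ y, mul_pos (hw y) ((hf y).lt_of_ne' hy)⟩

theorem continuous_noiseOp {n : ℕ} (γ : ℝ) :
    Continuous (noiseOp γ : ((Fin n → Fin 2) → ℝ) → (Fin n → Fin 2) → ℝ) := by
  unfold noiseOp
  fun_prop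

theorem continuous_lpnorm_of_pos {n : ℕ} {p : ℝ} (hp : 0 < p) :
    Continuous (lpnorm p : ((Fin n → Fin 2) → ℝ) → ℝ) := by
  unfold lpnorm
  refine Continuous.rpow_const (Continuous.div_const (continuous_finsetSum _ fun x _ => ?_) _)
    fun _ => Or.inr (one_div_pos.2 hp).le
  exact Continuous.rpow_const (by fun_prop) fun _ => Or.inr hp.le

theorem continuousAt_lpnorm {n : ℕ} (p : ℝ) {f : (Fin n → Fin 2) → ℝ} (hf : ∀ x, 0 < f x) :
    ContinuousAt (lpnorm p) f := by
  unfold lpnorm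
  have h := sum_rpow_div_pos p hf
  refine ContinuousAt.rpow_const (ContinuousAt.div_const (tendsto_finsetSum _ fun x _ => ?_) _)
    (Or.inl ?_)
  · exact ContinuousAt.rpow_const (continuous_apply x).abs.continuousAt
      (Or.inl (abs_pos.2 (hf x).ne').ne')
  · simpa only [abs_of_pos (hf _)] using h.ne'

/-- Reverse hypercontractivity for the boolean cube (Borell). -/
theorem boolean_reverse_hypercontractivity
    (n : ℕ) (f : (Fin n → Fin 2) → ℝ) (hf : ∀ x, 0 ≤ f x)
    (p q : ℝ) (hqp : q ≤ p) (hp1 : p ≤ 1) (hp0 : p ≠ 0) (hq0 : q ≠ 0)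
    (hfpos : p < 0 → ∀ x, 0 < f x)
    (γ : ℝ) (hγ0 : 0 ≤ γ) (hγ1 : γ ≤ Real.sqrt ((1 - p) / (1 - q))) :
    lpnorm p f ≤ lpnorm q (noiseOp γ f) := by
  rcases hp0.lt_or_gt with hp | hp
  · exact lpnorm_le_lpnorm_noiseOp_of_pos hqp hp1 hp0 hq0 hγ0 hγ1 (hfpos hp)
  rcases eq_or_ne f 0 with rfl | hf0
  · simp [lpnorm, noiseOp, Real.zero_rpow hp0, Real.zero_rpow hq0, Real.zero_rpow (inv_ne_zero hp0),
      Real.zero_rpow (inv_ne_zero hq0)]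
  have hshift : Continuous fun ε : ℝ => fun x => f x + ε := by fun_prop
  have hshift0 : (fun x => f x + 0) = f := by simp
  have hleft : Filter.Tendsto (fun ε : ℝ => lpnorm p fun x => f x + ε) (nhdsWithin 0 (Set.Ioi 0))
      (nhds (lpnorm p f)) := by
    have := ((continuous_lpnorm_of_pos hp).comp hshift).tendsto 0
    simp only [Function.comp_def, hshift0] at this
    exact this.mono_left nhdsWithin_le_nhds
  have hcont : ContinuousAt (lpnorm q) (noiseOp γ f) := by
    rcases hq0.lt_or_gt with hq | hq
    · refine continuousAt_lpnorm q (noiseOp_pos_of_ne_zero hγ0 (hγ1.trans_lt ?_) hf hf0)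
      rw [Real.sqrt_lt' one_pos, one_pow, div_lt_one (by linarith)]
      linarith
    · exact (continuous_lpnorm_of_pos hq).continuousAt
  have hright : Filter.Tendsto (fun ε : ℝ => lpnorm q (noiseOp γ fun x => f x + ε))
      (nhdsWithin 0 (Set.Ioi 0)) (nhds (lpnorm q (noiseOp γ f))) := by
    have h := ((continuous_noiseOp γ).comp hshift).tendsto 0
    simp only [Function.comp_def, hshift0] at h
    exact (hcont.tendsto.comp h).mono_left nhdsWithin_le_nhds
  refine le_of_tendsto_of_tendsto hleft hright ?_
  filter_upwards [self_mem_nhdsWithin] with ε hε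
  exact lpnorm_le_lpnorm_noiseOp_of_pos hqp hp1 hp0 hq0 hγ0 hγ1
    fun x => add_pos_of_nonneg_of_pos (hf x) hε
end

section
/- Quantum hypercontractivity for the depolarizing channel (King): Let n ≥ 1, let f ∈ M_{2^n} be a complex 2^n × 2^n matrix, and fix real numbers p, q with 1 ≤ p ≤ q. Then for all γ with 0 ≤ γ ≤ √((p−1)/(q−1)) (interpreting the bound as γ = 0 allowed whenever p = 1), one has ‖D_γ^{⊗n}(f)‖_q ≤ ‖f‖_p. -/
open Matrix
open scoped ComplexOrder

/-- The function `x ↦ x log x`. -/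
noncomputable def mulLog (x : ℝ) : ℝ := x * Real.log x

lemma mulLog_zero : mulLog 0 = 0 := by simp [mulLog]

lemma mulLog_one : mulLog 1 = 0 := by simp [mulLog]

lemma continuous_mulLog : Continuous mulLog := Real.continuous_mul_log

lemma mulLog_mul (c : ℝ) {x : ℝ} (hx : 0 ≤ x) (hc : c ≠ 0) :
    mulLog (c * x) = c * mulLog x + c * x * Real.log c := by
  rcases hx.eq_or_lt with rfl | hx
  · simp [mulLog]
  · simp only [mulLog]
    rw [Real.log_mul hc hx.ne']
    ring

lemma log_le_half_sub_inv {y : ℝ} (hy : 1 ≤ y) : Real.log y ≤ (y - y⁻¹) / 2 := by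
  rw [← Real.sinh_log (by linarith)]
  exact Real.self_le_sinh_iff.2 (Real.log_nonneg hy)

lemma half_mulLog_add_mulLog_le_of_nonneg {s : ℝ} (h0 : 0 ≤ s) (h1 : s ≤ 1) :
    (mulLog (1 + s) + mulLog (1 - s)) / 2 ≤ 1 - Real.sqrt (1 - s ^ 2) := by
  let h : ℝ → ℝ := fun s => 1 - Real.sqrt (1 - s ^ 2) - (mulLog (1 + s) + mulLog (1 - s)) / 2
  have hc : Continuous h := by
    have h1 : Continuous fun s => mulLog (1 + s) := continuous_mulLog.comp (by fun_prop)
    have h2 : Continuous fun s => mulLog (1 - s) := continuous_mulLog.comp (by fun_prop)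
    exact ((continuous_const.sub (by fun_prop)).sub ((h1.add h2).div_const 2))
  have hd : ∀ x ∈ Set.Ioo (0 : ℝ) 1, HasDerivAt h
      (x / Real.sqrt (1 - x ^ 2) - (Real.log (1 + x) - Real.log (1 - x)) / 2) x := by
    intro x hx
    have hp : 0 < 1 + x := by linarith [hx.1]
    have hm : 0 < 1 - x := by linarith [hx.2]
    have hq : 0 < 1 - x ^ 2 := by nlinarith
    have e1 : HasDerivAt (fun s : ℝ => 1 + s) 1 x := by
      simpa using (hasDerivAt_id x).const_add 1
    have e2 : HasDerivAt (fun s : ℝ => 1 - s) (-1) x := by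
      simpa using (hasDerivAt_id x).const_sub 1
    have e3 : HasDerivAt (fun s : ℝ => 1 - s ^ 2) (-(2 * x)) x := by
      simpa using ((hasDerivAt_id x).pow 2).const_sub 1
    have := ((e3.sqrt hq.ne').const_sub 1).sub
      (((e1.mul (e1.log hp.ne')).add (e2.mul (e2.log hm.ne'))).div_const 2)
    refine this.congr_deriv ?_
    field_simp
    ring
  have hmono : MonotoneOn h (Set.Icc 0 1) := by
    apply monotoneOn_of_deriv_nonneg (convex_Icc 0 1) hc.continuousOn
    · rw [interior_Icc]
      exact fun x hx => (hd x hx).differentiableAt.differentiableWithinAt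
    · rw [interior_Icc]
      intro x hx
      rw [(hd x hx).deriv]
      have hp : 0 < 1 + x := by linarith [hx.1]
      have hm : 0 < 1 - x := by linarith [hx.2]
      have hsp := Real.sqrt_pos.2 hp
      have hsm := Real.sqrt_pos.2 hm
      have hy : 1 ≤ Real.sqrt (1 + x) / Real.sqrt (1 - x) := by
        rw [le_div_iff₀ hsm, one_mul]
        exact Real.sqrt_le_sqrt (by linarith [hx.1])
      have := log_le_half_sub_inv hy
      rw [Real.log_div hsp.ne' hsm.ne', Real.log_sqrt hp.le, Real.log_sqrt hm.le] at this
      have e : (Real.sqrt (1 + x) / Real.sqrt (1 - x) -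
          (Real.sqrt (1 + x) / Real.sqrt (1 - x))⁻¹) / 2 = x / Real.sqrt (1 - x ^ 2) := by
        rw [show 1 - x ^ 2 = (1 + x) * (1 - x) by ring, Real.sqrt_mul hp.le]
        field_simp
        rw [Real.sq_sqrt hp.le, Real.sq_sqrt hm.le]
        ring
      linarith
  have := hmono (Set.left_mem_Icc.2 zero_le_one) ⟨h0, h1⟩ h0
  simp only [h, add_zero, sub_zero, mulLog_one] at this
  norm_num at this
  linarith

lemma half_mulLog_add_mulLog_le {s : ℝ} (hs : |s| ≤ 1) :
    (mulLog (1 + s) + mulLog (1 - s)) / 2 ≤ 1 - Real.sqrt (1 - s ^ 2) := by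
  rcases le_total 0 s with h | h
  · exact half_mulLog_add_mulLog_le_of_nonneg h ((le_abs_self s).trans hs)
  · have := half_mulLog_add_mulLog_le_of_nonneg (s := -s) (by linarith)
      ((neg_le_abs s).trans hs)
    simp only [sub_neg_eq_add, ← sub_eq_add_neg, neg_sq] at this
    linarith

/-- The logarithmic Sobolev inequality on the two-point space. -/
lemma two_point_logSobolev {a b : ℝ} (h : |b| ≤ a) :
    (mulLog ((a + b) ^ 2) + mulLog ((a - b) ^ 2)) / 2 ≤ mulLog (a ^ 2 + b ^ 2) + 2 * b ^ 2 := by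
  have ha : 0 ≤ a := (abs_nonneg b).trans h
  have hba : b ^ 2 ≤ a ^ 2 := sq_le_sq' (by linarith [neg_abs_le b]) ((le_abs_self b).trans h)
  rcases (add_nonneg (sq_nonneg a) (sq_nonneg b)).eq_or_lt with hm | hm
  · have ha0 : a = 0 := by nlinarith [sq_nonneg a, sq_nonneg b]
    have hb0 : b = 0 := by nlinarith [sq_nonneg a, sq_nonneg b]
    simp [ha0, hb0, mulLog]
  · set m := a ^ 2 + b ^ 2 with hmdef
    set s := 2 * a * b / m with hs
    have hsm : m * s = 2 * a * b := by rw [hs]; field_simp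
    have hs1 : |s| ≤ 1 := by
      rw [abs_le]
      constructor
      · rw [hs, le_div_iff₀ hm]; nlinarith [sq_nonneg (a + b)]
      · rw [hs, div_le_iff₀ hm]; nlinarith [sq_nonneg (a - b)]
    have key := half_mulLog_add_mulLog_le hs1
    have e1 : (a + b) ^ 2 = m * (1 + s) := by rw [mul_add, hsm]; ring
    have e2 : (a - b) ^ 2 = m * (1 - s) := by rw [mul_sub, hsm]; ring
    have hsq : Real.sqrt (1 - s ^ 2) = (a ^ 2 - b ^ 2) / m := by
      have : 1 - s ^ 2 = ((a ^ 2 - b ^ 2) / m) ^ 2 := by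
        rw [hs]
        field_simp
        rw [hmdef]
        ring
      rw [this, Real.sqrt_sq (div_nonneg (by linarith) hm.le)]
    rw [e1, e2, mulLog_mul m (by linarith [neg_abs_le s]) hm.ne',
      mulLog_mul m (by linarith [le_abs_self s]) hm.ne']
    rw [hsq] at key
    have h2 : m * (1 - (a ^ 2 - b ^ 2) / m) = 2 * b ^ 2 := by
      rw [mul_sub, mul_div_cancel₀ _ hm.ne']; rw [hmdef]; ring
    have h3 := mul_le_mul_of_nonneg_left key hm.le
    rw [h2] at h3
    have : mulLog m = m * Real.log m := rfl
    nlinarith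

lemma mulLog_add_sub_le_of_add_eq_one {u v p q : ℝ} (hu : 0 ≤ u) (hv : 0 ≤ v) (hp : 0 < p)
    (hq : 0 < q) (hpq : p + q = 1) :
    mulLog (u + v) - mulLog u - mulLog v ≤ -u * Real.log p - v * Real.log q := by
  rcases hu.eq_or_lt with rfl | hu
  · simp only [zero_add, mulLog_zero]
    have := Real.log_nonpos hq.le (by linarith)
    nlinarith
  rcases hv.eq_or_lt with rfl | hv
  · simp only [add_zero, mulLog_zero]
    have := Real.log_nonpos hp.le (by linarith)
    nlinarith
  have huv : 0 < u + v := by positivity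
  have h1 := Real.log_le_sub_one_of_pos (show 0 < (u + v) * p / u by positivity)
  have h2 := Real.log_le_sub_one_of_pos (show 0 < (u + v) * q / v by positivity)
  rw [Real.log_div (by positivity) hu.ne', Real.log_mul huv.ne' hp.ne'] at h1
  rw [Real.log_div (by positivity) hv.ne', Real.log_mul huv.ne' hq.ne'] at h2
  have h1' := mul_le_mul_of_nonneg_left h1 hu.le
  have h2' := mul_le_mul_of_nonneg_left h2 hv.le
  have e1 : u * ((u + v) * p / u - 1) = (u + v) * p - u := by field_simp
  have e2 : v * ((u + v) * q / v - 1) = (u + v) * q - v := by field_simp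
  have e3 : (u + v) * p + (u + v) * q = u + v := by rw [← mul_add, hpq, mul_one]
  simp only [mulLog]
  nlinarith

lemma sum_mulLog_add_sub_le {ι : Type*} [Fintype ι] {u v : ι → ℝ} (hu : ∀ i, 0 ≤ u i)
    (hv : ∀ i, 0 ≤ v i) :
    ∑ i, (mulLog (u i + v i) - mulLog (u i) - mulLog (v i)) ≤
      mulLog (∑ i, u i + ∑ i, v i) - mulLog (∑ i, u i) - mulLog (∑ i, v i) := by
  rcases (Finset.sum_nonneg fun i _ => hu i).eq_or_lt with hU | hU
  · have h0 : ∀ i, u i = 0 := fun i =>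
      (Finset.sum_eq_zero_iff_of_nonneg fun i _ => hu i).1 hU.symm i (Finset.mem_univ i)
    simp [h0, mulLog_zero]
  rcases (Finset.sum_nonneg fun i _ => hv i).eq_or_lt with hV | hV
  · have h0 : ∀ i, v i = 0 := fun i =>
      (Finset.sum_eq_zero_iff_of_nonneg fun i _ => hv i).1 hV.symm i (Finset.mem_univ i)
    simp [h0, mulLog_zero]
  set U := ∑ i, u i
  set V := ∑ i, v i
  have hUV : 0 < U + V := by positivity
  calc _ ≤ ∑ i, (-u i * Real.log (U / (U + V)) - v i * Real.log (V / (U + V))) :=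
        Finset.sum_le_sum fun i _ => mulLog_add_sub_le_of_add_eq_one (hu i) (hv i)
          (by positivity) (by positivity) (by field_simp)
    _ = -U * Real.log (U / (U + V)) - V * Real.log (V / (U + V)) := by
        rw [Finset.sum_sub_distrib, ← Finset.sum_mul, ← Finset.sum_mul, Finset.sum_neg_distrib]
    _ = _ := by
        rw [Real.log_div hU.ne' hUV.ne', Real.log_div hV.ne' hUV.ne']
        simp only [mulLog]
        ring

lemma mulLog_add_sub_le_mulLog_add_sub {u u' v : ℝ} (hu : 0 ≤ u) (huu : u ≤ u') (hv : 0 ≤ v) :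
    mulLog (u + v) - mulLog u ≤ mulLog (u' + v) - mulLog u' := by
  have := sum_mulLog_add_sub_le (u := ![u, u' - u]) (v := ![v, 0])
    (by intro i; fin_cases i <;> simp [hu, huu]) (by intro i; fin_cases i <;> simp [hv])
  simp only [Fin.sum_univ_two, Matrix.cons_val_zero, Matrix.cons_val_one, add_zero, mulLog_zero,
    add_sub_cancel] at this
  linarith

lemma rpow_half_sub_sq_le {x y q : ℝ} (hx : 0 < x) (hy : 0 < y) (hq : 1 < q) :
    4 * (q - 1) / q ^ 2 * (x ^ (q / 2) - y ^ (q / 2)) ^ 2 ≤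
      (x - y) * (x ^ (q - 1) - y ^ (q - 1)) := by
  wlog hxy : y ≤ x generalizing x y
  · have := this hy hx (le_of_not_ge hxy)
    linarith [sq_abs (x ^ (q / 2) - y ^ (q / 2)), neg_sub (x ^ (q / 2)) (y ^ (q / 2))]
  have hmono : ∀ c : ℝ, 0 ≤ (x ^ (q - 1) - y ^ (q - 1)) / (q - 1)
      - 2 * c * ((x ^ (q / 2) - y ^ (q / 2)) / (q / 2)) + c ^ 2 * (x - y) := by
    intro c
    let Ψ : ℝ → ℝ := fun x => (x ^ (q - 1) - y ^ (q - 1)) / (q - 1)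
      - 2 * c * ((x ^ (q / 2) - y ^ (q / 2)) / (q / 2)) + c ^ 2 * (x - y)
    have hd : ∀ z ∈ Set.Icc y x, HasDerivAt Ψ ((z ^ (q / 2 - 1) - c) ^ 2) z := by
      intro z hz
      have hz0 : 0 < z := hy.trans_le hz.1
      have h1 := ((Real.hasDerivAt_rpow_const (p := q - 1) (Or.inl hz0.ne')).sub_const
        (y ^ (q - 1))).div_const (q - 1)
      have h2 := (((Real.hasDerivAt_rpow_const (p := q / 2) (Or.inl hz0.ne')).sub_const
        (y ^ (q / 2))).div_const (q / 2)).const_mul (2 * c)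
      have h3 := ((hasDerivAt_id z).sub_const y).const_mul (c ^ 2)
      refine ((h1.sub h2).add h3).congr_deriv ?_
      have : z ^ (q - 1 - 1) = (z ^ (q / 2 - 1)) ^ 2 := by
        rw [← Real.rpow_natCast, ← Real.rpow_mul hz0.le]
        congr 1
        push_cast
        ring
      rw [this]
      have hq1 : q - 1 ≠ 0 := by linarith
      have hq0 : q ≠ 0 := by linarith
      field_simp
      ring
    have hm : MonotoneOn Ψ (Set.Icc y x) := by
      apply monotoneOn_of_deriv_nonneg (convex_Icc y x)
        (fun z hz => (hd z hz).continuousAt.continuousWithinAt)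
      · exact fun z hz => (hd z (interior_subset hz)).differentiableAt.differentiableWithinAt
      · intro z hz
        rw [(hd z (interior_subset hz)).deriv]
        positivity
    have := hm (Set.left_mem_Icc.2 hxy) (Set.right_mem_Icc.2 hxy) hxy
    simpa [Ψ] using this
  rcases hxy.eq_or_lt with rfl | hlt
  · simp
  have hxy0 : 0 < x - y := by linarith
  have h := hmono ((x ^ (q / 2) - y ^ (q / 2)) / (q / 2) / (x - y))
  set d := x ^ (q / 2) - y ^ (q / 2)
  set e := x ^ (q - 1) - y ^ (q - 1)
  have hq1 : 0 < q - 1 := by linarith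
  have hq0 : 0 < q := by linarith
  have h' : 0 ≤ ((q - 1) * (x - y)) * (e / (q - 1) - 2 * (d / (q / 2) / (x - y)) * (d / (q / 2)) +
    (d / (q / 2) / (x - y)) ^ 2 * (x - y)) := by positivity
  have e1 : ((q - 1) * (x - y)) * (e / (q - 1) - 2 * (d / (q / 2) / (x - y)) * (d / (q / 2)) +
    (d / (q / 2) / (x - y)) ^ 2 * (x - y)) = (x - y) * e - 4 * (q - 1) / q ^ 2 * d ^ 2 := by
    field_simp
    ring
  linarith

lemma abs_sq_sub_sq_mul_log_le {x T : ℝ} (hx : 0 ≤ x) (hT : 0 < T) (hxT : 2 * x ≤ T) :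
    |(T ^ 2 - x ^ 2) * (Real.log (T + x) - Real.log T) - (T * x - x ^ 2 / 2)| ≤
      3 * x ^ 3 / T := by
  set y := x / T with hy
  have hxy : x = T * y := by rw [hy]; field_simp
  have hy0 : 0 ≤ y := by positivity
  have hy1 : y ≤ 1 / 2 := by rw [hy, div_le_iff₀ hT]; linarith
  have hlog : Real.log (T + x) - Real.log T = Real.log (1 + y) := by
    rw [← Real.log_div (by positivity) hT.ne']
    congr 1
    rw [hy]
    field_simp
  have h := Real.abs_log_sub_add_sum_range_le (x := -y) (by rw [abs_neg, abs_of_nonneg hy0]; linarith) 2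
  rw [abs_neg, abs_of_nonneg hy0, sub_neg_eq_add] at h
  simp only [Finset.sum_range_succ, Finset.sum_range_zero] at h
  norm_num at h
  rw [hlog]
  have h2 : y ^ 3 / (1 - y) ≤ 2 * y ^ 3 := by
    rw [div_le_iff₀ (by linarith)]
    nlinarith [pow_nonneg hy0 3]
  have h3 := abs_le.1 (h.trans h2)
  set L := Real.log (1 + y)
  have hTx : 0 ≤ T ^ 2 - x ^ 2 := by nlinarith
  have e : 3 * x ^ 3 / T = 3 * T ^ 2 * y ^ 3 := by
    rw [hxy]; field_simp
  rw [e, abs_le]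
  rw [hxy] at hTx ⊢
  have hW : T ^ 2 - (T * y) ^ 2 ≤ T ^ 2 := by nlinarith [sq_nonneg (T * y)]
  set W := T ^ 2 - (T * y) ^ 2 with hWdef
  set δ := L - y + y ^ 2 / 2 with hδ
  have hδ' : |δ| ≤ 2 * y ^ 3 := by
    rw [abs_le]
    constructor <;> linarith [h3.1, h3.2]
  have hWδ : |W * δ| ≤ T ^ 2 * (2 * y ^ 3) := by
    rw [abs_mul, abs_of_nonneg hTx]
    exact mul_le_mul hW hδ' (abs_nonneg _) (by positivity)
  have e2 : W * L - (T * (T * y) - (T * y) ^ 2 / 2) =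
      W * δ - T ^ 2 * y ^ 3 + T ^ 2 * y ^ 3 * (y / 2) := by
    rw [hδ, hWdef]
    ring
  have hTy : 0 ≤ T ^ 2 * y ^ 3 := by positivity
  have hTy1 : 0 ≤ T ^ 2 * y ^ 3 * (y / 2) := by positivity
  have hTy2 : T ^ 2 * y ^ 3 * (y / 2) ≤ T ^ 2 * y ^ 3 :=
    mul_le_of_le_one_right hTy (by linarith)
  rw [e2]
  constructor <;> linarith [(abs_le.1 hWδ).1, (abs_le.1 hWδ).2]

lemma sum_mul_sq_mul_log_nonpos {ι : Type*} (s : Finset ι) (c x : ι → ℝ)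
    (hx : ∀ i ∈ s, 0 ≤ x i) (h0 : ∑ i ∈ s, c i = 0) (h1 : ∑ i ∈ s, c i * x i = 0)
    (h2 : ∑ i ∈ s, c i * x i ^ 2 = 0)
    (hlog : ∀ t : ℝ, 0 < t → ∑ i ∈ s, c i * Real.log (x i + t) ≤ 0) :
    ∑ i ∈ s, c i * (x i ^ 2 * Real.log (x i)) ≤ 0 := by
  let K : ℝ → ℝ := fun T => ∑ i ∈ s, c i * ((T - x i) * mulLog (T + x i))
  have hK0 : K 0 = -∑ i ∈ s, c i * (x i ^ 2 * Real.log (x i)) := by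
    simp only [K, mulLog, zero_sub, zero_add, ← Finset.sum_neg_distrib]
    exact Finset.sum_congr rfl fun i _ => by ring
  have hKc : Continuous K := by
    refine continuous_finsetSum _ fun i _ => continuous_const.mul ?_
    exact (continuous_id.sub continuous_const).mul (continuous_mulLog.comp (by fun_prop))
  have hKd : ∀ T ∈ Set.Ioi (0 : ℝ), HasDerivAt K (2 * T * ∑ i ∈ s, c i * Real.log (x i + T)) T := by
    intro T hT
    have hT' : (0 : ℝ) < T := hT
    have : HasDerivAt K (∑ i ∈ s, c i * (1 * mulLog (T + x i) +
        (T - x i) * (1 * Real.log (T + x i) + (T + x i) * (1 / (T + x i))))) T := by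
      refine HasDerivAt.fun_sum fun i hi => HasDerivAt.const_mul _ ?_
      have hp : 0 < T + x i := add_pos_of_pos_of_nonneg hT' (hx i hi)
      have e1 : HasDerivAt (fun s : ℝ => s + x i) 1 T := (hasDerivAt_id T).add_const _
      exact ((hasDerivAt_id T).sub_const (x i)).mul (e1.mul (e1.log hp.ne'))
    refine this.congr_deriv ?_
    have : ∀ i ∈ s, c i * (1 * mulLog (T + x i) +
        (T - x i) * (1 * Real.log (T + x i) + (T + x i) * (1 / (T + x i)))) =
        2 * T * (c i * Real.log (x i + T)) + (T * c i - c i * x i) := by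
      intro i hi
      have hp : 0 < T + x i := add_pos_of_pos_of_nonneg hT' (hx i hi)
      rw [mulLog, mul_one_div_cancel hp.ne', add_comm (x i) T]
      ring
    rw [Finset.sum_congr rfl this, Finset.sum_add_distrib, Finset.sum_sub_distrib,
      ← Finset.mul_sum, ← Finset.mul_sum, h0, h1]
    ring
  have hanti : AntitoneOn K (Set.Ici 0) := by
    apply antitoneOn_of_deriv_nonpos (convex_Ici 0) hKc.continuousOn
    · rw [interior_Ici]
      exact fun x hx => (hKd x hx).differentiableAt.differentiableWithinAt
    · rw [interior_Ici]
      intro T hT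
      rw [(hKd T hT).deriv]
      have hT' : (0 : ℝ) < T := hT
      exact mul_nonpos_of_nonneg_of_nonpos (by positivity) (hlog T hT')
  set C := ∑ i ∈ s, |c i| * (3 * x i ^ 3)
  set M := ∑ i ∈ s, 2 * x i
  have hlow : ∀ T : ℝ, M < T → 0 < T → -(C / T) ≤ K 0 := by
    intro T hMT hT
    refine le_trans ?_ (hanti Set.self_mem_Ici hT.le hT.le)
    have e : K T = ∑ i ∈ s, c i * ((T ^ 2 - x i ^ 2) * (Real.log (T + x i) - Real.log T) -
        (T * x i - x i ^ 2 / 2)) := by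
      have : ∀ i ∈ s, c i * ((T ^ 2 - x i ^ 2) * (Real.log (T + x i) - Real.log T) -
        (T * x i - x i ^ 2 / 2)) = c i * ((T - x i) * mulLog (T + x i)) -
          (T ^ 2 * Real.log T) * c i - T * (c i * x i) +
          (Real.log T + 1 / 2) * (c i * x i ^ 2) := by
        intro i _
        rw [mulLog]
        ring
      rw [Finset.sum_congr rfl this, Finset.sum_add_distrib, Finset.sum_sub_distrib,
        Finset.sum_sub_distrib, ← Finset.mul_sum, ← Finset.mul_sum, ← Finset.mul_sum, h0, h1, h2]
      simp [K]
    rw [e, neg_le]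
    refine (neg_le_abs _).trans ((Finset.abs_sum_le_sum_abs _ _).trans ?_)
    rw [Finset.sum_div]
    refine Finset.sum_le_sum fun i hi => ?_
    rw [abs_mul, mul_div_assoc]
    refine mul_le_mul_of_nonneg_left (abs_sq_sub_sq_mul_log_le (hx i hi) hT ?_) (abs_nonneg _)
    exact (Finset.single_le_sum (f := fun i => 2 * x i)
      (fun j hj => mul_nonneg zero_le_two (hx j hj)) hi).trans hMT.le
  have hlim : Filter.Tendsto (fun T : ℝ => -(C / T)) Filter.atTop (nhds 0) := by
    simpa using (Filter.Tendsto.const_div_atTop Filter.tendsto_id C).neg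
  have : 0 ≤ K 0 := by
    refine le_of_tendsto hlim ?_
    filter_upwards [Filter.eventually_gt_atTop M, Filter.eventually_gt_atTop 0] with T h1 h2
    exact hlow T h1 h2
  linarith

lemma sub_mul_sub_mul_sq_le {P N a b h : ℝ} (ha : 0 ≤ a) (hb : 0 ≤ b) (haP : a < P)
    (hbN : b < N) (hh : h ^ 2 ≤ a * b) :
    (P - a) * (N - b) * ((P + N) / 2) ^ 2 ≤ ((P + N) / 2 - h) ^ 2 * (P * N) := by
  have hP : 0 < P := ha.trans_lt haP
  have hN : 0 < N := hb.trans_lt hbN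
  have hPN : 0 < P * N := mul_pos hP hN
  set c := (P + N) / 2 with hc
  have hc0 : 0 < c := by positivity
  set g := Real.sqrt (a * b / (P * N)) with hg
  have hg2 : g ^ 2 * (P * N) = a * b := by
    rw [hg, Real.sq_sqrt (by positivity)]
    field_simp
  have hg0 : 0 ≤ g := Real.sqrt_nonneg _
  have hg1 : g ≤ 1 := by
    rw [hg, Real.sqrt_le_one, div_le_one hPN]
    exact mul_le_mul haP.le hbN.le hb hP.le
  have hcPN : P * N ≤ c ^ 2 := by rw [hc]; nlinarith [sq_nonneg (P - N)]
  have hcg : h ≤ c * g := by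
    refine le_of_sq_le_sq ?_ (by positivity)
    calc h ^ 2 ≤ g ^ 2 * (P * N) := by rw [hg2]; exact hh
      _ ≤ g ^ 2 * c ^ 2 := mul_le_mul_of_nonneg_left hcPN (sq_nonneg _)
      _ = (c * g) ^ 2 := by ring
  have hch : (c * (1 - g)) ^ 2 ≤ (c - h) ^ 2 :=
    pow_le_pow_left₀ (mul_nonneg hc0.le (by linarith)) (by linarith) 2
  have hab : 2 * g * (P * N) ≤ a * N + b * P := by
    refine le_of_sq_le_sq ?_ (by positivity)
    have : (2 * g * (P * N)) ^ 2 = 4 * (a * N) * (b * P) := by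
      rw [mul_pow, mul_pow, sq (P * N), ← mul_assoc, mul_assoc (2 ^ 2) (g ^ 2), hg2]
      ring
    rw [this]
    nlinarith [sq_nonneg (a * N - b * P)]
  have h1 : (P - a) * (N - b) ≤ (1 - g) ^ 2 * (P * N) := by nlinarith
  calc (P - a) * (N - b) * c ^ 2 ≤ (1 - g) ^ 2 * (P * N) * c ^ 2 :=
        mul_le_mul_of_nonneg_right h1 (sq_nonneg _)
    _ = (c * (1 - g)) ^ 2 * (P * N) := by ring
    _ ≤ _ := mul_le_mul_of_nonneg_right hch hPN.le

lemma Matrix.PosDef.re_conjTranspose_mul_sq_le {κ : Type*} [Fintype κ] [DecidableEq κ]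
    {S : Matrix κ κ ℂ} (hS : S.PosDef) (u z : Matrix κ Unit ℂ) :
    ((uᴴ * z) () ()).re ^ 2 ≤ ((uᴴ * S⁻¹ * u) () ()).re * ((zᴴ * S * z) () ()).re := by
  have hu : IsUnit S.det := (Matrix.isUnit_iff_isUnit_det S).1 hS.isUnit
  have hH : (S⁻¹)ᴴ = S⁻¹ := hS.inv.isHermitian
  have key : ∀ l : ℝ, 0 ≤ ((zᴴ * S * z) () ()).re * (l * l) +
      (-2 * ((uᴴ * z) () ()).re) * l + ((uᴴ * S⁻¹ * u) () ()).re := by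
    intro l
    have h := (hS.posSemidef.conjTranspose_mul_mul_same (S⁻¹ * u - (l : ℂ) • z)).diag_nonneg
      (i := ())
    have e : (S⁻¹ * u - (l : ℂ) • z)ᴴ * S * (S⁻¹ * u - (l : ℂ) • z) =
        uᴴ * S⁻¹ * u - (l : ℂ) • (uᴴ * z) - (l : ℂ) • (uᴴ * z)ᴴ +
          ((l : ℂ) * l) • (zᴴ * S * z) := by
      have e1 : uᴴ * S⁻¹ * S = uᴴ := by
        rw [Matrix.mul_assoc, Matrix.nonsing_inv_mul _ hu, Matrix.mul_one]
      have e2 : S * (S⁻¹ * u) = u := by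
        rw [← Matrix.mul_assoc, Matrix.mul_nonsing_inv _ hu, Matrix.one_mul]
      rw [conjTranspose_sub, conjTranspose_mul, hH, conjTranspose_smul, Matrix.sub_mul, e1,
        Matrix.sub_mul, Matrix.mul_sub, Matrix.smul_mul, Matrix.smul_mul, Matrix.mul_sub,
        Matrix.mul_smul, Matrix.mul_smul, Matrix.mul_assoc zᴴ, e2, conjTranspose_mul,
        conjTranspose_conjTranspose, Matrix.mul_assoc uᴴ]
      simp only [Complex.star_def, Complex.conj_ofReal, smul_sub, smul_smul, Matrix.mul_assoc]
      abel
    rw [e] at h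
    have h' := (Complex.le_def.1 h).1
    simp only [Matrix.add_apply, Matrix.sub_apply, Matrix.smul_apply, conjTranspose_apply,
      smul_eq_mul, Complex.add_re, Complex.sub_re, Complex.re_ofReal_mul, Complex.star_def,
      Complex.conj_re, Complex.zero_re, ← Complex.ofReal_mul] at h'
    linarith
  have := discrim_le_zero key
  rw [discrim] at this
  nlinarith

lemma Matrix.PosDef.re_inv_sq_le {κ : Type*} [Fintype κ] [DecidableEq κ]
    {C Y : Matrix κ κ ℂ} (hp : (C + Y).PosDef) (hm : (C - Y).PosDef) (hC : C.PosDef)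
    (u : Matrix κ Unit ℂ) :
    ((uᴴ * C⁻¹ * u) () ()).re ^ 2 ≤
      ((uᴴ * (C + Y)⁻¹ * u) () ()).re * ((uᴴ * (C - Y)⁻¹ * u) () ()).re := by
  have nn : ∀ {S : Matrix κ κ ℂ}, S.PosDef → ∀ z : Matrix κ Unit ℂ,
      0 ≤ ((zᴴ * S * z) () ()).re := fun hS z =>
    (Complex.le_def.1 ((hS.posSemidef.conjTranspose_mul_mul_same z).diag_nonneg (i := ()))).1
  have hu : IsUnit C.det := (Matrix.isUnit_iff_isUnit_det C).1 hC.isUnit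
  have hH : (C⁻¹)ᴴ = C⁻¹ := hC.inv.isHermitian
  have h1 := hp.re_conjTranspose_mul_sq_le u (C⁻¹ * u)
  have h2 := hm.re_conjTranspose_mul_sq_le u (C⁻¹ * u)
  rw [← Matrix.mul_assoc] at h1 h2
  have hs : (((C⁻¹ * u)ᴴ * (C + Y) * (C⁻¹ * u)) () ()).re +
      (((C⁻¹ * u)ᴴ * (C - Y) * (C⁻¹ * u)) () ()).re = 2 * ((uᴴ * C⁻¹ * u) () ()).re := by
    rw [← Complex.add_re, ← Matrix.add_apply, ← Matrix.add_mul, ← Matrix.mul_add,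
      add_add_sub_cancel, conjTranspose_mul, hH, Matrix.mul_add, Matrix.mul_assoc uᴴ,
      Matrix.nonsing_inv_mul _ hu, Matrix.mul_one, Matrix.add_mul, ← Matrix.mul_assoc,
      Matrix.add_apply, Complex.add_re, two_mul]
  have a0 := nn hp.inv u
  have b0 := nn hm.inv u
  have s0 := nn hp (C⁻¹ * u)
  have t0 := nn hm (C⁻¹ * u)
  have h0 := nn hC.inv u
  generalize ((uᴴ * C⁻¹ * u) () ()).re = h at *
  generalize ((uᴴ * (C + Y)⁻¹ * u) () ()).re = a at *
  generalize ((uᴴ * (C - Y)⁻¹ * u) () ()).re = b at *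
  generalize (((C⁻¹ * u)ᴴ * (C + Y) * (C⁻¹ * u)) () ()).re = s at *
  generalize (((C⁻¹ * u)ᴴ * (C - Y) * (C⁻¹ * u)) () ()).re = t at *
  rcases h0.eq_or_lt with rfl | hpos
  · simpa using mul_nonneg a0 b0
  have st : s * t ≤ h ^ 2 := by nlinarith [sq_nonneg (s - t)]
  have : h ^ 2 * h ^ 2 ≤ (a * b) * h ^ 2 :=
    calc h ^ 2 * h ^ 2 ≤ (a * s) * (b * t) := mul_le_mul h1 h2 (sq_nonneg _) (mul_nonneg a0 s0)
      _ = (a * b) * (s * t) := by ring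
      _ ≤ _ := mul_le_mul_of_nonneg_left st (mul_nonneg a0 b0)
  exact le_of_mul_le_mul_right this (by positivity)

lemma Matrix.PosDef.det_re_fromBlocks {κ : Type*} [Fintype κ] [DecidableEq κ]
    {C : Matrix κ κ ℂ} (hC : C.PosDef) (u : Matrix κ Unit ℂ) (D : Matrix Unit Unit ℂ) :
    (fromBlocks C u uᴴ D).det.re =
      C.det.re * ((D () ()).re - ((uᴴ * C⁻¹ * u) () ()).re) := by
  have hu : IsUnit C.det := (Matrix.isUnit_iff_isUnit_det C).1 hC.isUnit
  let := C.invertibleOfIsUnitDet hu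
  have him : C.det.im = 0 := (Complex.le_def.1 hC.det_pos.le).2.symm
  rw [det_fromBlocks₁₁, Matrix.invOf_eq_nonsing_inv, det_unique (D - _), Complex.mul_re, him,
    Matrix.sub_apply, Complex.sub_re]
  simp [PUnit.default_eq_unit]

lemma Matrix.fromBlocks_sub {l m n o α : Type*} [AddGroup α] (A A' : Matrix n l α)
    (B B' : Matrix n m α) (C C' : Matrix o l α) (D D' : Matrix o m α) :
    fromBlocks A B C D - fromBlocks A' B' C' D' =
      fromBlocks (A - A') (B - B') (C - C') (D - D') := by
  ext (_ | _) (_ | _) <;> rfl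

theorem det_mul_det_mul_prod_le_fromBlocks {κ : Type*} [Fintype κ] [DecidableEq κ]
    {C : Matrix κ κ ℂ} {y : κ → ℝ} (u : Matrix κ Unit ℂ) (D : Matrix Unit Unit ℂ) (d : ℝ)
    (ih : (C + diagonal fun i => (y i : ℂ)).det.re * (C - diagonal fun i => (y i : ℂ)).det.re *
      ∏ i, (C i i).re ^ 2 ≤ C.det.re ^ 2 * ∏ i, ((C i i).re ^ 2 - y i ^ 2))
    (hp : (fromBlocks (C + diagonal fun i => (y i : ℂ)) u uᴴ (D + diagonal fun _ => (d : ℂ))).PosDef)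
    (hm : (fromBlocks (C - diagonal fun i => (y i : ℂ)) u uᴴ (D - diagonal fun _ => (d : ℂ))).PosDef) :
    (fromBlocks (C + diagonal fun i => (y i : ℂ)) u uᴴ (D + diagonal fun _ => (d : ℂ))).det.re *
      (fromBlocks (C - diagonal fun i => (y i : ℂ)) u uᴴ (D - diagonal fun _ => (d : ℂ))).det.re *
      ((∏ i, (C i i).re ^ 2) * (D () ()).re ^ 2) ≤
    (fromBlocks C u uᴴ D).det.re ^ 2 *
      ((∏ i, ((C i i).re ^ 2 - y i ^ 2)) * ((D () ()).re ^ 2 - d ^ 2)) := by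
  set Y := diagonal fun i => (y i : ℂ)
  have hCp : (C + Y).PosDef := hp.submatrix (e := Sum.inl) Sum.inl_injective
  have hCm : (C - Y).PosDef := hm.submatrix (e := Sum.inl) Sum.inl_injective
  have hC : C.PosDef := by
    have := (hCp.add hCm).smul (show (0 : ℝ) < 1 / 2 by norm_num)
    rwa [add_add_sub_cancel, ← two_smul ℝ C, smul_smul, one_div_mul_cancel two_ne_zero,
      one_smul] at this
  have pos : ∀ {κ' : Type _} [Fintype κ'] [DecidableEq κ'] {S : Matrix κ' κ' ℂ},
    S.PosDef → 0 < S.det.re := fun h => (Complex.lt_def.1 h.det_pos).1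
  have nn : ∀ {S : Matrix κ κ ℂ}, S.PosDef → 0 ≤ ((uᴴ * S * u) () ()).re := fun hS =>
    (Complex.le_def.1 ((hS.posSemidef.conjTranspose_mul_mul_same u).diag_nonneg (i := ()))).1
  have p1 := (Complex.lt_def.1 hp.det_pos).1
  have p2 := (Complex.lt_def.1 hm.det_pos).1
  have h1 := pos hCp
  have h2 := pos hCm
  rw [Complex.zero_re, hCp.det_re_fromBlocks, mul_pos_iff_of_pos_left h1] at p1
  rw [Complex.zero_re, hCm.det_re_fromBlocks, mul_pos_iff_of_pos_left h2] at p2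
  have a0 := nn hCp.inv
  have b0 := nn hCm.inv
  have key := hCp.re_inv_sq_le hCm hC u
  rw [hCp.det_re_fromBlocks, hCm.det_re_fromBlocks, hC.det_re_fromBlocks]
  simp only [Matrix.add_apply, Matrix.sub_apply, diagonal_apply_eq, Complex.add_re,
    Complex.sub_re, Complex.ofReal_re] at p1 p2 ⊢
  have main := sub_mul_sub_mul_sq_le a0 b0 (sub_pos.1 p1) (sub_pos.1 p2) key
  have e1 : ((D () ()).re + d + ((D () ()).re - d)) / 2 = (D () ()).re := by ring
  have e2 : ((D () ()).re + d) * ((D () ()).re - d) = (D () ()).re ^ 2 - d ^ 2 := by ring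
  rw [e1, e2] at main
  have := mul_le_mul ih main (mul_nonneg (mul_nonneg p1.le p2.le) (sq_nonneg _))
    (le_trans (mul_nonneg (mul_nonneg h1.le h2.le)
      (Finset.prod_nonneg fun i _ => sq_nonneg _)) ih)
  calc _ = _ := ?_
    _ ≤ _ := this
    _ = _ := ?_
  all_goals ring

theorem det_mul_det_mul_prod_le.{u} {ι : Type u} [Fintype ι] [DecidableEq ι]
    (W : Matrix ι ι ℂ) (y : ι → ℝ) (hp : (W + diagonal fun i => (y i : ℂ)).PosDef)
    (hm : (W - diagonal fun i => (y i : ℂ)).PosDef) :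
    (W + diagonal fun i => (y i : ℂ)).det.re * (W - diagonal fun i => (y i : ℂ)).det.re *
      ∏ i, (W i i).re ^ 2 ≤ W.det.re ^ 2 * ∏ i, ((W i i).re ^ 2 - y i ^ 2) := by
  induction h : Fintype.card ι generalizing ι with
  | zero =>
    have := Fintype.card_eq_zero_iff.1 h
    simp
  | succ n ih =>
    have e : ι ≃ ULift.{u} (Fin n) ⊕ Unit :=
      Fintype.equivOfCardEq (by simp [h])
    have hW : W.IsHermitian := by
      have := hp.isHermitian.add hm.isHermitian
      rw [add_add_sub_cancel] at this
      ext i j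
      have h3 := congrFun (congrFun this.eq i) j
      simp only [conjTranspose_apply, Matrix.add_apply, star_add] at h3 ⊢
      linear_combination h3 / 2
    set W' := W.submatrix e.symm e.symm with hW'
    have hW'H : W'.IsHermitian := hW.submatrix _
    have hd : (diagonal fun i => ((y i : ℝ) : ℂ)).submatrix e.symm e.symm =
      diagonal fun i => ((y (e.symm i) : ℝ) : ℂ) := by
      rw [submatrix_diagonal_equiv]; rfl
    have b : W' = fromBlocks W'.toBlocks₁₁ W'.toBlocks₁₂ W'.toBlocks₁₂ᴴ W'.toBlocks₂₂ := by
      conv_lhs => rw [← fromBlocks_toBlocks W']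
      congr 1
      ext i j
      exact (hW'H.apply _ _).symm
    have bd : (diagonal fun i => ((y (e.symm i) : ℝ) : ℂ)) = fromBlocks
        (diagonal fun i => ((y (e.symm (Sum.inl i)) : ℝ) : ℂ)) 0 0
        (diagonal fun _ => ((y (e.symm (Sum.inr ())) : ℝ) : ℂ)) := by
      rw [fromBlocks_diagonal]
      congr 1
      ext i
      cases i <;> rfl
    have hp' := hp.submatrix (e := e.symm) e.symm.injective
    have hm' := hm.submatrix (e := e.symm) e.symm.injective
    rw [submatrix_add, Pi.add_apply, Pi.add_apply, hd, ← hW', b, bd, fromBlocks_add] at hp'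
    rw [submatrix_sub, Pi.sub_apply, Pi.sub_apply, hd, ← hW', b, bd, fromBlocks_sub] at hm'
    rw [add_zero, add_zero] at hp'
    rw [sub_zero, sub_zero] at hm'
    have key := det_mul_det_mul_prod_le_fromBlocks _ _ _
      (ih W'.toBlocks₁₁ (fun i => y (e.symm (Sum.inl i)))
        (hp'.submatrix (e := Sum.inl) Sum.inl_injective)
        (hm'.submatrix (e := Sum.inl) Sum.inl_injective) (by simp)) hp' hm'
    have d1 : (W + diagonal fun i => ((y i : ℝ) : ℂ)).det =
        (fromBlocks (W'.toBlocks₁₁ + diagonal fun i => ((y (e.symm (Sum.inl i)) : ℝ) : ℂ))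
          W'.toBlocks₁₂ W'.toBlocks₁₂ᴴ
          (W'.toBlocks₂₂ + diagonal fun _ => ((y (e.symm (Sum.inr ())) : ℝ) : ℂ))).det := by
      rw [← det_submatrix_equiv_self e.symm, submatrix_add, Pi.add_apply, Pi.add_apply, hd,
        ← hW', bd]
      conv_lhs => rw [b, fromBlocks_add, add_zero, add_zero]
    have d2 : (W - diagonal fun i => ((y i : ℝ) : ℂ)).det =
        (fromBlocks (W'.toBlocks₁₁ - diagonal fun i => ((y (e.symm (Sum.inl i)) : ℝ) : ℂ))
          W'.toBlocks₁₂ W'.toBlocks₁₂ᴴ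
          (W'.toBlocks₂₂ - diagonal fun _ => ((y (e.symm (Sum.inr ())) : ℝ) : ℂ))).det := by
      rw [← det_submatrix_equiv_self e.symm, submatrix_sub, Pi.sub_apply, Pi.sub_apply, hd,
        ← hW', bd]
      conv_lhs => rw [b, fromBlocks_sub, sub_zero, sub_zero]
    have d3 : W.det = (fromBlocks W'.toBlocks₁₁ W'.toBlocks₁₂ W'.toBlocks₁₂ᴴ W'.toBlocks₂₂).det := by
      rw [← b, hW', det_submatrix_equiv_self]
    rw [d1, d2, d3, ← e.symm.prod_comp, ← e.symm.prod_comp]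
    simp only [Fintype.prod_sum_type, Fintype.prod_unique]
    exact key

section Spectrum

variable {ι κ : Type*} [Fintype ι] [DecidableEq ι] [Fintype κ] [DecidableEq κ]

/-- The sum of `φ` over the real parts of the eigenvalues of `A`, with multiplicity. -/
noncomputable def specSum (φ : ℝ → ℝ) (A : Matrix ι ι ℂ) : ℝ :=
  (A.charpoly.roots.map fun z => φ z.re).sum

lemma Matrix.IsHermitian.exists_eq_conj_diagonal {A : Matrix ι ι ℂ} (hA : A.IsHermitian) :
    ∃ (V : Matrix ι ι ℂ) (d : ι → ℝ), Vᴴ * V = 1 ∧ (d = hA.eigenvalues) ∧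
      A = V * diagonal (fun i => (d i : ℂ)) * Vᴴ :=
  ⟨hA.eigenvectorUnitary, hA.eigenvalues, mem_unitaryGroup_iff'.1 hA.eigenvectorUnitary.2, rfl, by
    conv_lhs => rw [hA.spectral_theorem]
    rfl⟩

lemma Matrix.PosSemidef.exists_eq_conj_diagonal {A : Matrix ι ι ℂ} (hA : A.PosSemidef) :
    ∃ (V : Matrix ι ι ℂ) (d : ι → ℝ), Vᴴ * V = 1 ∧ (∀ i, 0 ≤ d i) ∧
      A = V * diagonal (fun i => (d i : ℂ)) * Vᴴ := by
  obtain ⟨V, d, hV, rfl, h⟩ := hA.isHermitian.exists_eq_conj_diagonal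
  exact ⟨V, _, hV, hA.eigenvalues_nonneg, h⟩

lemma specSum_mul_comm (φ : ℝ → ℝ) (A B : Matrix ι ι ℂ) :
    specSum φ (A * B) = specSum φ (B * A) := by
  rw [specSum, charpoly_mul_comm, specSum]

lemma specSum_conj (φ : ℝ → ℝ) {V : Matrix ι ι ℂ} (hV : Vᴴ * V = 1) (A : Matrix ι ι ℂ) :
    specSum φ (V * A * Vᴴ) = specSum φ A := by
  rw [specSum_mul_comm, ← Matrix.mul_assoc, hV, Matrix.one_mul]

lemma specSum_diagonal (φ : ℝ → ℝ) (d : ι → ℝ) :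
    specSum φ (diagonal fun i => (d i : ℂ)) = ∑ i, φ (d i) := by
  have : (diagonal fun i => (d i : ℂ)).charpoly.roots = Finset.univ.val.map fun i => (d i : ℂ) := by
    rw [charpoly_diagonal]
    exact Polynomial.roots_multiset_prod_X_sub_C (Finset.univ.val.map fun i => (d i : ℂ)) ▸ by
      rw [Multiset.map_map]; rfl
  rw [specSum, this, Multiset.map_map]
  rfl

lemma specSum_conj_diagonal (φ : ℝ → ℝ) {V : Matrix ι ι ℂ} (hV : Vᴴ * V = 1) (d : ι → ℝ) :
    specSum φ (V * (diagonal fun i => (d i : ℂ)) * Vᴴ) = ∑ i, φ (d i) := by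
  rw [specSum_conj φ hV, specSum_diagonal]

lemma specSum_submatrix (φ : ℝ → ℝ) (e : κ ≃ ι) (A : Matrix ι ι ℂ) :
    specSum φ (A.submatrix e e) = specSum φ A := by
  rw [specSum, specSum, ← charpoly_reindex e.symm A]
  rfl

lemma specSum_fromBlocks_zero (φ : ℝ → ℝ) (A : Matrix ι ι ℂ) (B : Matrix κ κ ℂ) :
    specSum φ (fromBlocks A 0 0 B) = specSum φ A + specSum φ B := by
  rw [specSum, charpoly_fromBlocks_zero₁₂,
    Polynomial.roots_mul (mul_ne_zero A.charpoly_monic.ne_zero B.charpoly_monic.ne_zero),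
    Multiset.map_add, Multiset.sum_add]
  rfl

lemma conj_diagonal_mul {V : Matrix ι ι ℂ} (hV : Vᴴ * V = 1) (c d : ι → ℂ) :
    V * diagonal c * Vᴴ * (V * diagonal d * Vᴴ) = V * diagonal (fun i => c i * d i) * Vᴴ := by
  calc _ = V * diagonal c * (Vᴴ * V) * diagonal d * Vᴴ := by simp only [Matrix.mul_assoc]
    _ = _ := by rw [hV, Matrix.mul_one, Matrix.mul_assoc V, diagonal_mul_diagonal]

lemma isHermitian_conj_diagonal (V : Matrix ι ι ℂ) (d : ι → ℝ) :
    (V * (diagonal fun i => (d i : ℂ)) * Vᴴ).IsHermitian := by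
  refine isHermitian_mul_mul_conjTranspose V ?_
  rw [IsHermitian, diagonal_conjTranspose]
  congr 1
  ext i
  simp

lemma posSemidef_conj_diagonal (V : Matrix ι ι ℂ) {d : ι → ℝ} (hd : ∀ i, 0 ≤ d i) :
    (V * (diagonal fun i => (d i : ℂ)) * Vᴴ).PosSemidef :=
  (PosSemidef.diagonal fun i => Complex.zero_le_real.2 (hd i)).mul_mul_conjTranspose_same V

lemma trace_conj_diagonal {V : Matrix ι ι ℂ} (hV : Vᴴ * V = 1) (d : ι → ℝ) :
    (V * (diagonal fun i => (d i : ℂ)) * Vᴴ).trace = ∑ i, (d i : ℂ) := by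
  rw [trace_mul_comm, ← Matrix.mul_assoc, hV, Matrix.one_mul, trace_diagonal]

lemma specSum_congr {φ ψ : ℝ → ℝ} {A : Matrix ι ι ℂ} (hA : A.PosSemidef)
    (h : ∀ x, 0 ≤ x → φ x = ψ x) : specSum φ A = specSum ψ A := by
  obtain ⟨V, d, hV, hd, rfl⟩ := hA.exists_eq_conj_diagonal
  rw [specSum_conj_diagonal φ hV, specSum_conj_diagonal ψ hV]
  exact Finset.sum_congr rfl fun i _ => h _ (hd i)

lemma specSum_nonneg {φ : ℝ → ℝ} {A : Matrix ι ι ℂ} (hA : A.PosSemidef)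
    (h : ∀ x, 0 ≤ x → 0 ≤ φ x) : 0 ≤ specSum φ A := by
  obtain ⟨V, d, hV, hd, rfl⟩ := hA.exists_eq_conj_diagonal
  rw [specSum_conj_diagonal φ hV]
  exact Finset.sum_nonneg fun i _ => h _ (hd i)

lemma specSum_id {A : Matrix ι ι ℂ} (hA : A.IsHermitian) :
    specSum (fun x => x) A = A.trace.re := by
  obtain ⟨V, d, hV, -, rfl⟩ := hA.exists_eq_conj_diagonal
  rw [specSum_conj_diagonal _ hV, trace_conj_diagonal hV]
  simp

lemma specSum_add_smul_one (φ : ℝ → ℝ) {A : Matrix ι ι ℂ} (hA : A.IsHermitian) (c : ℝ) :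
    specSum φ (A + (c : ℂ) • 1) = specSum (fun x => φ (x + c)) A := by
  obtain ⟨V, d, hV, -, rfl⟩ := hA.exists_eq_conj_diagonal
  have hV' := mul_eq_one_comm.1 hV
  have : V * (diagonal fun i => (d i : ℂ)) * Vᴴ + (c : ℂ) • 1 =
      V * (diagonal fun i => ((d i + c : ℝ) : ℂ)) * Vᴴ := by
    have e : (diagonal fun i => ((d i + c : ℝ) : ℂ)) =
        (diagonal fun i => (d i : ℂ)) + (c : ℂ) • (1 : Matrix ι ι ℂ) := by
      rw [smul_one_eq_diagonal, diagonal_add]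
      simp
    rw [e, Matrix.mul_add, Matrix.add_mul, Matrix.mul_smul, Matrix.mul_one, Matrix.smul_mul, hV']
  rw [this, specSum_conj_diagonal _ hV, specSum_conj_diagonal _ hV]

lemma specSum_mul_self (φ : ℝ → ℝ) {A : Matrix ι ι ℂ} (hA : A.IsHermitian) :
    specSum φ (A * A) = specSum (fun x => φ (x ^ 2)) A := by
  obtain ⟨V, d, hV, -, rfl⟩ := hA.exists_eq_conj_diagonal
  have e : (fun i => (d i : ℂ) * d i) = fun i => ((d i ^ 2 : ℝ) : ℂ) := by
    ext i
    push_cast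
    ring
  rw [conj_diagonal_mul hV, e, specSum_conj_diagonal _ hV, specSum_conj_diagonal _ hV]

lemma snorm_eq_specSum (p : ℝ) (f : Matrix ι ι ℂ) :
    snorm p f = (specSum (fun x => x ^ (p / 2)) (fᴴ * f) / Fintype.card ι) ^ (1 / p) := by
  have hf : (fᴴ * f).IsHermitian := isHermitian_conjTranspose_mul_self f
  have hV : (hf.eigenvectorUnitary : Matrix ι ι ℂ)ᴴ * hf.eigenvectorUnitary = 1 :=
    mem_unitaryGroup_iff'.1 hf.eigenvectorUnitary.2
  have h1 : specSum (fun x => x ^ (p / 2)) (fᴴ * f) = ∑ i, hf.eigenvalues i ^ (p / 2) := by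
    conv_lhs => rw [hf.spectral_theorem]
    exact specSum_conj_diagonal _ hV _
  rw [snorm, ntrace, mpow, hermFC, dif_pos hf, h1]
  congr 2
  refine (congrArg Complex.re (trace_conj_diagonal hV _)).trans ?_
  simp

lemma snorm_eq_specSum_of_posSemidef (p : ℝ) {f : Matrix ι ι ℂ} (hf : f.PosSemidef) :
    snorm p f = (specSum (fun x => x ^ p) f / Fintype.card ι) ^ (1 / p) := by
  rw [snorm_eq_specSum, hf.isHermitian.eq, specSum_mul_self _ hf.isHermitian]
  congr 2
  refine specSum_congr hf fun x hx => ?_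
  rw [← Real.rpow_natCast, ← Real.rpow_mul hx]
  congr 1
  push_cast
  ring

/-- A linear map on matrices that preserves positivity, the identity and the trace. -/
structure IsBistochastic (Φ : Matrix ι ι ℂ →ₗ[ℂ] Matrix ι ι ℂ) : Prop where
  posSemidef : ∀ {A : Matrix ι ι ℂ}, A.PosSemidef → (Φ A).PosSemidef
  map_one : Φ 1 = 1
  trace_map : ∀ A : Matrix ι ι ℂ, (Φ A).trace = A.trace

lemma IsBistochastic.id : IsBistochastic (LinearMap.id : Matrix ι ι ℂ →ₗ[ℂ] Matrix ι ι ℂ) :=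
  ⟨fun h => h, rfl, fun _ => rfl⟩

lemma IsBistochastic.comp {Φ Ψ : Matrix ι ι ℂ →ₗ[ℂ] Matrix ι ι ℂ} (hΦ : IsBistochastic Φ)
    (hΨ : IsBistochastic Ψ) : IsBistochastic (Φ ∘ₗ Ψ) :=
  ⟨fun h => hΦ.posSemidef (hΨ.posSemidef h), by simp [hΨ.map_one, hΦ.map_one],
    fun A => by simp [hΨ.trace_map, hΦ.trace_map]⟩

/-- The transition matrix of `Φ` from the orthonormal basis of columns of `V` to that of `U`. -/
def transitionMatrix (Φ : Matrix ι ι ℂ →ₗ[ℂ] Matrix ι ι ℂ) (U V : Matrix ι ι ℂ) (i j : ι) : ℝ :=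
  ((Uᴴ * Φ (V * diagonal (Pi.single j 1) * Vᴴ) * U) i i).re

lemma sum_transitionMatrix_mul (Φ : Matrix ι ι ℂ →ₗ[ℂ] Matrix ι ι ℂ) (U V : Matrix ι ι ℂ)
    (a : ι → ℝ) (i : ι) :
    ((Uᴴ * Φ (V * (diagonal fun j => (a j : ℂ)) * Vᴴ) * U) i i).re =
      ∑ j, transitionMatrix Φ U V i j * a j := by
  have : (diagonal fun j => (a j : ℂ)) =
      ∑ j, (a j : ℂ) • (diagonal (Pi.single j 1) : Matrix ι ι ℂ) := by
    ext k l
    rw [Matrix.sum_apply]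
    by_cases h : k = l
    · subst h
      simp [Pi.single_apply]
    · simp [diagonal_apply_ne _ h]
  simp only [this, Matrix.mul_sum, Matrix.sum_mul, Matrix.mul_smul, Matrix.smul_mul, map_sum,
    map_smul, Matrix.sum_apply, Matrix.smul_apply, Complex.re_sum, smul_eq_mul,
    Complex.re_ofReal_mul, transitionMatrix]
  exact Finset.sum_congr rfl fun j _ => mul_comm _ _

lemma transitionMatrix_nonneg {Φ : Matrix ι ι ℂ →ₗ[ℂ] Matrix ι ι ℂ} (hΦ : IsBistochastic Φ)
    (U V : Matrix ι ι ℂ) (i j : ι) : 0 ≤ transitionMatrix Φ U V i j := by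
  have h : (diagonal (Pi.single j 1) : Matrix ι ι ℂ).PosSemidef :=
    PosSemidef.diagonal fun k => by
      by_cases hk : k = j
      · subst hk; simp
      · simp [hk]
  exact (Complex.le_def.1 ((hΦ.posSemidef (h.mul_mul_conjTranspose_same V)).conjTranspose_mul_mul_same
    U |>.diag_nonneg (i := i))).1

lemma sum_transitionMatrix {Φ : Matrix ι ι ℂ →ₗ[ℂ] Matrix ι ι ℂ} (hΦ : IsBistochastic Φ)
    {U V : Matrix ι ι ℂ} (hU : Uᴴ * U = 1) (hV : Vᴴ * V = 1) (i : ι) :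
    ∑ j, transitionMatrix Φ U V i j = 1 := by
  have := sum_transitionMatrix_mul Φ U V (fun _ => 1) i
  simp only [mul_one, Complex.ofReal_one, diagonal_one, mul_eq_one_comm.1 hV, hΦ.map_one, hU,
    one_apply_eq, Complex.one_re] at this
  exact this.symm

lemma sum_transitionMatrix_left {Φ : Matrix ι ι ℂ →ₗ[ℂ] Matrix ι ι ℂ} (hΦ : IsBistochastic Φ)
    {U V : Matrix ι ι ℂ} (hU : Uᴴ * U = 1) (hV : Vᴴ * V = 1) (j : ι) :
    ∑ i, transitionMatrix Φ U V i j = 1 := by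
  have h : (Uᴴ * Φ (V * diagonal (Pi.single j 1) * Vᴴ) * U).trace = 1 := by
    rw [trace_mul_comm, ← Matrix.mul_assoc, mul_eq_one_comm.1 hU, Matrix.one_mul, hΦ.trace_map,
      trace_mul_comm, ← Matrix.mul_assoc, hV, Matrix.one_mul, trace_diagonal]
    simp
  simpa [trace, transitionMatrix] using congrArg Complex.re h

lemma sum_apply_conj_map_le_specSum {Φ : Matrix ι ι ℂ →ₗ[ℂ] Matrix ι ι ℂ} (hΦ : IsBistochastic Φ)
    {U A : Matrix ι ι ℂ} (hU : Uᴴ * U = 1) (hA : A.PosSemidef) {φ : ℝ → ℝ}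
    (hφ : ConvexOn ℝ (Set.Ici 0) φ) :
    ∑ i, φ ((Uᴴ * Φ A * U) i i).re ≤ specSum φ A := by
  obtain ⟨V, a, hV, ha, rfl⟩ := hA.exists_eq_conj_diagonal
  rw [specSum_conj_diagonal _ hV]
  calc ∑ i, φ ((Uᴴ * Φ (V * (diagonal fun i => (a i : ℂ)) * Vᴴ) * U) i i).re
      ≤ ∑ i, ∑ j, transitionMatrix Φ U V i j * φ (a j) := by
        refine Finset.sum_le_sum fun i _ => ?_
        rw [sum_transitionMatrix_mul]
        exact hφ.map_sum_le (fun j _ => transitionMatrix_nonneg hΦ U V i j)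
          (sum_transitionMatrix hΦ hU hV i) fun j _ => ha j
    _ = ∑ j, φ (a j) := by
        rw [Finset.sum_comm]
        refine Finset.sum_congr rfl fun j _ => ?_
        rw [← Finset.sum_mul, sum_transitionMatrix_left hΦ hU hV, one_mul]

lemma specSum_map_le {Φ : Matrix ι ι ℂ →ₗ[ℂ] Matrix ι ι ℂ} (hΦ : IsBistochastic Φ)
    {A : Matrix ι ι ℂ} (hA : A.PosSemidef) {φ : ℝ → ℝ} (hφ : ConvexOn ℝ (Set.Ici 0) φ) :
    specSum φ (Φ A) ≤ specSum φ A := by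
  obtain ⟨U, d, hU, -, h⟩ := (hΦ.posSemidef hA).isHermitian.exists_eq_conj_diagonal
  refine le_trans (le_of_eq ?_) (sum_apply_conj_map_le_specSum hΦ hU hA hφ)
  rw [h, specSum_conj_diagonal _ hU]
  have : Uᴴ * (U * (diagonal fun i => (d i : ℂ)) * Uᴴ) * U = diagonal fun i => (d i : ℂ) := by
    calc _ = (Uᴴ * U) * (diagonal fun i => (d i : ℂ)) * (Uᴴ * U) := by
          simp only [Matrix.mul_assoc]
      _ = _ := by rw [hU, Matrix.one_mul, Matrix.mul_one]
  simp [this]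

end Spectrum

section KeyInequality

variable {ι : Type*} [Fintype ι] [DecidableEq ι]

lemma Matrix.PosSemidef.exists_specSum_eq_sum {A : Matrix ι ι ℂ} (hA : A.PosSemidef) :
    ∃ d : ι → ℝ, (∀ i, 0 ≤ d i) ∧ ∀ φ, specSum φ A = ∑ i, φ (d i) := by
  obtain ⟨V, d, hV, hd, rfl⟩ := hA.exists_eq_conj_diagonal
  exact ⟨d, hd, fun φ => specSum_conj_diagonal φ hV d⟩

lemma specSum_sq {A : Matrix ι ι ℂ} (hA : A.IsHermitian) :
    specSum (fun x => x ^ 2) A = (A * A).trace.re := by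
  rw [← specSum_mul_self (fun x => x) hA, specSum_id]
  rw [IsHermitian, conjTranspose_mul, hA.eq]

lemma specSum_log_add {A : Matrix ι ι ℂ} (hA : A.PosSemidef) {t : ℝ} (ht : 0 < t) :
    specSum (fun x => Real.log (x + t)) A = Real.log (A + (t : ℂ) • 1).det.re := by
  rw [← specSum_add_smul_one Real.log hA.isHermitian]
  have hpd : (A + (t : ℂ) • 1).PosDef :=
    PosDef.posSemidef_add hA (PosDef.one.smul (Complex.zero_lt_real.2 ht))
  obtain ⟨V, d, hV, hd, h⟩ := hpd.isHermitian.exists_eq_conj_diagonal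
  have hpos : ∀ i, 0 < d i := fun i => by rw [hd]; exact hpd.eigenvalues_pos i
  have hdet : (A + (t : ℂ) • 1).det = ((∏ i, d i : ℝ) : ℂ) := by
    rw [h, det_mul_comm, ← Matrix.mul_assoc, hV, Matrix.one_mul, det_diagonal]
    push_cast
    rfl
  rw [hdet, Complex.ofReal_re, Real.log_prod fun i _ => (hpos i).ne', h,
    specSum_conj_diagonal _ hV]

lemma specSum_mulLog_sq_add_sub_diagonal_le {A : Matrix ι ι ℂ} {y : ι → ℝ}
    (hp : (A + diagonal fun i => (y i : ℂ)).PosSemidef)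
    (hm : (A - diagonal fun i => (y i : ℂ)).PosSemidef) (hA : A.PosSemidef) :
    specSum (fun x => mulLog (x ^ 2)) (A + diagonal fun i => (y i : ℂ)) +
      specSum (fun x => mulLog (x ^ 2)) (A - diagonal fun i => (y i : ℂ)) +
      2 * ∑ i, mulLog ((A i i).re ^ 2) ≤
    2 * specSum (fun x => mulLog (x ^ 2)) A +
      ∑ i, (mulLog (((A i i).re + y i) ^ 2) + mulLog (((A i i).re - y i) ^ 2)) := by
  set D := diagonal fun i => (y i : ℂ) with hD
  obtain ⟨u, hu, eu⟩ := hp.exists_specSum_eq_sum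
  obtain ⟨v, hv, ev⟩ := hm.exists_specSum_eq_sum
  obtain ⟨w, hw, ew⟩ := hA.exists_specSum_eq_sum
  have dp : ∀ i, 0 ≤ (A i i).re + y i := fun i => by
    simpa [hD] using (Complex.le_def.1 (hp.diag_nonneg (i := i))).1
  have dm : ∀ i, 0 ≤ (A i i).re - y i := fun i => by
    have := (Complex.le_def.1 (hm.diag_nonneg (i := i))).1
    rwa [hD, Matrix.sub_apply, diagonal_apply_eq, Complex.sub_re, Complex.ofReal_re] at this
  have da : ∀ i, 0 ≤ (A i i).re := fun i => (Complex.le_def.1 (hA.diag_nonneg (i := i))).1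
  let c : Fin 6 × ι → ℝ := fun k => (![1, 1, -2, -1, -1, 2] : Fin 6 → ℝ) k.1
  let x : Fin 6 × ι → ℝ := fun k => (![u k.2, v k.2, w k.2, (A k.2 k.2).re + y k.2,
    (A k.2 k.2).re - y k.2, (A k.2 k.2).re] : Fin 6 → ℝ) k.1
  have hsum : ∀ g : ℝ → ℝ, ∑ k, c k * g (x k) = specSum g (A + D) + specSum g (A - D) -
      2 * specSum g A - ∑ i, g ((A i i).re + y i) - ∑ i, g ((A i i).re - y i) +
      2 * ∑ i, g (A i i).re := by
    intro g
    rw [Fintype.sum_prod_type, Fin.sum_univ_six, eu, ev, ew]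
    simp [c, x, ← Finset.mul_sum]
    ring
  have key := sum_mul_sq_mul_log_nonpos Finset.univ c x ?_ ?_ ?_ ?_ ?_
  · have h := hsum fun x => mulLog (x ^ 2)
    have e : ∀ r : ℝ, mulLog (r ^ 2) = 2 * (r ^ 2 * Real.log r) := fun r => by
      rw [mulLog, Real.log_pow]; push_cast; ring
    have h' : ∑ k, c k * mulLog (x k ^ 2) = 2 * ∑ k, c k * (x k ^ 2 * Real.log (x k)) := by
      rw [Finset.mul_sum]
      exact Finset.sum_congr rfl fun k _ => by rw [e]; ring
    rw [Finset.sum_add_distrib]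
    linarith
  · rintro ⟨k, i⟩ -
    fin_cases k
    exacts [hu i, hv i, hw i, dp i, dm i, da i]
  · have h := hsum fun _ => 1
    simp only [mul_one] at h
    rw [h, eu, ev, ew]
    ring
  · have h := hsum fun x => x
    rw [h, specSum_id hp.isHermitian, specSum_id hm.isHermitian, specSum_id hA.isHermitian,
      trace_add, trace_sub, Complex.add_re, Complex.sub_re, Finset.sum_add_distrib,
      Finset.sum_sub_distrib]
    have : A.trace.re = ∑ i, (A i i).re := by simp [trace]
    rw [this]
    ring
  · have h := hsum fun x => x ^ 2
    rw [h, specSum_sq hp.isHermitian, specSum_sq hm.isHermitian, specSum_sq hA.isHermitian]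
    have e1 : ((A + D) * (A + D)).trace.re + ((A - D) * (A - D)).trace.re =
        2 * (A * A).trace.re + 2 * (D * D).trace.re := by
      rw [← Complex.add_re, ← trace_add]
      have : (A + D) * (A + D) + (A - D) * (A - D) = (A * A + A * A) + (D * D + D * D) := by
        noncomm_ring
      rw [this]
      simp only [trace_add, Complex.add_re]
      ring
    have e2 : (D * D).trace.re = ∑ i, y i ^ 2 := by
      rw [hD, diagonal_mul_diagonal, trace_diagonal]
      simp [sq]
    have e3 : ∑ i, ((A i i).re + y i) ^ 2 + ∑ i, ((A i i).re - y i) ^ 2 =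
        2 * ∑ i, (A i i).re ^ 2 + 2 * ∑ i, y i ^ 2 := by
      simp only [Finset.mul_sum, ← Finset.sum_add_distrib]
      exact Finset.sum_congr rfl fun i _ => by ring
    linarith
  · intro t ht
    have h := hsum fun x => Real.log (x + t)
    rw [h, specSum_log_add hp ht, specSum_log_add hm ht, specSum_log_add hA ht]
    have pd : ∀ {X : Matrix ι ι ℂ}, X.PosSemidef → (X + (t : ℂ) • 1).PosDef := fun hX =>
      PosDef.posSemidef_add hX (PosDef.one.smul (Complex.zero_lt_real.2 ht))
    have e1 : A + D + (t : ℂ) • 1 = (A + (t : ℂ) • 1) + D := by abel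
    have e2 : A - D + (t : ℂ) • 1 = (A + (t : ℂ) • 1) - D := by abel
    have q1 := pd hp
    have q2 := pd hm
    have q0 := pd hA
    rw [e1] at q1 ⊢
    rw [e2] at q2 ⊢
    have main := det_mul_det_mul_prod_le (A + (t : ℂ) • 1) y q1 q2
    have r1 := (Complex.lt_def.1 q1.det_pos).1
    have r2 := (Complex.lt_def.1 q2.det_pos).1
    have r0 := (Complex.lt_def.1 q0.det_pos).1
    have ew : ∀ i, ((A + (t : ℂ) • (1 : Matrix ι ι ℂ)) i i).re = (A i i).re + t := fun i => by
      simp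
    simp only [ew] at main
    have s1 : ∀ i, 0 < (A i i).re + y i + t := fun i => by linarith [dp i]
    have s2 : ∀ i, 0 < (A i i).re - y i + t := fun i => by linarith [dm i]
    have s0 : ∀ i, 0 < (A i i).re + t := fun i => by linarith [da i]
    have f : ∀ i, ((A i i).re + t) ^ 2 - y i ^ 2 =
        ((A i i).re + y i + t) * ((A i i).re - y i + t) := fun i => by ring
    simp only [f, Finset.prod_mul_distrib, Finset.prod_pow] at main
    have P1 : 0 < ∏ i, ((A i i).re + y i + t) := Finset.prod_pos fun i _ => s1 i
    have P2 : 0 < ∏ i, ((A i i).re - y i + t) := Finset.prod_pos fun i _ => s2 i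
    have P0 : 0 < ∏ i, ((A i i).re + t) := Finset.prod_pos fun i _ => s0 i
    simp only [Complex.zero_re] at r1 r2 r0
    have := Real.log_le_log (by positivity) main
    rw [Real.log_mul (mul_pos r1 r2).ne' (by positivity), Real.log_mul r1.ne' r2.ne',
      Real.log_mul (by positivity) (mul_pos P1 P2).ne', Real.log_mul P1.ne' P2.ne', Real.log_pow,
      Real.log_pow, Real.log_prod fun i _ => (s1 i).ne', Real.log_prod fun i _ => (s2 i).ne',
      Real.log_prod fun i _ => (s0 i).ne'] at this
    push_cast at this
    linarith

theorem specSum_mulLog_sq_add_sub_le {A B : Matrix ι ι ℂ} (hB : B.IsHermitian)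
    (hp : (A + B).PosSemidef) (hm : (A - B).PosSemidef) :
    (specSum (fun x => mulLog (x ^ 2)) (A + B) + specSum (fun x => mulLog (x ^ 2)) (A - B)) / 2 ≤
      specSum (fun x => mulLog (x ^ 2)) A + specSum (fun x => mulLog (x ^ 2)) B +
      2 * (B * B).trace.re + (mulLog ((A * A).trace.re + (B * B).trace.re) -
        mulLog (A * A).trace.re - mulLog (B * B).trace.re) := by
  have hA : A.PosSemidef := by
    have := (hp.add hm).smul (show (0 : ℝ) ≤ 1 / 2 by norm_num)
    rwa [add_add_sub_cancel, ← two_smul ℝ A, smul_smul, one_div_mul_cancel two_ne_zero,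
      one_smul] at this
  obtain ⟨V, y, hV, -, rfl⟩ := hB.exists_eq_conj_diagonal
  set D := diagonal fun i => (y i : ℂ) with hD
  have hV' := mul_eq_one_comm.1 hV
  obtain ⟨A', rfl⟩ : ∃ A', A = V * A' * Vᴴ := ⟨Vᴴ * A * V, by
    calc A = (V * Vᴴ) * A * (V * Vᴴ) := by rw [hV', Matrix.one_mul, Matrix.mul_one]
      _ = _ := by simp only [Matrix.mul_assoc]⟩
  have undo : ∀ X : Matrix ι ι ℂ, Vᴴ * (V * X * Vᴴ) * V = X := fun X => by
    calc _ = (Vᴴ * V) * X * (Vᴴ * V) := by simp only [Matrix.mul_assoc]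
      _ = X := by rw [hV, Matrix.one_mul, Matrix.mul_one]
  have sq : ∀ X : Matrix ι ι ℂ, (V * X * Vᴴ * (V * X * Vᴴ)).trace = (X * X).trace := fun X => by
    calc _ = (V * X * (Vᴴ * V) * X * Vᴴ).trace := by simp only [Matrix.mul_assoc]
      _ = (Vᴴ * (V * X * X)).trace := by rw [hV, Matrix.mul_one, trace_mul_comm]
      _ = (Vᴴ * V * (X * X)).trace := by simp only [Matrix.mul_assoc]
      _ = _ := by rw [hV, Matrix.one_mul]
  have psd : ∀ {X : Matrix ι ι ℂ}, (V * X * Vᴴ).PosSemidef → X.PosSemidef := fun {X} h => by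
    have := h.conjTranspose_mul_mul_same V
    rwa [undo] at this
  rw [← Matrix.add_mul, ← Matrix.mul_add] at hp ⊢
  rw [← Matrix.sub_mul, ← Matrix.mul_sub] at hm ⊢
  rw [specSum_conj _ hV, specSum_conj _ hV, specSum_conj _ hV, sq, sq, specSum_conj _ hV]
  replace hp := psd hp
  replace hm := psd hm
  replace hA := psd hA
  have main := specSum_mulLog_sq_add_sub_diagonal_le hp hm hA
  have dp : ∀ i, 0 ≤ (A' i i).re + y i := fun i => by
    simpa [hD] using (Complex.le_def.1 (hp.diag_nonneg (i := i))).1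
  have dm : ∀ i, 0 ≤ (A' i i).re - y i := fun i => by
    have := (Complex.le_def.1 (hm.diag_nonneg (i := i))).1
    rwa [hD, Matrix.sub_apply, diagonal_apply_eq, Complex.sub_re, Complex.ofReal_re] at this
  have h2 : ∑ i, (mulLog (((A' i i).re + y i) ^ 2) + mulLog (((A' i i).re - y i) ^ 2)) ≤
      ∑ i, 2 * (mulLog ((A' i i).re ^ 2 + y i ^ 2) + 2 * y i ^ 2) :=
    Finset.sum_le_sum fun i _ => by
      have := two_point_logSobolev (abs_le.2 ⟨by linarith [dp i], by linarith [dm i]⟩ :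
        |y i| ≤ (A' i i).re)
      linarith
  have h3 := sum_mulLog_add_sub_le (fun i => sq_nonneg (A' i i).re) (fun i => sq_nonneg (y i))
  have tD : (D * D).trace.re = ∑ i, y i ^ 2 := by
    rw [hD, diagonal_mul_diagonal, trace_diagonal]
    simp [_root_.sq]
  have le : ∑ i, (A' i i).re ^ 2 ≤ (A' * A').trace.re := by
    rw [← specSum_sq hA.isHermitian]
    have := sum_apply_conj_map_le_specSum IsBistochastic.id (U := 1) (by simp) hA
      ((even_two.convexOn_pow (𝕜 := ℝ)).subset (Set.subset_univ _) (convex_Ici 0))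
    simpa using this
  have h4 := mulLog_add_sub_le_mulLog_add_sub (Finset.sum_nonneg fun i _ => sq_nonneg (A' i i).re)
    le (Finset.sum_nonneg fun i (_ : i ∈ Finset.univ) => sq_nonneg (y i))
  rw [hD, specSum_diagonal, ← hD, tD]
  simp only [Finset.sum_add_distrib, Finset.sum_sub_distrib, ← Finset.mul_sum] at *
  linarith

end KeyInequality

section Polar

open scoped MatrixOrder Matrix.Norms.L2Operator

variable {ι : Type*} [Fintype ι] [DecidableEq ι]

lemma Matrix.PosSemidef.eq_of_mul_self_eq {A B : Matrix ι ι ℂ} (hA : A.PosSemidef)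
    (hB : B.PosSemidef) (h : A * A = B * B) : A = B := by
  rw [← CFC.sqrt_mul_self A hA.nonneg, h, CFC.sqrt_mul_self B hB.nonneg]

lemma Matrix.PosSemidef.exists_mul_self_eq {A : Matrix ι ι ℂ} (hA : A.PosSemidef) :
    ∃ S : Matrix ι ι ℂ, S.PosSemidef ∧ S * S = A :=
  ⟨CFC.sqrt A, nonneg_iff_posSemidef.1 (CFC.sqrt_nonneg A), CFC.sqrt_mul_sqrt_self A hA.nonneg⟩

end Polar

section Kraus

variable {ι κ : Type*} [Fintype ι] [DecidableEq ι] [Fintype κ] [DecidableEq κ]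

lemma Matrix.PosSemidef.trace_mul_re_nonneg {A B : Matrix ι ι ℂ} (hA : A.PosSemidef)
    (hB : B.PosSemidef) : 0 ≤ (A * B).trace.re := by
  obtain ⟨S, hS, rfl⟩ := hB.exists_mul_self_eq
  have := (hA.conjTranspose_mul_mul_same S).trace_nonneg
  rw [hS.isHermitian.eq, trace_mul_comm, ← Matrix.mul_assoc, trace_mul_comm] at this
  exact (Complex.le_def.1 this).1

lemma Matrix.PosSemidef.fromBlocks_zero {A : Matrix ι ι ℂ} {B : Matrix κ κ ℂ}
    (hA : A.PosSemidef) (hB : B.PosSemidef) : (fromBlocks A 0 0 B).PosSemidef := by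
  obtain ⟨S, hS, rfl⟩ := hA.exists_mul_self_eq
  obtain ⟨T, hT, rfl⟩ := hB.exists_mul_self_eq
  have := posSemidef_conjTranspose_mul_self (fromBlocks S 0 0 T)
  rw [fromBlocks_conjTranspose, fromBlocks_multiply, hS.isHermitian.eq, hT.isHermitian.eq] at this
  simpa using this

lemma Matrix.PosSemidef.fromBlocks_neg {P Q f g : Matrix ι ι ℂ}
    (h : (fromBlocks P f g Q).PosSemidef) : (fromBlocks P (-f) (-g) Q).PosSemidef := by
  have := h.mul_mul_conjTranspose_same (fromBlocks (1 : Matrix ι ι ℂ) 0 0 (-1 : Matrix ι ι ℂ))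
  simpa [fromBlocks_conjTranspose, fromBlocks_multiply] using this

/-- The polar decomposition of `f`, as a positive semidefinite block matrix. -/
lemma exists_posSemidef_fromBlocks (f : Matrix ι ι ℂ) : ∃ P Q : Matrix ι ι ℂ,
    P.PosSemidef ∧ Q.PosSemidef ∧ P * P = f * fᴴ ∧ Q * Q = fᴴ * f ∧
      (fromBlocks P f fᴴ Q).PosSemidef := by
  obtain ⟨P, hP, eP⟩ := (posSemidef_self_mul_conjTranspose f).exists_mul_self_eq
  obtain ⟨Q, hQ, eQ⟩ := (posSemidef_conjTranspose_mul_self f).exists_mul_self_eq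
  refine ⟨P, Q, hP, hQ, eP, eQ, ?_⟩
  have hH : (fromBlocks 0 f fᴴ 0).IsHermitian := by
    rw [IsHermitian, fromBlocks_conjTranspose]
    simp
  obtain ⟨V, d, hV, -, e⟩ := hH.exists_eq_conj_diagonal
  have h1 : (V * (diagonal fun i => ((|d i| : ℝ) : ℂ)) * Vᴴ).PosSemidef :=
    posSemidef_conj_diagonal V fun i => abs_nonneg _
  have h2 : V * (diagonal fun i => ((|d i| : ℝ) : ℂ)) * Vᴴ = fromBlocks P 0 0 Q := by
    refine h1.eq_of_mul_self_eq (hP.fromBlocks_zero hQ) ?_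
    have h3 : fromBlocks P 0 0 Q * fromBlocks P 0 0 Q =
        fromBlocks 0 f fᴴ 0 * fromBlocks 0 f fᴴ 0 := by
      simp [fromBlocks_multiply, eP, eQ]
    rw [h3, e, conj_diagonal_mul hV, conj_diagonal_mul hV]
    congr 3
    ext i
    rw [← Complex.ofReal_mul, abs_mul_abs_self, Complex.ofReal_mul]
  have h4 : fromBlocks P f fᴴ Q = V * (diagonal fun i => ((|d i| + d i : ℝ) : ℂ)) * Vᴴ := by
    have : (diagonal fun i => ((|d i| + d i : ℝ) : ℂ)) =
        (diagonal fun i => ((|d i| : ℝ) : ℂ)) + diagonal fun i => (d i : ℂ) := by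
      rw [diagonal_add]
      simp
    rw [this, Matrix.mul_add, Matrix.add_mul, h2, ← e, fromBlocks_add]
    simp
  rw [h4]
  exact posSemidef_conj_diagonal V fun i => by linarith [neg_abs_le (d i)]

omit [DecidableEq ι] [DecidableEq κ] in
lemma Matrix.trace_fromBlocks' (A : Matrix ι ι ℂ) (B : Matrix ι κ ℂ) (C : Matrix κ ι ℂ)
    (D : Matrix κ κ ℂ) : (fromBlocks A B C D).trace = A.trace + D.trace := by
  simp [trace]

/-- A linear map on matrices given by a finite Kraus decomposition. -/
def HasKraus (Φ : Matrix ι ι ℂ →ₗ[ℂ] Matrix ι ι ℂ) : Prop :=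
  ∃ (σ : Type) (_ : Fintype σ) (K : σ → Matrix ι ι ℂ), ∀ A, Φ A = ∑ s, K s * A * (K s)ᴴ

omit [DecidableEq ι] in
lemma HasKraus.posSemidef {Φ : Matrix ι ι ℂ →ₗ[ℂ] Matrix ι ι ℂ} (hΦ : HasKraus Φ)
    {A : Matrix ι ι ℂ} (hA : A.PosSemidef) : (Φ A).PosSemidef := by
  obtain ⟨σ, _, K, h⟩ := hΦ
  rw [h]
  exact posSemidef_sum _ fun s _ => hA.mul_mul_conjTranspose_same (K s)

omit [DecidableEq ι] in
lemma HasKraus.map_conjTranspose {Φ : Matrix ι ι ℂ →ₗ[ℂ] Matrix ι ι ℂ} (hΦ : HasKraus Φ)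
    (A : Matrix ι ι ℂ) : Φ Aᴴ = (Φ A)ᴴ := by
  obtain ⟨σ, _, K, h⟩ := hΦ
  rw [h, h, conjTranspose_sum]
  simp [conjTranspose_mul, Matrix.mul_assoc]

lemma HasKraus.id : HasKraus (LinearMap.id : Matrix ι ι ℂ →ₗ[ℂ] Matrix ι ι ℂ) :=
  ⟨Unit, inferInstance, fun _ => 1, fun A => by simp⟩

omit [DecidableEq ι] in
lemma HasKraus.comp {Φ Ψ : Matrix ι ι ℂ →ₗ[ℂ] Matrix ι ι ℂ} (hΦ : HasKraus Φ)
    (hΨ : HasKraus Ψ) : HasKraus (Φ ∘ₗ Ψ) := by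
  obtain ⟨σ, _, K, h⟩ := hΦ
  obtain ⟨τ, _, L, h'⟩ := hΨ
  refine ⟨σ × τ, inferInstance, fun s => K s.1 * L s.2, fun A => ?_⟩
  rw [LinearMap.comp_apply, h, h', Fintype.sum_prod_type]
  refine Finset.sum_congr rfl fun s _ => ?_
  rw [Matrix.mul_sum, Matrix.sum_mul]
  simp [conjTranspose_mul, Matrix.mul_assoc]

lemma HasKraus.fromBlocks {Φ : Matrix ι ι ℂ →ₗ[ℂ] Matrix ι ι ℂ} (hΦ : HasKraus Φ)
    {P Q f : Matrix ι ι ℂ} (h : (fromBlocks P f fᴴ Q).PosSemidef) :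
    (fromBlocks (Φ P) (Φ f) (Φ f)ᴴ (Φ Q)).PosSemidef := by
  rw [← hΦ.map_conjTranspose]
  obtain ⟨σ, _, K, hK⟩ := hΦ
  have : Matrix.fromBlocks (Φ P) (Φ f) (Φ fᴴ) (Φ Q) =
      ∑ s, Matrix.fromBlocks (K s) 0 0 (K s) * Matrix.fromBlocks P f fᴴ Q *
        (Matrix.fromBlocks (K s) 0 0 (K s))ᴴ := by
    simp only [hK, fromBlocks_conjTranspose, fromBlocks_multiply]
    ext (i | i) (j | j) <;> simp [Matrix.sum_apply]
  rw [this]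
  exact posSemidef_sum _ fun s _ => h.mul_mul_conjTranspose_same _

lemma HasKraus.two_mul_re_trace_le {Φ : Matrix ι ι ℂ →ₗ[ℂ] Matrix ι ι ℂ} (hΦ : HasKraus Φ)
    {P Q f : Matrix ι ι ℂ} (h : (Matrix.fromBlocks P f fᴴ Q).PosSemidef) :
    2 * (fᴴ * Φ f).trace.re ≤ (P * Φ P).trace.re + (Q * Φ Q).trace.re := by
  have h1 := h.trace_mul_re_nonneg (hΦ.fromBlocks h).fromBlocks_neg
  rw [fromBlocks_multiply, trace_fromBlocks'] at h1
  have h2 : (f * (Φ f)ᴴ).trace.re = (fᴴ * Φ f).trace.re := by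
    rw [← Complex.conj_re, ← Complex.star_def, ← trace_conjTranspose, conjTranspose_mul,
      conjTranspose_conjTranspose, trace_mul_comm]
  simp only [Matrix.mul_neg, trace_add, trace_neg, Complex.add_re, Complex.neg_re] at h1
  linarith

end Kraus

section HasKrausOps

variable {ι : Type*} [Fintype ι]

lemma HasKraus.add {Φ Ψ : Matrix ι ι ℂ →ₗ[ℂ] Matrix ι ι ℂ} (hΦ : HasKraus Φ)
    (hΨ : HasKraus Ψ) : HasKraus (Φ + Ψ) := by
  obtain ⟨σ, _, K, h⟩ := hΦ
  obtain ⟨τ, _, L, h'⟩ := hΨ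
  exact ⟨σ ⊕ τ, inferInstance, Sum.elim K L, fun A => by simp [h, h']⟩

lemma HasKraus.smul {Φ : Matrix ι ι ℂ →ₗ[ℂ] Matrix ι ι ℂ} (hΦ : HasKraus Φ) {c : ℝ}
    (hc : 0 ≤ c) : HasKraus ((c : ℂ) • Φ) := by
  obtain ⟨σ, _, K, h⟩ := hΦ
  refine ⟨σ, inferInstance, fun s => ((Real.sqrt c : ℝ) : ℂ) • K s, fun A => ?_⟩
  simp [h, Finset.smul_sum, smul_smul, Real.mul_self_sqrt hc]

end HasKrausOps

section Depolarizing

variable {n : ℕ}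

/-- `depolAt` as a linear map. -/
noncomputable def depolLin (γ : ℝ) (k : Fin n) :
    Matrix (Fin n → Fin 2) (Fin n → Fin 2) ℂ →ₗ[ℂ] Matrix (Fin n → Fin 2) (Fin n → Fin 2) ℂ where
  toFun := depolAt γ k
  map_add' f g := by
    ext x y
    simp only [depolAt, of_apply, Matrix.add_apply, Finset.sum_add_distrib]
    split_ifs <;> ring
  map_smul' c f := by
    ext x y
    simp only [depolAt, of_apply, Matrix.smul_apply, smul_eq_mul, RingHom.id_apply,
      ← Finset.mul_sum]
    split_ifs <;> ring

lemma depolLin_apply (γ : ℝ) (k : Fin n) (f : Matrix (Fin n → Fin 2) (Fin n → Fin 2) ℂ) :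
    depolLin γ k f = depolAt γ k f := rfl

lemma depolLin_zero_apply (k : Fin n) (f : Matrix (Fin n → Fin 2) (Fin n → Fin 2) ℂ)
    (x y : Fin n → Fin 2) : depolLin 0 k f x y = if x k = y k then
      (1 / 2) * ∑ b : Fin 2, f (Function.update x k b) (Function.update y k b) else 0 := by
  simp [depolLin_apply, depolAt]

lemma depolLin_eq (γ : ℝ) (k : Fin n) :
    depolLin γ k = (γ : ℂ) • LinearMap.id + ((1 - γ : ℝ) : ℂ) • depolLin 0 k := by
  ext1 f
  ext x y
  simp [depolLin_apply, depolAt]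

/-- The Kraus operators of the completely depolarizing channel at the qubit `k`. -/
noncomputable def depolKraus (k : Fin n) (s : Fin 2 × Fin 2) :
    Matrix (Fin n → Fin 2) (Fin n → Fin 2) ℂ :=
  of fun x z => if z = Function.update x k s.2 then
    if x k = s.1 then (((Real.sqrt 2)⁻¹ : ℝ) : ℂ) else 0 else 0

lemma depolKraus_conjTranspose (k : Fin n) (s : Fin 2 × Fin 2) :
    (depolKraus k s)ᴴ = depolKraus k s.swap := by
  ext z x
  have : z = Function.update x k s.2 ∧ x k = s.1 ↔ x = Function.update z k s.1 ∧ z k = s.2 := by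
    constructor
    · rintro ⟨rfl, h⟩
      simp [← h]
    · rintro ⟨rfl, h⟩
      simp [← h]
  simp only [conjTranspose_apply, depolKraus, of_apply, Prod.fst_swap, Prod.snd_swap, ← ite_and,
    this]
  split_ifs <;> simp

lemma depolLin_zero_eq_sum (k : Fin n) (f : Matrix (Fin n → Fin 2) (Fin n → Fin 2) ℂ) :
    depolLin 0 k f = ∑ s, depolKraus k s * f * (depolKraus k s)ᴴ := by
  have key : ∀ s x y, (depolKraus k s * f * (depolKraus k s)ᴴ) x y =
      if x k = s.1 ∧ y k = s.1 then
        (1 / 2) * f (Function.update x k s.2) (Function.update y k s.2) else 0 := by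
    intro s x y
    simp only [Matrix.mul_apply, conjTranspose_apply, depolKraus, of_apply, ite_mul, zero_mul,
      Finset.sum_ite_eq', Finset.mem_univ, if_true, apply_ite star, star_zero, mul_ite, mul_zero,
      Complex.star_def, Complex.conj_ofReal]
    by_cases h1 : x k = s.1 <;> by_cases h2 : y k = s.1 <;> simp [h1, h2]
    rw [mul_right_comm, ← mul_inv, ← Complex.ofReal_mul, Real.mul_self_sqrt zero_le_two]
    simp
  ext x y
  rw [depolLin_zero_apply, Matrix.sum_apply]
  simp only [key, Fintype.sum_prod_type, Fin.sum_univ_two]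
  generalize x k = a
  generalize y k = b
  fin_cases a <;> fin_cases b <;> simp <;> ring

lemma hasKraus_depolLin_zero (k : Fin n) : HasKraus (depolLin 0 k) :=
  ⟨_, inferInstance, depolKraus k, depolLin_zero_eq_sum k⟩

lemma hasKraus_depolLin {γ : ℝ} (h0 : 0 ≤ γ) (h1 : γ ≤ 1) (k : Fin n) :
    HasKraus (depolLin γ k) := by
  rw [depolLin_eq]
  exact (HasKraus.id.smul h0).add ((hasKraus_depolLin_zero k).smul (sub_nonneg.2 h1))

lemma trace_mul_depolLin_zero (k : Fin n) (f g : Matrix (Fin n → Fin 2) (Fin n → Fin 2) ℂ) :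
    (f * depolLin 0 k g).trace = (depolLin 0 k f * g).trace := by
  rw [depolLin_zero_eq_sum, depolLin_zero_eq_sum, Matrix.mul_sum, Matrix.sum_mul, trace_sum,
    trace_sum, ← (Equiv.prodComm (Fin 2) (Fin 2)).sum_comp]
  refine Finset.sum_congr rfl fun s _ => ?_
  rw [Equiv.prodComm_apply, depolKraus_conjTranspose, depolKraus_conjTranspose, Prod.swap_swap]
  calc _ = (f * (depolKraus k s.swap * g) * depolKraus k s).trace := by
        simp only [Matrix.mul_assoc]
    _ = _ := by
        rw [trace_mul_comm]
        simp only [Matrix.mul_assoc]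

lemma depolLin_zero_one (k : Fin n) : depolLin 0 k 1 = 1 := by
  ext x y
  rw [depolLin_zero_apply]
  have : ∀ b, x k = y k → ((Function.update x k b = Function.update y k b) ↔ x = y) := by
    intro b h
    constructor
    · intro e
      ext j
      by_cases hj : j = k
      · subst hj; rw [h]
      · have := congrFun e j
        rw [Function.update_of_ne hj, Function.update_of_ne hj] at this
        rw [this]
    · rintro rfl; rfl
  split_ifs with h
  · simp only [one_apply, this _ h]
    split_ifs <;> simp
  · rw [one_apply_ne]
    rintro rfl
    exact h rfl

lemma depolLin_one (γ : ℝ) (k : Fin n) : depolLin γ k 1 = 1 := by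
  rw [depolLin_eq, LinearMap.add_apply, LinearMap.smul_apply, LinearMap.smul_apply,
    depolLin_zero_one, LinearMap.id_apply, ← add_smul]
  simp

lemma trace_depolLin_zero (k : Fin n) (f : Matrix (Fin n → Fin 2) (Fin n → Fin 2) ℂ) :
    (depolLin 0 k f).trace = f.trace := by
  simpa [depolLin_zero_one] using trace_mul_depolLin_zero k 1 f

lemma isBistochastic_depolLin {γ : ℝ} (h0 : 0 ≤ γ) (h1 : γ ≤ 1) (k : Fin n) :
    IsBistochastic (depolLin γ k) where
  posSemidef := (hasKraus_depolLin h0 h1 k).posSemidef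
  map_one := depolLin_one γ k
  trace_map f := by
    rw [depolLin_eq, LinearMap.add_apply, LinearMap.smul_apply, LinearMap.smul_apply, trace_add,
      trace_smul, trace_smul, trace_depolLin_zero, LinearMap.id_apply, ← add_smul]
    simp

lemma depolLin_zero_idem (k : Fin n) : depolLin 0 k ∘ₗ depolLin 0 k = depolLin 0 k := by
  ext1 f
  ext x y
  simp [depolLin_zero_apply]

lemma depolLin_zero_comm (j k : Fin n) :
    depolLin 0 j ∘ₗ depolLin 0 k = depolLin 0 k ∘ₗ depolLin 0 j := by
  by_cases h : j = k
  · rw [h]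
  · ext1 f
    ext x y
    simp only [LinearMap.comp_apply, depolLin_zero_apply, Function.update_of_ne h,
      Function.update_of_ne (Ne.symm h), Fin.sum_univ_two, Function.update_comm h]
    split_ifs <;> ring

lemma depolLin_comm (γ δ : ℝ) (j k : Fin n) :
    depolLin γ j ∘ₗ depolLin δ k = depolLin δ k ∘ₗ depolLin γ j := by
  rw [depolLin_eq γ, depolLin_eq δ]
  simp only [LinearMap.add_comp, LinearMap.comp_add, LinearMap.smul_comp, LinearMap.comp_smul,
    LinearMap.id_comp, LinearMap.comp_id, depolLin_zero_comm k j]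
  module

lemma depolLin_comp_depolLin (γ δ : ℝ) (k : Fin n) :
    depolLin γ k ∘ₗ depolLin δ k = depolLin (γ * δ) k := by
  rw [depolLin_eq γ, depolLin_eq δ, depolLin_eq (γ * δ)]
  simp only [LinearMap.add_comp, LinearMap.comp_add, LinearMap.smul_comp, LinearMap.comp_smul,
    LinearMap.id_comp, LinearMap.comp_id, depolLin_zero_idem]
  push_cast
  module

/-- The composition of `depolAt` over the qubits in a list, as a linear map. -/
noncomputable def depolList (γ : ℝ) : List (Fin n) →
    Matrix (Fin n → Fin 2) (Fin n → Fin 2) ℂ →ₗ[ℂ] Matrix (Fin n → Fin 2) (Fin n → Fin 2) ℂ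
  | [] => LinearMap.id
  | k :: l => depolList γ l ∘ₗ depolLin γ k

lemma depolList_apply (γ : ℝ) (l : List (Fin n))
    (f : Matrix (Fin n → Fin 2) (Fin n → Fin 2) ℂ) :
    depolList γ l f = l.foldl (fun g k => depolAt γ k g) f := by
  induction l generalizing f with
  | nil => rfl
  | cons k l ih => exact ih _

lemma depolChannel_eq (γ : ℝ) (f : Matrix (Fin n → Fin 2) (Fin n → Fin 2) ℂ) :
    depolChannel γ f = depolList γ (List.finRange n) f := (depolList_apply _ _ _).symm

lemma hasKraus_depolList {γ : ℝ} (h0 : 0 ≤ γ) (h1 : γ ≤ 1) (l : List (Fin n)) :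
    HasKraus (depolList γ l) := by
  induction l with
  | nil => exact HasKraus.id
  | cons k l ih => exact ih.comp (hasKraus_depolLin h0 h1 k)

lemma isBistochastic_depolList {γ : ℝ} (h0 : 0 ≤ γ) (h1 : γ ≤ 1) (l : List (Fin n)) :
    IsBistochastic (depolList γ l) := by
  induction l with
  | nil => exact IsBistochastic.id
  | cons k l ih => exact ih.comp (isBistochastic_depolLin h0 h1 k)

lemma depolLin_comp_depolList (γ δ : ℝ) (k : Fin n) (l : List (Fin n)) :
    depolLin γ k ∘ₗ depolList δ l = depolList δ l ∘ₗ depolLin γ k := by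
  induction l with
  | nil => rfl
  | cons j l ih =>
    rw [depolList, ← LinearMap.comp_assoc, ih, LinearMap.comp_assoc, LinearMap.comp_assoc,
      depolLin_comm]

lemma depolList_comp_depolList (γ δ : ℝ) (l : List (Fin n)) :
    depolList γ l ∘ₗ depolList δ l = depolList (γ * δ) l := by
  induction l with
  | nil => rfl
  | cons j l ih =>
    rw [depolList, depolList, depolList, ← ih, ← depolLin_comp_depolLin γ δ,
      LinearMap.comp_assoc, ← LinearMap.comp_assoc _ (depolList δ l), depolLin_comp_depolList]
    simp only [LinearMap.comp_assoc]

lemma depolList_one_left (l : List (Fin n)) : depolList 1 l = LinearMap.id := by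
  induction l with
  | nil => rfl
  | cons j l ih =>
    rw [depolList, ih, depolLin_eq]
    simp

lemma hasDerivAt_depolList (l : List (Fin n)) (f : Matrix (Fin n → Fin 2) (Fin n → Fin 2) ℂ)
    (φ : Matrix (Fin n → Fin 2) (Fin n → Fin 2) ℂ →ₗ[ℂ] ℂ) (t : ℝ) :
    HasDerivAt (fun t : ℝ => φ (depolList (Real.exp (-t)) l f))
      (-(l.map fun k => φ (depolList (Real.exp (-t)) l f) -
        φ (depolLin 0 k (depolList (Real.exp (-t)) l f))).sum) t := by
  induction l generalizing φ with
  | nil => simpa [depolList] using hasDerivAt_const t (φ f)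
  | cons k l ih =>
    have e : ∀ (t : ℝ) (φ : Matrix (Fin n → Fin 2) (Fin n → Fin 2) ℂ →ₗ[ℂ] ℂ),
        φ (depolList (Real.exp (-t)) (k :: l) f) =
          (Real.exp (-t) : ℂ) * φ (depolList (Real.exp (-t)) l f) +
          ((1 - Real.exp (-t) : ℝ) : ℂ) *
            (φ ∘ₗ depolLin 0 k) (depolList (Real.exp (-t)) l f) := fun t φ => by
      rw [depolList, ← depolLin_comp_depolList, depolLin_eq]
      simp
    have hexp : HasDerivAt (fun t : ℝ => ((Real.exp (-t) : ℝ) : ℂ))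
        (((-Real.exp (-t) : ℝ)) : ℂ) t := by
      have : HasDerivAt (fun t : ℝ => Real.exp (-t)) (-Real.exp (-t)) t := by
        simpa using (hasDerivAt_neg t).exp
      exact this.ofReal_comp
    have hexp' : HasDerivAt (fun t : ℝ => ((1 - Real.exp (-t) : ℝ) : ℂ))
        (((Real.exp (-t) : ℝ)) : ℂ) t := by
      have := hexp.const_sub 1
      simpa using this
    have h := (hexp.mul (ih φ)).add (hexp'.mul (ih (φ ∘ₗ depolLin 0 k)))
    have idem : ∀ g, depolLin 0 k (depolLin 0 k g) = depolLin 0 k g := fun g =>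
      LinearMap.congr_fun (depolLin_zero_idem k) g
    have comm : ∀ j g, depolLin 0 k (depolLin 0 j g) = depolLin 0 j (depolLin 0 k g) :=
      fun j g => LinearMap.congr_fun (depolLin_zero_comm k j) g
    refine (h.congr_of_eventuallyEq (.of_forall fun t => e t φ)).congr_deriv ?_
    have e2 : ∀ j, φ (depolList (Real.exp (-t)) (k :: l) f) -
        φ (depolLin 0 j (depolList (Real.exp (-t)) (k :: l) f)) =
        (Real.exp (-t) : ℂ) * (φ (depolList (Real.exp (-t)) l f) -
          φ (depolLin 0 j (depolList (Real.exp (-t)) l f))) +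
        ((1 - Real.exp (-t) : ℝ) : ℂ) * ((φ ∘ₗ depolLin 0 k) (depolList (Real.exp (-t)) l f) -
          (φ ∘ₗ depolLin 0 k) (depolLin 0 j (depolList (Real.exp (-t)) l f))) := fun j => by
      have := e t (φ ∘ₗ depolLin 0 j)
      simp only [LinearMap.comp_apply] at this
      rw [this, e t φ]
      simp only [LinearMap.comp_apply, comm]
      ring
    rw [List.map_cons, List.sum_cons]
    simp only [e2, List.sum_map_add, List.sum_map_mul_left, LinearMap.comp_apply, idem]
    push_cast
    ring

end Depolarizing

section LogSobolev

variable {n : ℕ}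

/-- The Dirichlet form of the depolarizing semigroup on `n` qubits, for the unnormalized trace. -/
noncomputable def depolDirichlet (f : Matrix (Fin n → Fin 2) (Fin n → Fin 2) ℂ) : ℝ :=
  ∑ k, ((fᴴ * f).trace.re - (fᴴ * depolLin 0 k f).trace.re)

/-- The logarithmic Sobolev inequality for the depolarizing semigroup, at the matrix `f`. -/
def LogSobolevAt (f : Matrix (Fin n → Fin 2) (Fin n → Fin 2) ℂ) : Prop :=
  specSum mulLog (fᴴ * f) ≤ mulLog (fᴴ * f).trace.re - (fᴴ * f).trace.re * (n * Real.log 2) +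
    2 * depolDirichlet f

lemma depolDirichlet_add_le {P Q f : Matrix (Fin n → Fin 2) (Fin n → Fin 2) ℂ}
    (hP : P.PosSemidef) (hQ : Q.PosSemidef) (eP : P * P = f * fᴴ) (eQ : Q * Q = fᴴ * f)
    (h : (fromBlocks P f fᴴ Q).PosSemidef) :
    depolDirichlet P + depolDirichlet Q ≤ 2 * depolDirichlet f := by
  rw [depolDirichlet, depolDirichlet, depolDirichlet, ← Finset.sum_add_distrib, Finset.mul_sum]
  refine Finset.sum_le_sum fun k _ => ?_
  have := (hasKraus_depolLin_zero k).two_mul_re_trace_le h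
  rw [hP.isHermitian.eq, hQ.isHermitian.eq, eP, eQ, trace_mul_comm f]
  linarith

lemma logSobolevAt_of_posSemidef
    (h : ∀ M : Matrix (Fin n → Fin 2) (Fin n → Fin 2) ℂ, M.PosSemidef → LogSobolevAt M)
    (f : Matrix (Fin n → Fin 2) (Fin n → Fin 2) ℂ) : LogSobolevAt f := by
  obtain ⟨P, Q, hP, hQ, eP, eQ, hM⟩ := exists_posSemidef_fromBlocks f
  have h1 := h P hP
  have h2 := h Q hQ
  have h3 := depolDirichlet_add_le hP hQ eP eQ hM
  rw [LogSobolevAt, hP.isHermitian.eq, eP, specSum_mul_comm, trace_mul_comm] at h1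
  rw [LogSobolevAt, hQ.isHermitian.eq, eQ] at h2
  rw [LogSobolevAt]
  linarith

/-- Splitting off the first qubit. -/
def consEquiv (n : ℕ) : (Fin n → Fin 2) ⊕ (Fin n → Fin 2) ≃ (Fin (n + 1) → Fin 2) where
  toFun := Sum.elim (fun x => Fin.cons 0 x) fun x => Fin.cons 1 x
  invFun x := if x 0 = 0 then Sum.inl (Fin.tail x) else Sum.inr (Fin.tail x)
  left_inv := by rintro (x | x) <;> simp
  right_inv x := by
    by_cases h : x 0 = 0
    · simp only [h, if_true, Sum.elim_inl]
      rw [← h, Fin.cons_self_tail]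
    · simp only [h, if_false, Sum.elim_inr]
      rw [← Fin.eq_one_of_ne_zero _ h, Fin.cons_self_tail]

lemma consEquiv_inl (x : Fin n → Fin 2) : consEquiv n (Sum.inl x) = Fin.cons 0 x := rfl

lemma consEquiv_inr (x : Fin n → Fin 2) : consEquiv n (Sum.inr x) = Fin.cons 1 x := rfl

lemma depolLin_succ_submatrix (k : Fin n)
    {M : Matrix (Fin (n + 1) → Fin 2) (Fin (n + 1) → Fin 2) ℂ}
    {X Y Z W : Matrix (Fin n → Fin 2) (Fin n → Fin 2) ℂ}
    (h : M.submatrix (consEquiv n) (consEquiv n) = fromBlocks X Y Z W) :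
    (depolLin 0 k.succ M).submatrix (consEquiv n) (consEquiv n) =
      fromBlocks (depolLin 0 k X) (depolLin 0 k Y) (depolLin 0 k Z) (depolLin 0 k W) := by
  have h' : ∀ i j, M (consEquiv n i) (consEquiv n j) = fromBlocks X Y Z W i j := fun i j =>
    congrFun (congrFun h i) j
  ext (x | x) (y | y) <;>
  simp only [submatrix_apply, depolLin_zero_apply, consEquiv_inl, consEquiv_inr, Fin.cons_succ,
    ← Fin.cons_update, fromBlocks_apply₁₁, fromBlocks_apply₁₂, fromBlocks_apply₂₁,
    fromBlocks_apply₂₂] <;>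
  simp only [← consEquiv_inl, ← consEquiv_inr, h', fromBlocks_apply₁₁, fromBlocks_apply₁₂,
    fromBlocks_apply₂₁, fromBlocks_apply₂₂]

lemma depolLin_zero_submatrix {M : Matrix (Fin (n + 1) → Fin 2) (Fin (n + 1) → Fin 2) ℂ}
    {X Y Z W : Matrix (Fin n → Fin 2) (Fin n → Fin 2) ℂ}
    (h : M.submatrix (consEquiv n) (consEquiv n) = fromBlocks X Y Z W) :
    (depolLin 0 0 M).submatrix (consEquiv n) (consEquiv n) =
      fromBlocks ((1 / 2 : ℂ) • (X + W)) 0 0 ((1 / 2 : ℂ) • (X + W)) := by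
  have h' : ∀ i j, M (consEquiv n i) (consEquiv n j) = fromBlocks X Y Z W i j := fun i j =>
    congrFun (congrFun h i) j
  ext (x | x) (y | y) <;>
  simp only [submatrix_apply, depolLin_zero_apply, consEquiv_inl, consEquiv_inr, Fin.cons_zero,
    Fin.update_cons_zero, Fin.sum_univ_two, fromBlocks_apply₁₁, fromBlocks_apply₁₂,
    fromBlocks_apply₂₁, fromBlocks_apply₂₂] <;>
  simp only [← consEquiv_inl, ← consEquiv_inr, h', fromBlocks_apply₁₁, fromBlocks_apply₂₂] <;> simp

lemma trace_mul_submatrix {ι κ : Type*} [Fintype ι] [Fintype κ] (e : κ ≃ ι) (A B : Matrix ι ι ℂ) :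
    (A * B).trace = (A.submatrix e e * B.submatrix e e).trace := by
  rw [submatrix_mul_equiv]
  simp only [trace, diag_apply, submatrix_apply]
  exact (e.sum_comp fun i => (A * B) i i).symm

lemma re_trace_conjTranspose_mul_comm {ι : Type*} [Fintype ι] (A B : Matrix ι ι ℂ) :
    (A * Bᴴ).trace.re = (Aᴴ * B).trace.re := by
  rw [← Complex.conj_re, ← Complex.star_def, ← trace_conjTranspose, conjTranspose_mul,
    conjTranspose_conjTranspose, trace_mul_comm]

lemma LogSobolevAt.of_blocks {M : Matrix (Fin (n + 1) → Fin 2) (Fin (n + 1) → Fin 2) ℂ}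
    (hM : M.PosSemidef) (ih : ∀ f : Matrix (Fin n → Fin 2) (Fin n → Fin 2) ℂ, LogSobolevAt f) :
    LogSobolevAt M := by
  obtain ⟨X, Y, W, hX, hW, hb⟩ : ∃ X Y W : Matrix (Fin n → Fin 2) (Fin n → Fin 2) ℂ,
      X.PosSemidef ∧ W.PosSemidef ∧
      M.submatrix (consEquiv n) (consEquiv n) = fromBlocks X Y Yᴴ W := by
    have h := hM.submatrix (consEquiv n)
    refine ⟨_, (M.submatrix (consEquiv n) (consEquiv n)).toBlocks₁₂, _, h.submatrix Sum.inl,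
      h.submatrix Sum.inr, ?_⟩
    ext (x | x) (y | y)
    · rfl
    · rfl
    · exact (hM.isHermitian.apply _ _).symm
    · rfl
  obtain ⟨A, B, hA, hB, rfl, rfl⟩ : ∃ A B : Matrix (Fin n → Fin 2) (Fin n → Fin 2) ℂ,
      A.IsHermitian ∧ B.IsHermitian ∧ X = A + B ∧ W = A - B := by
    have half : ∀ {Z : Matrix (Fin n → Fin 2) (Fin n → Fin 2) ℂ}, Z.IsHermitian →
        ((1 / 2 : ℂ) • Z).IsHermitian := fun {Z} h => by
      rw [IsHermitian, conjTranspose_smul, h.eq]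
      simp
    refine ⟨(1 / 2 : ℂ) • (X + W), (1 / 2 : ℂ) • (X - W), half (hX.isHermitian.add hW.isHermitian),
      half (hX.isHermitian.sub hW.isHermitian), ?_, ?_⟩ <;> module
  have hb' := hM.submatrix (consEquiv n)
  rw [hb] at hb'
  have k2 := specSum_mulLog_sq_add_sub_le hB hX hW
  have hBB : (fromBlocks 0 Y Yᴴ 0).IsHermitian := by
    rw [IsHermitian, fromBlocks_conjTranspose]
    simp
  have k1 := specSum_mulLog_sq_add_sub_le (A := fromBlocks (A + B) 0 0 (A - B)) hBB
    (by simpa [fromBlocks_add] using hb')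
    (by simpa [fromBlocks_sub] using hb'.fromBlocks_neg)
  have sY : specSum (fun x => mulLog (x ^ 2)) (fromBlocks 0 Y Yᴴ 0) =
      2 * specSum mulLog (Yᴴ * Y) := by
    rw [← specSum_mul_self _ hBB, fromBlocks_multiply]
    simp only [Matrix.zero_mul, Matrix.mul_zero, zero_add, add_zero]
    rw [specSum_fromBlocks_zero, specSum_mul_comm, two_mul]
  have sM : specSum mulLog (Mᴴ * M) =
      specSum (fun x => mulLog (x ^ 2)) (fromBlocks (A + B) Y Yᴴ (A - B)) := by
    rw [hM.isHermitian.eq, specSum_mul_self _ hM.isHermitian, ← hb, specSum_submatrix]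
  have sM' : specSum (fun x => mulLog (x ^ 2)) (fromBlocks (A + B) (-Y) (-Yᴴ) (A - B)) =
      specSum (fun x => mulLog (x ^ 2)) (fromBlocks (A + B) Y Yᴴ (A - B)) := by
    set J := fromBlocks (1 : Matrix (Fin n → Fin 2) (Fin n → Fin 2) ℂ) 0 0
      (-1 : Matrix (Fin n → Fin 2) (Fin n → Fin 2) ℂ) with hJ
    have hJJ : Jᴴ * J = 1 := by
      rw [hJ, fromBlocks_conjTranspose, fromBlocks_multiply]
      simp [fromBlocks_one]
    rw [← specSum_conj _ hJJ (fromBlocks (A + B) Y Yᴴ (A - B))]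
    congr 1
    rw [hJ, fromBlocks_conjTranspose, fromBlocks_multiply, fromBlocks_multiply]
    simp
  have eadd : fromBlocks (A + B) 0 0 (A - B) + fromBlocks 0 Y Yᴴ 0 =
      fromBlocks (A + B) Y Yᴴ (A - B) := by simp [fromBlocks_add]
  have esub : fromBlocks (A + B) 0 0 (A - B) - fromBlocks 0 Y Yᴴ 0 =
      fromBlocks (A + B) (-Y) (-Yᴴ) (A - B) := by simp [Matrix.fromBlocks_sub]
  rw [eadd, esub, sM', specSum_fromBlocks_zero, sY, fromBlocks_multiply, fromBlocks_multiply,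
    trace_fromBlocks', trace_fromBlocks'] at k1
  simp only [Matrix.mul_zero, zero_add, add_zero] at k1
  rw [trace_mul_comm Y, Complex.add_re, Complex.add_re] at k1
  have iA := ih A
  have iB := ih B
  have iY := ih Y
  rw [LogSobolevAt, hA.eq, specSum_mul_self _ hA] at iA
  rw [LogSobolevAt, hB.eq, specSum_mul_self _ hB] at iB
  rw [LogSobolevAt] at iY
  set a := (A * A).trace.re with ha
  set b := (B * B).trace.re with hb2
  set y := (Yᴴ * Y).trace.re with hy
  have tXW : ((A + B) * (A + B)).trace.re + ((A - B) * (A - B)).trace.re = 2 * (a + b) := by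
    rw [← Complex.add_re, ← trace_add]
    have : (A + B) * (A + B) + (A - B) * (A - B) = (A * A + A * A) + (B * B + B * B) := by
      noncomm_ring
    rw [this]
    simp only [trace_add, Complex.add_re]
    ring
  rw [tXW] at k1
  have nonneg : ∀ Z : Matrix (Fin n → Fin 2) (Fin n → Fin 2) ℂ, 0 ≤ (Zᴴ * Z).trace.re :=
    fun Z => (Complex.le_def.1 (posSemidef_conjTranspose_mul_self Z).trace_nonneg).1
  have a0 : 0 ≤ a := by have := nonneg A; rwa [hA.eq] at this
  have b0 : 0 ≤ b := by have := nonneg B; rwa [hB.eq] at this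
  have y0 : 0 ≤ y := nonneg Y
  have tM : (Mᴴ * M).trace.re = 2 * (a + b) + 2 * y := by
    rw [hM.isHermitian.eq, trace_mul_submatrix (consEquiv n), hb, fromBlocks_multiply,
      trace_fromBlocks', trace_add, trace_add, trace_mul_comm Y]
    simp only [Complex.add_re]
    linarith
  have tP0 : (Mᴴ * depolLin 0 0 M).trace.re = 2 * a := by
    rw [hM.isHermitian.eq, trace_mul_submatrix (consEquiv n), depolLin_zero_submatrix hb, hb,
      fromBlocks_multiply, trace_fromBlocks', ← trace_add]
    have : (1 / 2 : ℂ) • (A + B + (A - B)) = A := by module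
    simp only [this, Matrix.mul_zero, zero_add, add_zero]
    have : (A + B) * A + (A - B) * A = A * A + A * A := by noncomm_ring
    rw [this, trace_add, Complex.add_re]
    ring
  have tPk : ∀ k : Fin n, (Mᴴ * depolLin 0 k.succ M).trace.re =
      2 * (A * depolLin 0 k A).trace.re + 2 * (B * depolLin 0 k B).trace.re +
        2 * (Yᴴ * depolLin 0 k Y).trace.re := fun k => by
    rw [hM.isHermitian.eq, trace_mul_submatrix (consEquiv n), depolLin_succ_submatrix k hb, hb,
      fromBlocks_multiply, trace_fromBlocks', (hasKraus_depolLin_zero k).map_conjTranspose,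
      trace_add, trace_add]
    have : ((A + B) * depolLin 0 k (A + B)).trace + ((A - B) * depolLin 0 k (A - B)).trace =
        2 * (A * depolLin 0 k A).trace + 2 * (B * depolLin 0 k B).trace := by
      rw [map_add, map_sub, ← trace_add]
      have : ∀ A' B' : Matrix (Fin n → Fin 2) (Fin n → Fin 2) ℂ,
          (A + B) * (A' + B') + (A - B) * (A' - B') = (A * A' + A * A') + (B * B' + B * B') :=
        fun A' B' => by noncomm_ring
      rw [this]
      simp only [trace_add]
      ring
    have h2 := congrArg Complex.re this
    have h3 := re_trace_conjTranspose_mul_comm Y (depolLin 0 k Y)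
    have r2 : ∀ z : ℂ, (2 * z).re = 2 * z.re := fun z => by simp
    simp only [Complex.add_re, r2] at h2 ⊢
    linarith
  have tD : depolDirichlet M = (2 * b + 2 * y) +
      2 * (depolDirichlet A + depolDirichlet B + depolDirichlet Y) := by
    rw [depolDirichlet, Fin.sum_univ_succ, tM, tP0]
    simp only [tPk, depolDirichlet, hA.eq, hB.eq, ← ha, ← hb2, ← hy, ← Finset.sum_add_distrib,
      Finset.mul_sum]
    congr 1
    · ring
    · exact Finset.sum_congr rfl fun k _ => by ring
  have m1 := mulLog_mul 2 (add_nonneg a0 b0) two_ne_zero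
  have m2 := mulLog_mul 2 y0 two_ne_zero
  rw [LogSobolevAt, tM, tD, sM]
  rw [← two_mul y] at k1
  push_cast
  linarith

theorem logSobolevAt (f : Matrix (Fin n → Fin 2) (Fin n → Fin 2) ℂ) : LogSobolevAt f := by
  induction n with
  | zero =>
    have h := posSemidef_conjTranspose_mul_self f
    obtain ⟨d, hd, e⟩ := h.exists_specSum_eq_sum
    have h1 := specSum_id h.isHermitian
    rw [LogSobolevAt, ← h1, e, e]
    simp [depolDirichlet]
  | succ n ih => exact logSobolevAt_of_posSemidef (fun M hM => .of_blocks hM ih) f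

end LogSobolev

section PathDerivatives

open Filter Topology

lemma le_of_forall_eventually_sub_le {u : ℝ → ℝ} {T : ℝ} (hT : 0 ≤ T)
    (hl : ∀ s, 0 < s → ∀ ε > 0, ∀ᶠ t in 𝓝[<] s, u s - u t ≤ ε * (s - t))
    (hr : ∀ t, 0 ≤ t → ∀ ε > 0, ∀ᶠ r in 𝓝[>] t, u r ≤ u t + ε) : u T ≤ u 0 := by
  have key : ∀ ε > 0, u T - ε * T ≤ u 0 := by
    intro ε hε
    set A := {t | 0 ≤ t ∧ u T - ε * T ≤ u t - ε * t} with hA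
    have hTA : T ∈ A := ⟨hT, le_rfl⟩
    have hbdd : BddBelow A := ⟨0, fun t ht => ht.1⟩
    set a := sInf A with ha
    have ha0 : 0 ≤ a := le_csInf ⟨T, hTA⟩ fun t ht => ht.1
    have haA : a ∈ A := by
      by_contra hna
      refine hna ⟨ha0, le_of_forall_pos_le_add fun δ hδ => ?_⟩
      obtain ⟨b, hab, hb⟩ := mem_nhdsGT_iff_exists_Ioo_subset.1 (hr a ha0 δ hδ)
      obtain ⟨t, htA, htb⟩ := exists_lt_of_csInf_lt ⟨T, hTA⟩ hab
      have hat : a < t := lt_of_le_of_ne (csInf_le hbdd htA) fun h => hna (h ▸ htA)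
      have h1 : u t ≤ u a + δ := hb ⟨hat, htb⟩
      have h2 := htA.2
      nlinarith
    rcases ha0.eq_or_lt with h | h
    · have := haA.2
      rw [← h] at this
      simpa using this
    · obtain ⟨t, ht, hta, ht0⟩ := ((hl a h ε hε).and
        ((eventually_mem_nhdsWithin (s := Set.Iio a)).and
          (mem_nhdsWithin_of_mem_nhds (Ioi_mem_nhds h)))).exists
      have h3 : t ∈ A := ⟨le_of_lt ht0, by have := haA.2; linarith⟩
      exact absurd (csInf_le hbdd h3) (not_le.2 hta)
  refine le_of_forall_pos_le_add fun δ hδ => ?_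
  have h := key (δ / (T + 1)) (by positivity)
  have h1 : δ / (T + 1) * T ≤ δ := by
    rw [div_mul_eq_mul_div, div_le_iff₀ (by positivity)]
    nlinarith
  linarith

lemma HasDerivAt.eventually_sub_le {w : ℝ → ℝ} {w' s : ℝ} (h : HasDerivAt w w' s) (hw : w' ≤ 0)
    {ε : ℝ} (hε : 0 < ε) : ∀ᶠ t in 𝓝[<] s, w s - w t ≤ ε * (s - t) := by
  have h1 := (hasDerivAt_iff_tendsto_slope.1 h).eventually (gt_mem_nhds (hw.trans_lt hε))
  have h2 : 𝓝[<] s ≤ 𝓝[≠] s := nhdsWithin_mono _ fun x hx => ne_of_lt hx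
  filter_upwards [h2 h1, self_mem_nhdsWithin] with t ht hts
  have hts : t < s := hts
  rw [slope_def_field, div_lt_iff_of_neg (by linarith)] at ht
  linarith

variable {ι : Type*} [Fintype ι]

lemma stroock_varopoulos {s : ι → ι → ℝ} (hs : ∀ i j, 0 ≤ s i j) (hsymm : ∀ i j, s i j = s j i)
    (hsum : ∀ i, ∑ j, s i j = 1) {x : ι → ℝ} (hx : ∀ i, 0 < x i) {q : ℝ} (hq : 1 < q) :
    4 * (q - 1) / q ^ 2 *
      (∑ i, x i ^ q - ∑ i, x i ^ (q / 2) * ∑ j, s i j * x j ^ (q / 2)) ≤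
      ∑ i, x i ^ (q - 1) * (x i - ∑ j, s i j * x j) := by
  have form : ∀ a b : ι → ℝ, ∑ i, a i * (b i - ∑ j, s i j * b j) =
      1 / 2 * ∑ i, ∑ j, s i j * ((b i - b j) * (a i - a j)) := by
    intro a b
    have e1 : ∑ i, a i * (b i - ∑ j, s i j * b j) =
        ∑ i, ∑ j, s i j * (a i * b i - a i * b j) := by
      refine Finset.sum_congr rfl fun i _ => ?_
      calc _ = a i * b i * ∑ j, s i j - a i * ∑ j, s i j * b j := by rw [hsum]; ring
        _ = _ := by
          rw [Finset.mul_sum, Finset.mul_sum, ← Finset.sum_sub_distrib]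
          exact Finset.sum_congr rfl fun j _ => by ring
    have e2 : ∑ i, ∑ j, s i j * (a i * b i - a i * b j) =
        ∑ i, ∑ j, s i j * (a j * b j - a j * b i) := by
      rw [Finset.sum_comm]
      exact Finset.sum_congr rfl fun i _ => Finset.sum_congr rfl fun j _ => by rw [hsymm]
    have e3 : ∑ i, ∑ j, s i j * ((b i - b j) * (a i - a j)) =
        ∑ i, ∑ j, s i j * (a i * b i - a i * b j) +
        ∑ i, ∑ j, s i j * (a j * b j - a j * b i) := by
      simp only [← Finset.sum_add_distrib]
      exact Finset.sum_congr rfl fun i _ => Finset.sum_congr rfl fun j _ => by ring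
    rw [e1, e3, ← e2]
    ring
  have e : ∑ i, x i ^ q - ∑ i, x i ^ (q / 2) * ∑ j, s i j * x j ^ (q / 2) =
      ∑ i, x i ^ (q / 2) * (x i ^ (q / 2) - ∑ j, s i j * x j ^ (q / 2)) := by
    rw [← Finset.sum_sub_distrib]
    refine Finset.sum_congr rfl fun i _ => ?_
    rw [mul_sub, ← Real.rpow_add (hx i), add_halves]
  rw [e, form, form, mul_left_comm, Finset.mul_sum]
  refine mul_le_mul_of_nonneg_left (Finset.sum_le_sum fun i _ => ?_) (by norm_num)
  rw [Finset.mul_sum]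
  refine Finset.sum_le_sum fun j _ => ?_
  rw [mul_left_comm, ← sq]
  exact mul_le_mul_of_nonneg_left (rpow_half_sub_sq_le (hx i) (hx j) hq) (hs i j)

/-- Derivative of the logarithm of a weighted `ℓ_q` norm along a path with varying exponent. -/
lemma hasDerivAt_log_sum_rpow [Nonempty ι] {y : ι → ℝ → ℝ} {y' : ι → ℝ} {q : ℝ → ℝ} {q' s m : ℝ}
    (hm : 0 < m) (hy : ∀ i, HasDerivAt (y i) (y' i) s) (hpos : ∀ i, 0 < y i s)
    (hq : HasDerivAt q q' s) (hq0 : 0 < q s) :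
    HasDerivAt (fun t => 1 / q t * Real.log ((∑ i, y i t ^ q t) / m))
      ((q' / q s ^ 2 * (∑ i, mulLog (y i s ^ q s) - mulLog (∑ i, y i s ^ q s) +
        (∑ i, y i s ^ q s) * Real.log m) + ∑ i, y i s ^ (q s - 1) * y' i) /
        ∑ i, y i s ^ q s) s := by
  have hS : 0 < ∑ i, y i s ^ q s :=
    Finset.sum_pos (fun i _ => Real.rpow_pos_of_pos (hpos i) _) Finset.univ_nonempty
  have h1 : HasDerivAt (fun t => ∑ i, y i t ^ q t)
      (∑ i, (y' i * q s * y i s ^ (q s - 1) + q' * y i s ^ q s * Real.log (y i s))) s :=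
    HasDerivAt.fun_sum fun i _ => (hy i).rpow hq (hpos i)
  have h2 := ((h1.div_const m).log (div_pos hS hm).ne')
  have h3 := (hq.inv hq0.ne').mul h2
  simp only [one_div]
  refine h3.congr_deriv ?_
  have e1 : ∑ i, mulLog (y i s ^ q s) = q s * ∑ i, y i s ^ q s * Real.log (y i s) := by
    rw [Finset.mul_sum]
    refine Finset.sum_congr rfl fun i _ => ?_
    rw [mulLog, Real.log_rpow (hpos i)]
    ring
  have e2 : ∑ i, (y' i * q s * y i s ^ (q s - 1) + q' * y i s ^ q s * Real.log (y i s)) =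
      q s * ∑ i, y i s ^ (q s - 1) * y' i + q' * ∑ i, y i s ^ q s * Real.log (y i s) := by
    rw [Finset.mul_sum, Finset.mul_sum, ← Finset.sum_add_distrib]
    exact Finset.sum_congr rfl fun i _ => by ring
  rw [e1, e2, Real.log_div hS.ne' hm.ne', mulLog]
  simp only [Pi.inv_apply]
  field_simp
  ring

end PathDerivatives

section GrossMatrix

open Filter Topology

variable {n : ℕ}

lemma trace_conj_diagonal_mul {ι : Type*} [Fintype ι] [DecidableEq ι] (V M : Matrix ι ι ℂ)
    (a : ι → ℂ) : (V * diagonal a * Vᴴ * M).trace = ∑ i, a i * (Vᴴ * M * V) i i := by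
  rw [Matrix.mul_assoc, Matrix.mul_assoc, trace_mul_comm, Matrix.mul_assoc]
  simp [trace, diagonal_mul]

lemma transitionMatrix_depolLin_zero_symm (k : Fin n)
    (V : Matrix (Fin n → Fin 2) (Fin n → Fin 2) ℂ) (i j : Fin n → Fin 2) :
    transitionMatrix (depolLin 0 k) V V i j = transitionMatrix (depolLin 0 k) V V j i := by
  have h : ∀ i j, ((Vᴴ * depolLin 0 k (V * diagonal (Pi.single j 1) * Vᴴ) * V) i i) =
      (V * diagonal (Pi.single i 1) * Vᴴ *
        depolLin 0 k (V * diagonal (Pi.single j 1) * Vᴴ)).trace := fun i j => by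
    rw [trace_conj_diagonal_mul]
    simp [Pi.single_apply]
  rw [transitionMatrix, transitionMatrix, h, h, trace_mul_depolLin_zero, trace_mul_comm]

lemma logSobolev_rpow {V : Matrix (Fin n → Fin 2) (Fin n → Fin 2) ℂ} (hV : Vᴴ * V = 1)
    {x : (Fin n → Fin 2) → ℝ} (hx : ∀ i, 0 < x i) {q : ℝ} (hq : 1 < q) :
    2 * (q - 1) / q ^ 2 * (∑ i, mulLog (x i ^ q) - mulLog (∑ i, x i ^ q) +
      (∑ i, x i ^ q) * (n * Real.log 2)) ≤
      ∑ i, x i ^ (q - 1) * ∑ k, (x i - ∑ j, transitionMatrix (depolLin 0 k) V V i j * x j) := by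
  have hsq : ∀ i, x i ^ (q / 2) * x i ^ (q / 2) = x i ^ q := fun i => by
    rw [← Real.rpow_add (hx i), add_halves]
  set h := V * (diagonal fun i => ((x i ^ (q / 2) : ℝ) : ℂ)) * Vᴴ with hh
  have hherm : hᴴ = h := (isHermitian_conj_diagonal V _).eq
  have hmul : hᴴ * h = V * (diagonal fun i => ((x i ^ q : ℝ) : ℂ)) * Vᴴ := by
    rw [hherm, hh, conj_diagonal_mul hV]
    simp only [← Complex.ofReal_mul, hsq]
  have tr : (hᴴ * h).trace.re = ∑ i, x i ^ q := by
    rw [hmul, trace_conj_diagonal hV, ← Complex.ofReal_sum, Complex.ofReal_re]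
  have trk : ∀ k, (hᴴ * depolLin 0 k h).trace.re = ∑ i, x i ^ (q / 2) *
      ∑ j, transitionMatrix (depolLin 0 k) V V i j * x j ^ (q / 2) := fun k => by
    rw [hherm, hh, trace_conj_diagonal_mul, Complex.re_sum]
    simp only [Complex.re_ofReal_mul, sum_transitionMatrix_mul]
  have key := logSobolevAt h
  rw [LogSobolevAt, depolDirichlet, tr, hmul, specSum_conj_diagonal _ hV] at key
  simp only [trk] at key
  have sv := Finset.sum_le_sum fun k (_ : k ∈ Finset.univ) => stroock_varopoulos
    (transitionMatrix_nonneg (isBistochastic_depolLin le_rfl zero_le_one k) V V)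
    (transitionMatrix_depolLin_zero_symm k V)
    (sum_transitionMatrix (isBistochastic_depolLin le_rfl zero_le_one k) hV hV) hx hq
  rw [← Finset.mul_sum, Finset.sum_comm] at sv
  simp only [← Finset.mul_sum] at sv
  refine le_trans ?_ sv
  have hc : 4 * (q - 1) / q ^ 2 = 2 * (q - 1) / q ^ 2 * 2 := by ring
  rw [hc, mul_assoc]
  have : 0 ≤ 2 * (q - 1) / q ^ 2 := by
    have := sub_pos.2 hq
    positivity
  refine mul_le_mul_of_nonneg_left ?_ this
  linarith

lemma Matrix.PosDef.exists_eq_conj_diagonal {ι : Type*} [Fintype ι] [DecidableEq ι] {A : Matrix ι ι ℂ}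
    (hA : A.PosDef) : ∃ (V : Matrix ι ι ℂ) (d : ι → ℝ), Vᴴ * V = 1 ∧ (∀ i, 0 < d i) ∧
      A = V * (diagonal fun i => (d i : ℂ)) * Vᴴ := by
  obtain ⟨V, d, hV, hd, h⟩ := hA.isHermitian.exists_eq_conj_diagonal
  exact ⟨V, d, hV, fun i => by rw [hd]; exact hA.eigenvalues_pos i, h⟩

lemma IsBistochastic.posDef {ι : Type*} [Fintype ι] [DecidableEq ι]
    {Φ : Matrix ι ι ℂ →ₗ[ℂ] Matrix ι ι ℂ} (hΦ : IsBistochastic Φ) {A : Matrix ι ι ℂ}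
    (hA : A.PosSemidef) {c : ℝ} (hc : 0 < c) : (Φ (A + (c : ℂ) • 1)).PosDef := by
  rw [map_add, map_smul, hΦ.map_one]
  exact PosDef.posSemidef_add (hΦ.posSemidef hA) (PosDef.one.smul (by simpa using hc))

lemma Matrix.PosDef.re_conj_apply_pos {ι : Type*} [Fintype ι] [DecidableEq ι] {A V : Matrix ι ι ℂ}
    (hA : A.PosDef) (hV : Vᴴ * V = 1) (i : ι) : 0 < ((Vᴴ * A * V) i i).re := by
  have h : (Vᴴ * A * V).PosDef := hA.conjTranspose_mul_mul_same fun x y hxy => by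
    have := congrArg (Vᴴ *ᵥ ·) hxy
    simpa [mulVec_mulVec, hV] using this
  exact (Complex.lt_def.1 (h.diag_pos (i := i))).1

end GrossMatrix

section Gross

open Filter Topology

variable {n : ℕ}

/-- The exponent along the hypercontractive path started at `p`. -/
noncomputable def grossExponent (p t : ℝ) : ℝ := 1 + (p - 1) * Real.exp (2 * t)

/-- The logarithm of the Schatten norm along the hypercontractive path. -/
noncomputable def grossLog (p : ℝ) (f : Matrix (Fin n → Fin 2) (Fin n → Fin 2) ℂ) (t : ℝ) : ℝ :=
  1 / grossExponent p t * Real.log (specSum (fun x => x ^ grossExponent p t)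
    (depolList (Real.exp (-t)) (List.finRange n) f) / 2 ^ n)

lemma one_lt_grossExponent {p : ℝ} (hp : 1 < p) (t : ℝ) : 1 < grossExponent p t := by
  have := mul_pos (sub_pos.2 hp) (Real.exp_pos (2 * t))
  rw [grossExponent]
  linarith

lemma hasDerivAt_grossExponent (p t : ℝ) :
    HasDerivAt (grossExponent p) (2 * (grossExponent p t - 1)) t := by
  have h : HasDerivAt (fun t : ℝ => 2 * t) 2 t := by simpa using (hasDerivAt_id t).const_mul 2
  refine ((h.exp.const_mul (p - 1)).const_add 1).congr_deriv ?_
  rw [grossExponent]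
  ring

lemma convexOn_rpow_grossExponent {p : ℝ} (hp : 1 < p) (t : ℝ) :
    ConvexOn ℝ (Set.Ici 0) fun x : ℝ => x ^ grossExponent p t :=
  convexOn_rpow (one_lt_grossExponent hp t).le

variable {f : Matrix (Fin n → Fin 2) (Fin n → Fin 2) ℂ} {p : ℝ}

lemma grossLog_eventually_sub_le (hp : 1 < p)
    (hf : ∀ t, 0 ≤ t → (depolList (Real.exp (-t)) (List.finRange n) f).PosDef) {s : ℝ}
    (hs : 0 < s) {ε : ℝ} (hε : 0 < ε) :
    ∀ᶠ t in 𝓝[<] s, grossLog p f s - grossLog p f t ≤ ε * (s - t) := by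
  obtain ⟨V, x, hV, hx, hfs⟩ := (hf s hs.le).exists_eq_conj_diagonal
  set q := grossExponent p with hq
  have hq1 : ∀ t, 1 < q t := one_lt_grossExponent hp
  let y : (Fin n → Fin 2) → ℝ → ℝ := fun i t =>
    ((Vᴴ * depolList (Real.exp (-t)) (List.finRange n) f * V) i i).re
  have hys : ∀ i, y i s = x i := fun i => by
    simp only [y, hfs]
    have : Vᴴ * (V * (diagonal fun i => (x i : ℂ)) * Vᴴ) * V = diagonal fun i => (x i : ℂ) := by
      calc _ = (Vᴴ * V) * (diagonal fun i => (x i : ℂ)) * (Vᴴ * V) := by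
            simp only [Matrix.mul_assoc]
        _ = _ := by rw [hV, Matrix.one_mul, Matrix.mul_one]
    simp [this]
  have hy : ∀ i, HasDerivAt (y i)
      (-∑ k, (x i - ∑ j, transitionMatrix (depolLin 0 k) V V i j * x j)) s := fun i => by
    let φ : Matrix (Fin n → Fin 2) (Fin n → Fin 2) ℂ →ₗ[ℂ] ℂ :=
      { toFun := fun M => (Vᴴ * M * V) i i
        map_add' := fun A B => by simp [Matrix.mul_add, Matrix.add_mul]
        map_smul' := fun c A => by simp }
    have h := hasDerivAt_depolList (List.finRange n) f φ s
    have h2 := (Complex.reCLM.hasFDerivAt.comp_hasDerivAt s h)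
    refine h2.congr_deriv ?_
    rw [← List.ofFn_eq_map, List.sum_ofFn]
    simp only [Complex.reCLM_apply, Complex.neg_re, Complex.re_sum, Complex.sub_re]
    congr 1
    refine Finset.sum_congr rfl fun k _ => ?_
    have e1 := hys i
    simp only [y] at e1
    simp only [φ, LinearMap.coe_mk, AddHom.coe_mk, e1]
    rw [hfs, sum_transitionMatrix_mul]
  have hypos : ∀ t, 0 ≤ t → ∀ i, 0 < y i t := fun t ht i => (hf t ht).re_conj_apply_pos hV i
  have hder := hasDerivAt_log_sum_rpow (m := 2 ^ n) (by positivity) hy (hypos s hs.le)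
    (hasDerivAt_grossExponent p s) (zero_lt_one.trans (hq1 s))
  have hle := hder.eventually_sub_le ?_ hε
  · filter_upwards [hle, mem_nhdsWithin_of_mem_nhds (Ioi_mem_nhds hs)] with t ht ht0
    have ht0 : 0 < t := ht0
    have e : 1 / q s * Real.log ((∑ i, y i s ^ q s) / 2 ^ n) = grossLog p f s := by
      rw [grossLog, hfs, specSum_conj_diagonal _ hV]
      simp only [hys, hq]
    have e' : 1 / q t * Real.log ((∑ i, y i t ^ q t) / 2 ^ n) ≤ grossLog p f t := by
      rw [grossLog]
      have h1 := sum_apply_conj_map_le_specSum .id hV (hf t ht0.le).posSemidef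
        (convexOn_rpow_grossExponent hp t)
      have h2 : 0 < ∑ i, y i t ^ q t := Finset.sum_pos
        (fun i _ => Real.rpow_pos_of_pos (hypos t ht0.le i) _) Finset.univ_nonempty
      have h3 : 0 ≤ 1 / q t := by have := hq1 t; positivity
      refine mul_le_mul_of_nonneg_left (Real.log_le_log (by positivity) ?_) h3
      exact div_le_div_of_nonneg_right h1 (by positivity)
    linarith
  · refine div_nonpos_of_nonpos_of_nonneg ?_
      (Finset.sum_nonneg fun i _ => (Real.rpow_pos_of_pos (hypos s hs.le i) _).le)
    have h := logSobolev_rpow hV hx (hq1 s)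
    simp only [hys, mul_neg, Finset.sum_neg_distrib, Real.log_pow]
    linarith

lemma grossLog_eventually_le (hp : 1 < p)
    (hf : ∀ t, 0 ≤ t → (depolList (Real.exp (-t)) (List.finRange n) f).PosDef) {t : ℝ}
    (ht : 0 ≤ t) {ε : ℝ} (hε : 0 < ε) :
    ∀ᶠ r in 𝓝[>] t, grossLog p f r ≤ grossLog p f t + ε := by
  obtain ⟨V, x, hV, hx, hft⟩ := (hf t ht).exists_eq_conj_diagonal
  set q := grossExponent p with hq
  have hq1 : ∀ t, 1 < q t := one_lt_grossExponent hp
  have hder := hasDerivAt_log_sum_rpow (m := 2 ^ n) (by positivity)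
    (fun i => hasDerivAt_const t (x i)) hx
    (hasDerivAt_grossExponent p t) (zero_lt_one.trans (hq1 t))
  have hcont := hder.continuousAt.eventually (gt_mem_nhds (lt_add_of_pos_right _ hε))
  filter_upwards [mem_nhdsWithin_of_mem_nhds hcont, self_mem_nhdsWithin] with r hr htr
  have htr : t < r := htr
  have e : 1 / q t * Real.log ((∑ i, x i ^ q t) / 2 ^ n) = grossLog p f t := by
    rw [grossLog, hft, specSum_conj_diagonal _ hV]
  have e' : grossLog p f r ≤ 1 / q r * Real.log ((∑ i, x i ^ q r) / 2 ^ n) := by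
    rw [grossLog]
    have h0 : depolList (Real.exp (-r)) (List.finRange n) f =
        depolList (Real.exp (-(r - t))) (List.finRange n)
          (depolList (Real.exp (-t)) (List.finRange n) f) := by
      rw [← LinearMap.comp_apply, depolList_comp_depolList, ← Real.exp_add]
      congr 2
      ring_nf
    have h1 := specSum_map_le (isBistochastic_depolList (Real.exp_pos (-(r - t))).le
      (Real.exp_le_one_iff.2 (by linarith)) (List.finRange n)) (hf t ht).posSemidef
        (convexOn_rpow_grossExponent hp r)
    rw [← h0, hft, specSum_conj_diagonal _ hV] at h1
    obtain ⟨W, z, hW, hz, hfr⟩ := (hf r (by linarith)).exists_eq_conj_diagonal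
    have h2 : 0 < specSum (fun x => x ^ q r)
        (depolList (Real.exp (-r)) (List.finRange n) f) := by
      rw [hfr, specSum_conj_diagonal _ hW]
      exact Finset.sum_pos (fun i _ => Real.rpow_pos_of_pos (hz i) _) Finset.univ_nonempty
    have h3 : 0 ≤ 1 / q r := by have := hq1 r; positivity
    refine mul_le_mul_of_nonneg_left (Real.log_le_log (by positivity) ?_) h3
    exact div_le_div_of_nonneg_right h1 (by positivity)
  linarith

lemma grossLog_le (hp : 1 < p)
    (hf : ∀ t, 0 ≤ t → (depolList (Real.exp (-t)) (List.finRange n) f).PosDef) {T : ℝ}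
    (hT : 0 ≤ T) : grossLog p f T ≤ grossLog p f 0 :=
  le_of_forall_eventually_sub_le hT (fun _ hs _ hε => grossLog_eventually_sub_le hp hf hs hε)
    fun _ ht _ hε => grossLog_eventually_le hp hf ht hε

end Gross

section SchattenNorm

open Filter Topology

variable {ι : Type*} [Fintype ι] [DecidableEq ι]

lemma snorm_nonneg (p : ℝ) (f : Matrix ι ι ℂ) : 0 ≤ snorm p f := by
  rw [snorm_eq_specSum]
  exact Real.rpow_nonneg (div_nonneg (specSum_nonneg (posSemidef_conjTranspose_mul_self f)
    fun x hx => Real.rpow_nonneg hx _) (Nat.cast_nonneg _)) _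

lemma specSum_rpow_eq_snorm_rpow [Nonempty ι] {p : ℝ} (hp : p ≠ 0) (f : Matrix ι ι ℂ) :
    specSum (fun x => x ^ (p / 2)) (fᴴ * f) = Fintype.card ι * snorm p f ^ p := by
  have h := specSum_nonneg (posSemidef_conjTranspose_mul_self f)
    fun x hx => Real.rpow_nonneg hx (p / 2)
  rw [snorm_eq_specSum, one_div, Real.rpow_inv_rpow (by positivity) hp]
  field_simp

lemma specSum_rpow_eq_snorm_rpow_of_posSemidef [Nonempty ι] {p : ℝ} (hp : p ≠ 0)
    {f : Matrix ι ι ℂ} (hf : f.PosSemidef) :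
    specSum (fun x => x ^ p) f = Fintype.card ι * snorm p f ^ p := by
  have h := specSum_nonneg hf fun x hx => Real.rpow_nonneg hx p
  rw [snorm_eq_specSum_of_posSemidef p hf, one_div, Real.rpow_inv_rpow (by positivity) hp]
  field_simp

lemma snorm_le_snorm_of_exponent_le [Nonempty ι] {p q : ℝ} (hp : 0 < p) (hpq : p ≤ q)
    {f : Matrix ι ι ℂ} (hf : f.PosSemidef) : snorm p f ≤ snorm q f := by
  obtain ⟨d, hd, h⟩ := hf.exists_specSum_eq_sum
  have hq := hp.trans_le hpq
  have hcard : (0 : ℝ) < Fintype.card ι := by exact_mod_cast Fintype.card_pos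
  rw [snorm_eq_specSum_of_posSemidef p hf, snorm_eq_specSum_of_posSemidef q hf, h, h]
  have key := Real.arith_mean_le_rpow_mean Finset.univ (fun _ => (Fintype.card ι : ℝ)⁻¹)
    (fun i => d i ^ p) (fun _ _ => by positivity) (by simp [hcard.ne'])
    (fun i _ => Real.rpow_nonneg (hd i) p) ((one_le_div hp).2 hpq)
  simp only [← Finset.mul_sum, ← Real.rpow_mul (hd _), mul_div_cancel₀ q hp.ne'] at key
  rw [inv_mul_eq_div, inv_mul_eq_div] at key
  have h0 : 0 ≤ (∑ i, d i ^ q) / Fintype.card ι :=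
    div_nonneg (Finset.sum_nonneg fun i _ => Real.rpow_nonneg (hd i) q) hcard.le
  have h1 : 0 ≤ (∑ i, d i ^ p) / Fintype.card ι :=
    div_nonneg (Finset.sum_nonneg fun i _ => Real.rpow_nonneg (hd i) p) hcard.le
  refine (Real.rpow_le_rpow h1 key (by positivity)).trans_eq ?_
  rw [← Real.rpow_mul h0]
  congr 1
  field_simp

lemma continuousAt_snorm {p : ℝ} (hp : 0 < p) {f : Matrix ι ι ℂ} (hf : f.PosSemidef) :
    ContinuousAt (fun p => snorm p f) p := by
  obtain ⟨d, hd, h⟩ := hf.exists_specSum_eq_sum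
  simp only [snorm_eq_specSum_of_posSemidef _ hf, h]
  have h1 : ContinuousAt (fun p : ℝ => (∑ i, d i ^ p) / (Fintype.card ι : ℝ)) p :=
    (tendsto_finsetSum _ fun i _ => Real.continuousAt_const_rpow' hp.ne').div_const _
  exact h1.rpow (continuousAt_const.div continuousAt_id hp.ne') (Or.inr (by positivity))

lemma snorm_le_snorm_add_smul_one {p : ℝ} (hp : 0 ≤ p) {f : Matrix ι ι ℂ} (hf : f.PosSemidef)
    {c : ℝ} (hc : 0 ≤ c) : snorm p f ≤ snorm p (f + (c : ℂ) • 1) := by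
  have hfc : (f + (c : ℂ) • 1).PosSemidef :=
    hf.add (PosSemidef.one.smul (by simpa using hc))
  rw [snorm_eq_specSum_of_posSemidef p hf, snorm_eq_specSum_of_posSemidef p hfc,
    specSum_add_smul_one _ hf.isHermitian]
  obtain ⟨d, hd, h⟩ := hf.exists_specSum_eq_sum
  rw [h, h]
  refine Real.rpow_le_rpow (div_nonneg (Finset.sum_nonneg fun i _ => Real.rpow_nonneg (hd i) _)
    (Nat.cast_nonneg _)) (div_le_div_of_nonneg_right (Finset.sum_le_sum fun i _ => ?_)
      (Nat.cast_nonneg _)) (by positivity)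
  exact Real.rpow_le_rpow (hd i) (by linarith) hp

lemma tendsto_snorm_add_smul_one {p : ℝ} (hp : 0 < p) {f : Matrix ι ι ℂ} (hf : f.PosSemidef) :
    Tendsto (fun c : ℝ => snorm p (f + (c : ℂ) • 1)) (𝓝[>] 0) (𝓝 (snorm p f)) := by
  obtain ⟨d, hd, h⟩ := hf.exists_specSum_eq_sum
  have e : ∀ᶠ c : ℝ in 𝓝[>] 0, ((∑ i, (d i + c) ^ p) / Fintype.card ι) ^ (1 / p) =
      snorm p (f + (c : ℂ) • 1) := by
    filter_upwards [self_mem_nhdsWithin] with c hc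
    have hc : 0 < c := hc
    have hfc : (f + (c : ℂ) • 1).PosSemidef :=
      hf.add (PosSemidef.one.smul (by simpa using hc.le))
    rw [snorm_eq_specSum_of_posSemidef p hfc, specSum_add_smul_one _ hf.isHermitian, h]
  refine Tendsto.congr' e ?_
  have : Continuous fun c : ℝ => ((∑ i, (d i + c) ^ p) / Fintype.card ι) ^ (1 / p) :=
    ((continuous_finsetSum _ fun i _ => (continuous_const.add continuous_id).rpow_const
      fun _ => Or.inr hp.le).div_const _).rpow_const fun _ => Or.inr (by positivity)
  have h2 := this.tendsto 0
  simp only [add_zero] at h2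
  rw [snorm_eq_specSum_of_posSemidef p hf, h]
  exact h2.mono_left nhdsWithin_le_nhds

lemma two_mul_specSum_le {P Q g : Matrix ι ι ℂ} (hP : P.PosSemidef) (hQ : Q.PosSemidef)
    (h : (fromBlocks P g gᴴ Q).PosSemidef) {q : ℝ} (hq : 1 ≤ q) :
    2 * specSum (fun x => x ^ (q / 2)) (gᴴ * g) ≤
      specSum (fun x => x ^ q) P + specSum (fun x => x ^ q) Q := by
  have hH : (fromBlocks 0 g gᴴ 0).IsHermitian := by
    rw [IsHermitian, fromBlocks_conjTranspose]
    simp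
  have hG := hP.fromBlocks_zero hQ
  have eadd : fromBlocks P g gᴴ Q = fromBlocks P 0 0 Q + fromBlocks 0 g gᴴ 0 := by
    simp [fromBlocks_add]
  have esub : fromBlocks P (-g) (-gᴴ) Q = fromBlocks P 0 0 Q - fromBlocks 0 g gᴴ 0 := by
    simp [Matrix.fromBlocks_sub]
  have h' := h.fromBlocks_neg
  rw [esub] at h'
  rw [eadd] at h
  rw [← specSum_fromBlocks_zero]
  have e : 2 * specSum (fun x => x ^ (q / 2)) (gᴴ * g) =
      specSum (fun x => x ^ (q / 2)) (fromBlocks 0 g gᴴ 0 * fromBlocks 0 g gᴴ 0) := by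
    rw [fromBlocks_multiply]
    simp only [Matrix.zero_mul, Matrix.mul_zero, zero_add, add_zero]
    rw [specSum_fromBlocks_zero, specSum_mul_comm _ g, two_mul]
  rw [e, specSum_mul_self _ hH]
  obtain ⟨V, d, hV, -, hd⟩ := hH.exists_eq_conj_diagonal
  refine le_trans ?_ (sum_apply_conj_map_le_specSum .id hV hG (convexOn_rpow hq))
  have hVd : ∀ i, (Vᴴ * fromBlocks 0 g gᴴ 0 * V) i i = (d i : ℂ) := fun i => by
    rw [hd]
    have : Vᴴ * (V * (diagonal fun i => (d i : ℂ)) * Vᴴ) * V = diagonal fun i => (d i : ℂ) := by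
      calc _ = (Vᴴ * V) * (diagonal fun i => (d i : ℂ)) * (Vᴴ * V) := by
            simp only [Matrix.mul_assoc]
        _ = _ := by rw [hV, Matrix.one_mul, Matrix.mul_one]
    simp [this]
  have hle : ∀ i, |d i| ≤ ((Vᴴ * fromBlocks P 0 0 Q * V) i i).re := fun i => by
    have h1 := (Complex.le_def.1 ((h.conjTranspose_mul_mul_same V).diag_nonneg (i := i))).1
    have h2 := (Complex.le_def.1 ((h'.conjTranspose_mul_mul_same V).diag_nonneg (i := i))).1
    simp only [Matrix.mul_add, Matrix.add_mul, Matrix.mul_sub, Matrix.sub_mul, Matrix.add_apply,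
      Matrix.sub_apply, hVd, Complex.add_re, Complex.sub_re, Complex.ofReal_re,
      Complex.zero_re] at h1 h2
    exact abs_le.2 ⟨by linarith, by linarith⟩
  rw [hd, specSum_conj_diagonal _ hV]
  refine Finset.sum_le_sum fun i _ => ?_
  have hi : (d i ^ 2) ^ (q / 2) = |d i| ^ q := by
    rw [← sq_abs, ← Real.rpow_natCast, ← Real.rpow_mul (abs_nonneg _)]
    congr 1
    push_cast
    ring
  rw [hi]
  exact Real.rpow_le_rpow (abs_nonneg _) (hle i) (by linarith)

/-- Norm bounds on positive semidefinite matrices extend to all matrices. -/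
lemma HasKraus.snorm_map_le [Nonempty ι] {Φ : Matrix ι ι ℂ →ₗ[ℂ] Matrix ι ι ℂ} (hΦ : HasKraus Φ)
    {p q : ℝ} (hq : 1 ≤ q)
    (h : ∀ A : Matrix ι ι ℂ, A.PosSemidef → snorm q (Φ A) ≤ snorm p A) (f : Matrix ι ι ℂ) :
    snorm q (Φ f) ≤ snorm p f := by
  obtain ⟨P, Q, hP, hQ, eP, eQ, hM⟩ := exists_posSemidef_fromBlocks f
  have nP : snorm p P = snorm p f := by
    rw [snorm_eq_specSum, snorm_eq_specSum, hP.isHermitian.eq, eP, specSum_mul_comm]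
  have nQ : snorm p Q = snorm p f := by
    rw [snorm_eq_specSum, snorm_eq_specSum, hQ.isHermitian.eq, eQ]
  have hq0 : q ≠ 0 := by linarith
  have key := two_mul_specSum_le (hΦ.posSemidef hP) (hΦ.posSemidef hQ) (hΦ.fromBlocks hM) hq
  have hcard : (0 : ℝ) < Fintype.card ι := by exact_mod_cast Fintype.card_pos
  rw [specSum_rpow_eq_snorm_rpow hq0,
    specSum_rpow_eq_snorm_rpow_of_posSemidef hq0 (hΦ.posSemidef hP),
    specSum_rpow_eq_snorm_rpow_of_posSemidef hq0 (hΦ.posSemidef hQ), ← mul_add,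
    mul_left_comm, mul_le_mul_iff_right₀ hcard] at key
  have h1 := Real.rpow_le_rpow (snorm_nonneg _ _) (nP ▸ h P hP) (zero_le_one.trans hq)
  have h2 := Real.rpow_le_rpow (snorm_nonneg _ _) (nQ ▸ h Q hQ) (zero_le_one.trans hq)
  exact (Real.rpow_le_rpow_iff (snorm_nonneg _ _) (snorm_nonneg _ _) (by linarith : 0 < q)).1
    (by linarith)

end SchattenNorm

section Hypercontractivity

open Filter Topology

variable {n : ℕ} {f : Matrix (Fin n → Fin 2) (Fin n → Fin 2) ℂ}

lemma card_qubits : (Fintype.card (Fin n → Fin 2) : ℝ) = 2 ^ n := by simp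

lemma snorm_depolList_exp_le {p : ℝ} (hp : 1 < p) (hf : f.PosSemidef) {T : ℝ} (hT : 0 ≤ T) :
    snorm (grossExponent p T) (depolList (Real.exp (-T)) (List.finRange n) f) ≤ snorm p f := by
  have hbi : ∀ t, 0 ≤ t → IsBistochastic (depolList (Real.exp (-t)) (List.finRange n)) :=
    fun t ht => isBistochastic_depolList (Real.exp_pos _).le
      (Real.exp_le_one_iff.2 (by linarith)) _
  refine ge_of_tendsto (tendsto_snorm_add_smul_one (zero_lt_one.trans hp) hf) ?_
  filter_upwards [self_mem_nhdsWithin] with c hc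
  have hc : 0 < c := hc
  have hpd : ∀ t, 0 ≤ t →
      (depolList (Real.exp (-t)) (List.finRange n) (f + (c : ℂ) • 1)).PosDef :=
    fun t ht => (hbi t ht).posDef hf hc
  have hq1 := one_lt_grossExponent hp T
  refine (snorm_le_snorm_add_smul_one (by linarith) ((hbi T hT).posSemidef hf) hc.le).trans ?_
  have e : ∀ t, 0 ≤ t → snorm (grossExponent p t)
      (depolList (Real.exp (-t)) (List.finRange n) (f + (c : ℂ) • 1)) =
      Real.exp (grossLog p (f + (c : ℂ) • 1) t) := fun t ht => by
    obtain ⟨V, x, hV, hx, h⟩ := (hpd t ht).exists_eq_conj_diagonal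
    rw [snorm_eq_specSum_of_posSemidef _ (hpd t ht).posSemidef, grossLog, h,
      specSum_conj_diagonal _ hV, card_qubits, Real.rpow_def_of_pos, mul_comm]
    exact div_pos (Finset.sum_pos (fun i _ => Real.rpow_pos_of_pos (hx i) _)
      Finset.univ_nonempty) (by positivity)
  have e0 := e 0 le_rfl
  have eT := e T hT
  rw [map_add, map_smul, (hbi T hT).map_one] at eT
  have hp0 : grossExponent p 0 = p := by simp [grossExponent]
  rw [hp0, neg_zero, Real.exp_zero, depolList_one_left, LinearMap.id_apply] at e0
  rw [eT, e0]
  exact Real.exp_le_exp.2 (grossLog_le hp hpd hT)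

lemma snorm_depolList_le_of_pos {p q γ : ℝ} (hp : 1 < p) (hpq : p ≤ q) (hγ0 : 0 < γ)
    (hγ1 : γ ≤ Real.sqrt ((p - 1) / (q - 1))) (hf : f.PosSemidef) :
    snorm q (depolList γ (List.finRange n) f) ≤ snorm p f := by
  have hq : 0 < q - 1 := by linarith
  have hsq : γ ^ 2 * (q - 1) ≤ p - 1 := by
    rw [← le_div_iff₀ hq]
    exact (Real.le_sqrt hγ0.le (div_nonneg (by linarith) hq.le)).1 hγ1
  have hle : γ ≤ 1 := hγ1.trans (Real.sqrt_le_one.2 ((div_le_one hq).2 (by linarith)))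
  have hT : 0 ≤ -Real.log γ := neg_nonneg.2 (Real.log_nonpos hγ0.le hle)
  have h := snorm_depolList_exp_le hp hf hT
  rw [neg_neg, Real.exp_log hγ0] at h
  refine le_trans (snorm_le_snorm_of_exponent_le (by linarith) ?_
    ((isBistochastic_depolList hγ0.le hle _).posSemidef hf)) h
  have : Real.exp (2 * -Real.log γ) = (γ ^ 2)⁻¹ := by
    rw [mul_neg, Real.exp_neg, ← Real.exp_log (pow_pos hγ0 2), Real.log_pow]
    norm_num
  rw [grossExponent, this, ← div_eq_mul_inv, ← sub_le_iff_le_add', le_div_iff₀ (by positivity)]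
  linarith

lemma snorm_depolList_zero_le {p q : ℝ} (hp : 1 ≤ p) (hpq : p ≤ q) (hf : f.PosSemidef) :
    snorm q (depolList 0 (List.finRange n) f) ≤ snorm p f := by
  have hbi := isBistochastic_depolList le_rfl zero_le_one (List.finRange n)
  have hg := hbi.posSemidef hf
  have h1 : snorm 1 (depolList 0 (List.finRange n) f) = snorm 1 f := by
    simp only [snorm_eq_specSum_of_posSemidef 1 hg, snorm_eq_specSum_of_posSemidef 1 hf,
      Real.rpow_one, specSum_id hg.isHermitian, specSum_id hf.isHermitian, hbi.trace_map]
  refine le_trans ?_ (h1.le.trans (snorm_le_snorm_of_exponent_le zero_lt_one hp hf))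
  rcases (hp.trans hpq).eq_or_lt with rfl | hq
  · exact le_rfl
  refine ge_of_tendsto ((continuousAt_snorm zero_lt_one hg).tendsto.mono_left
    (nhdsWithin_le_nhds (s := Set.Ioi 1))) ?_
  filter_upwards [self_mem_nhdsWithin, mem_nhdsWithin_of_mem_nhds (Iio_mem_nhds hq)] with r hr hrq
  have hr : 1 < r := hr
  have hrq : r < q := hrq
  have h := snorm_depolList_le_of_pos hr hrq.le
    (Real.sqrt_pos.2 (div_pos (sub_pos.2 hr) (sub_pos.2 hq))) le_rfl hg
  rwa [← LinearMap.comp_apply, depolList_comp_depolList, mul_zero] at h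

end Hypercontractivity

/-- Quantum hypercontractivity for the depolarizing channel (King). -/
theorem quantum_hypercontractivity_depolarizing
    (n : ℕ) (hn : 1 ≤ n)
    (f : Matrix (Fin n → Fin 2) (Fin n → Fin 2) ℂ)
    (p q : ℝ) (hp : 1 ≤ p) (hpq : p ≤ q)
    (γ : ℝ) (hγ0 : 0 ≤ γ) (hγ1 : γ ≤ Real.sqrt ((p - 1) / (q - 1))) :
    snorm q (depolChannel γ f) ≤ snorm p f := by
  have hle : γ ≤ 1 := hγ1.trans
    (Real.sqrt_le_one.2 (div_le_one_of_le₀ (by linarith) (by linarith)))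
  rw [depolChannel_eq]
  refine (hasKraus_depolList hγ0 hle _).snorm_map_le (hp.trans hpq) (fun A hA => ?_) f
  rcases hγ0.eq_or_lt with rfl | hpos
  · exact snorm_depolList_zero_le hp hpq hA
  · refine snorm_depolList_le_of_pos (hp.lt_of_ne ?_) hpq hpos hγ1 hA
    rintro rfl
    simp at hγ1
    linarith
end
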